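/- Let a, b be integers with 2 ≤ a ≤ 10, 2 ≤ b ≤ 10 and gcd(a,b) = 1, and let c > 1 be an integer, such that none of a, b, c is a perfect power (i.e., none equals m^k for integers m ≥ 1 and k ≥ 2). If neither (a,b,c) nor (b,a,c) belongs to the set {(2,3,5), (2,3,11), (2,3,35), (2,3,259), (2,5,3), (2,5,133), (2,7,3), (3,5,2), (3,10,13)}, then there is at most one triple (x,y,z) of positive integers with a^x + b^y = c^z. -/

import Mathlib

theorem exists_submatrix_det_ne_zero {ι κ F : Type*} [Field F] [Fintype κ] [DecidableEq κ]
    (A : Matrix ι κ F) (h : ∀ c : κ → F, (∀ i, ∑ j, A i j * c j = 0) → c = 0) :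
    ∃ f : κ → ι, (A.submatrix f id).det ≠ 0 := by
  have hspan : Submodule.span F (Set.range A) = ⊤ := by
    by_contra hne
    obtain ⟨φ, hφ, hle⟩ := Submodule.exists_le_ker_of_lt_top _ (lt_top_iff_ne_top.2 hne)
    apply hφ
    have h0 := h (fun j => φ (Pi.single j 1)) (fun i => by
      have h1 : φ (A i) = 0 := hle (Submodule.subset_span ⟨i, rfl⟩)
      rw [← h1]
      conv_rhs => rw [pi_eq_sum_univ' (A i)]
      rw [map_sum]
      refine Finset.sum_congr rfl fun j _ => ?_
      rw [map_smul, smul_eq_mul])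
    refine LinearMap.pi_ext' fun j => ?_
    ext
    simpa using congrFun h0 j
  obtain ⟨τ, e, he, hs, hl⟩ := exists_linearIndependent' F A
  rw [hspan] at hs
  let bs := Module.Basis.mk hl hs.ge
  have : Finite τ := Module.Finite.finite_basis bs
  have := Fintype.ofFinite τ
  have hcard : Fintype.card κ = Fintype.card τ := by
    rw [← Module.finrank_eq_card_basis bs, Module.finrank_fintype_fun_eq_card]
  let eq := Fintype.equivOfCardEq hcard
  refine ⟨e ∘ eq, ?_⟩
  have hl2 : LinearIndependent F (A.submatrix (e ∘ eq) id).row := by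
    exact hl.comp eq eq.injective
  have := Matrix.linearIndependent_rows_iff_isUnit.1 hl2
  exact ((Matrix.isUnit_iff_isUnit_det _).1 this).ne_zero

theorem coeff_prod_sum_of_natDegree_le {ι R : Type*} [CommSemiring R] (s : Finset ι)
    (p : ι → Polynomial R) (d : ι → ℕ) (h : ∀ i ∈ s, (p i).natDegree ≤ d i) :
    (∏ i ∈ s, p i).coeff (∑ i ∈ s, d i) = ∏ i ∈ s, (p i).coeff (d i) := by
  classical
  induction s using Finset.induction_on with
  | empty => simp
  | insert a s ha ih =>
    rw [Finset.prod_insert ha, Finset.sum_insert ha, Finset.prod_insert ha,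
      Polynomial.coeff_mul_add_eq_of_natDegree_le (h a (by simp)),
      ih fun i hi => h i (by simp [hi])]
    refine (Polynomial.natDegree_prod_le _ _).trans
      (Finset.sum_le_sum fun i hi => h i (by simp [hi]))

open Polynomial in
/-- A family of polynomials `P l`, not all zero and of degree less than `K`, cannot make
`∑ l, P l (u) v ^ l` vanish on too large a sum set. -/
theorem exists_sum_eval_mul_pow_ne_zero {F ι τ : Type*} [Field F] {K L : ℕ}
    (P : Fin L → F[X]) (hdeg : ∀ l, (P l).natDegree ≤ K) {l₀ : Fin L} (hne : P l₀ ≠ 0)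
    (u v : ι → F) (hv : ∃ g : Fin L → ι, Function.Injective (v ∘ g))
    (u' v' : τ → F) (hv' : ∀ j, v' j ≠ 0) (T : Finset F) (hT : K * L < T.card)
    (hTu : ∀ t ∈ T, ∃ j, u' j = t) :
    ∃ i j, ∑ l : Fin L, (P l).eval (u i + u' j) * (v i * v' j) ^ (l : ℕ) ≠ 0 := by
  classical
  by_contra! hall
  obtain ⟨g, hg⟩ := hv
  let Λ := {l : Fin L // P l ≠ 0}
  let V : Matrix (Fin L) Λ F := fun i l => v (g i) ^ ((l : Fin L) : ℕ)
  have hV : ∀ c : Λ → F, (∀ i, ∑ j, V i j * c j = 0) → c = 0 := by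
    intro c hc
    have hdet : (Matrix.vandermonde (v ∘ g)).det ≠ 0 := Matrix.det_vandermonde_ne_zero_iff.2 hg
    let c' : Fin L → F := fun l => if h : P l ≠ 0 then c ⟨l, h⟩ else 0
    have h1 : (Matrix.vandermonde (v ∘ g)).mulVec c' = 0 := by
      funext i
      have := hc i
      simp only [Matrix.mulVec, dotProduct, Matrix.vandermonde_apply, Pi.zero_apply]
      rw [← this]
      symm
      apply Finset.sum_bij_ne_zero (fun (l : Λ) _ _ => (l : Fin L))
      · simp
      · intro a _ _ b _ _ h; exact Subtype.ext h
      · intro l _ hl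
        by_cases h : P l ≠ 0
        · exact ⟨⟨l, h⟩, Finset.mem_univ _, by simpa [c', h, V] using hl, rfl⟩
        · exact absurd hl (by simp [c', h])
      · intro l _ _
        simp [c', l.2, V]
    have h2 := Matrix.eq_zero_of_mulVec_eq_zero hdet h1
    funext l
    have := congrFun h2 l
    simpa [c', l.2] using this
  obtain ⟨f, hf⟩ := exists_submatrix_det_ne_zero V hV
  let M : Matrix Λ Λ F[X] := fun i l =>
    (P l).comp (X + C (u (g (f i)))) * C (v (g (f i)) ^ ((l : Fin L) : ℕ))
  let d : Λ → ℕ := fun l => (P l).natDegree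
  have hMdeg : ∀ i l, (M i l).natDegree ≤ d l := by
    intro i l
    refine (natDegree_mul_C_le _ _).trans ?_
    rw [natDegree_comp]
    simp [d]
  have hMcoeff : ∀ i l, (M i l).coeff (d l) = V (f i) l * (P l).leadingCoeff := by
    intro i l
    have : ((P l).comp (X + C (u (g (f i))))).coeff (d l) = (P l).leadingCoeff := by
      have h1 := leadingCoeff_comp (p := P l) (q := X + C (u (g (f i)))) (by simp)
      rw [leadingCoeff_X_add_C, one_pow, mul_one] at h1
      rw [← h1, leadingCoeff, natDegree_comp]
      simp [d]
    simp only [M, coeff_mul_C, this, V]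
    ring
  have hcoeff : M.det.coeff (∑ l, d l) = (V.submatrix f id).det * ∏ l : Λ, (P l).leadingCoeff := by
    rw [Matrix.det_apply, Matrix.det_apply, finsetSum_coeff, Finset.sum_mul]
    refine Finset.sum_congr rfl fun σ _ => ?_
    rw [Units.smul_def, Units.smul_def, coeff_smul, coeff_prod_sum_of_natDegree_le _ _ _
      (fun i _ => hMdeg (σ i) i)]
    simp only [hMcoeff, Finset.prod_mul_distrib, Matrix.submatrix_apply, id, smul_mul_assoc]
  have hdet0 : M.det ≠ 0 := by
    intro h0
    rw [h0, coeff_zero] at hcoeff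
    have : (∏ l : Λ, (P l).leadingCoeff) ≠ 0 :=
      Finset.prod_ne_zero_iff.2 fun l _ => leadingCoeff_ne_zero.2 l.2
    exact (mul_ne_zero hf this) hcoeff.symm
  have hdegdet : M.det.natDegree ≤ K * L := by
    rw [Matrix.det_apply]
    refine natDegree_sum_le_of_forall_le _ _ fun σ _ => ?_
    rw [Units.smul_def]
    refine (natDegree_smul_le _ _).trans ?_
    refine (natDegree_prod_le _ _).trans ?_
    calc ∑ i, (M (σ i) i).natDegree ≤ ∑ i : Λ, K :=
          Finset.sum_le_sum fun i _ => (hMdeg _ i).trans (hdeg i)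
      _ = Fintype.card Λ * K := by simp
      _ ≤ L * K := by
          gcongr
          exact (Fintype.card_subtype_le (fun l : Fin L => P l ≠ 0)).trans_eq (Fintype.card_fin L)
      _ = K * L := mul_comm _ _
  have hroots : T.card ≤ M.det.natDegree := by
    refine Polynomial.card_le_degree_of_subset_roots (p := M.det) ?_
    intro t ht
    rw [mem_roots hdet0, IsRoot.def]
    obtain ⟨j, hj⟩ := hTu t ht
    have h1 : M.det.eval t = (M.map (eval t)).det := by
      have := RingHom.map_det (evalRingHom t) M
      simpa [RingHom.mapMatrix_apply] using this
    rw [h1]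
    refine Matrix.exists_mulVec_eq_zero_iff.1 ⟨fun l => v' j ^ ((l : Fin L) : ℕ), ?_, ?_⟩
    · intro h
      have := congrFun h ⟨l₀, hne⟩
      exact pow_ne_zero _ (hv' j) this
    · funext i
      have h2 := hall (g (f i)) j
      simp only [Matrix.mulVec, dotProduct, Matrix.map_apply, Pi.zero_apply]
      rw [← h2]
      refine Finset.sum_bij_ne_zero (fun (l : Λ) _ _ => (l : Fin L)) (by simp)
        (fun a _ _ b _ _ h => Subtype.ext h) ?_ ?_
      · intro l _ hl
        have hl' : P l ≠ 0 := by
          intro h; simp [h] at hl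
        refine ⟨⟨l, hl'⟩, Finset.mem_univ _, ?_, rfl⟩
        simpa [M, hj, mul_pow, mul_assoc, add_comm] using hl
      · intro l _ _
        simp [M, hj, mul_pow, mul_assoc, add_comm]
  omega

theorem card_image_lattice_box {X Y m : ℕ} (hXY : Nat.Coprime X Y) (h : m ≤ X ∨ m ≤ Y)
    (hX : 0 < X) (hY : 0 < Y) :
    ((Finset.range m ×ˢ Finset.range m).image fun p : ℕ × ℕ => p.1 * Y + p.2 * X).card = m * m := by
  rw [Finset.card_image_of_injOn, Finset.card_product, Finset.card_range]
  rintro ⟨r, s⟩ h1 ⟨r', s'⟩ h2 heq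
  simp only [Finset.coe_product, Finset.coe_range, Set.mem_prod, Set.mem_Iio] at h1 h2
  simp only at heq
  have key : r = r' ∨ s = s' := by
    rcases h with h | h
    · left
      have h3 : r * Y ≡ r' * Y [MOD X] := by
        have : (r * Y + s * X) % X = (r' * Y + s' * X) % X := by rw [heq]
        simpa [Nat.ModEq] using this
      have h4 := Nat.ModEq.cancel_right_of_coprime hXY h3
      exact Nat.ModEq.eq_of_lt_of_lt h4 (by omega) (by omega)
    · right
      have h3 : s * X ≡ s' * X [MOD Y] := by
        have : (r * Y + s * X) % Y = (r' * Y + s' * X) % Y := by rw [heq]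
        simpa [Nat.ModEq] using this
      have h4 := Nat.ModEq.cancel_right_of_coprime hXY.symm h3
      exact Nat.ModEq.eq_of_lt_of_lt h4 (by omega) (by omega)
  rcases key with rfl | rfl
  · have : s = s' := Nat.eq_of_mul_eq_mul_right hX (by omega)
    rw [this]
  · have : r = r' := Nat.eq_of_mul_eq_mul_right hY (by omega)
    rw [this]

/-- Nonvanishing of an interpolation determinant attached to `a`, `b` and the linear form
`r * Y + s * X`. -/
theorem exists_interpolation_det_ne_zero {a b X Y K L m : ℕ} (ha : 2 ≤ a) (hb : 0 < b)
    (hXY : Nat.Coprime X Y) (h : m ≤ X ∨ m ≤ Y) (hX : 0 < X) (hY : 0 < Y)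
    (hm : (K - 1) * L < m * m) :
    ∃ r s : Fin K × Fin L → ℕ, (∀ i, r i < L + m) ∧ (∀ i, s i < m) ∧
      (Matrix.of fun i j : Fin K × Fin L =>
        ((r i * Y + s i * X : ℕ) : ℤ) ^ (j.1 : ℕ) *
          ((a ^ r i * b ^ s i : ℕ) : ℤ) ^ (j.2 : ℕ)).det ≠ 0 := by
  let ι := Fin (L + m) × Fin m
  let A : Matrix ι (Fin K × Fin L) ℚ := fun i j =>
    ((i.1 * Y + i.2 * X : ℕ) : ℚ) ^ (j.1 : ℕ) * ((a ^ (i.1 : ℕ) * b ^ (i.2 : ℕ) : ℕ) : ℚ) ^ (j.2 : ℕ)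
  have hcols : ∀ c : Fin K × Fin L → ℚ, (∀ i, ∑ j, A i j * c j = 0) → c = 0 := by
    intro c hc
    by_contra hne
    obtain ⟨⟨k₀, l₀⟩, hj⟩ := Function.ne_iff.1 hne
    let P : Fin L → Polynomial ℚ := fun l => ∑ k : Fin K, Polynomial.monomial (k : ℕ) (c (k, l))
    have hPc : ∀ l (k : Fin K), (P l).coeff k = c (k, l) := by
      intro l k
      simp [P, Polynomial.finsetSum_coeff, Polynomial.coeff_monomial, Fin.val_inj]
    have hPdeg : ∀ l, (P l).natDegree ≤ K - 1 := by
      intro l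
      refine Polynomial.natDegree_sum_le_of_forall_le _ _ fun k _ => ?_
      refine (Polynomial.natDegree_monomial_le _).trans ?_
      have := k.2
      omega
    have hP0 : P l₀ ≠ 0 := by
      intro h0
      apply hj
      rw [← hPc, h0]; simp
    have hm0 : 0 < m := by
      rcases Nat.eq_zero_or_pos m with rfl | h
      · simp at hm
      · exact h
    let T : Finset ℚ := ((Finset.range m ×ˢ Finset.range m).image
      fun p : ℕ × ℕ => p.1 * Y + p.2 * X).map Nat.castEmbedding
    have hTcard : (K - 1) * L < T.card := by
      rw [Finset.card_map, card_image_lattice_box hXY h hX hY]; exact hm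
    obtain ⟨i, j, hij⟩ := exists_sum_eval_mul_pow_ne_zero (ι := Fin L) (τ := Fin m × Fin m)
      P hPdeg hP0 (fun i => (((i : ℕ) * Y : ℕ) : ℚ)) (fun i => ((a ^ (i : ℕ) : ℕ) : ℚ))
      ⟨id, by
        intro i j hij
        have : a ^ (i : ℕ) = a ^ (j : ℕ) := Nat.cast_injective (R := ℚ) hij
        exact Fin.ext (Nat.pow_right_injective ha this)⟩
      (fun j => ((j.1 * Y + j.2 * X : ℕ) : ℚ)) (fun j => ((a ^ (j.1 : ℕ) * b ^ (j.2 : ℕ) : ℕ) : ℚ))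
      (fun j => by positivity) T hTcard (by
        intro t ht
        simp only [T, Finset.mem_map, Finset.mem_image, Finset.mem_product, Finset.mem_range] at ht
        obtain ⟨_, ⟨⟨r, s⟩, ⟨hr, hs⟩, rfl⟩, rfl⟩ := ht
        exact ⟨(⟨r, hr⟩, ⟨s, hs⟩), rfl⟩)
    apply hij
    have hc' := hc (⟨(i : ℕ) + j.1, by omega⟩, j.2)
    rw [← hc', Fintype.sum_prod_type_right]
    refine Finset.sum_congr rfl fun l _ => ?_
    rw [Polynomial.eval_finsetSum, Finset.sum_mul]
    refine Finset.sum_congr rfl fun k _ => ?_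
    simp only [Polynomial.eval_monomial, A]
    push_cast
    ring
  obtain ⟨f, hf⟩ := exists_submatrix_det_ne_zero A hcols
  refine ⟨fun i => (f i).1, fun i => (f i).2, fun i => (f i).1.2, fun i => (f i).2.2, ?_⟩
  intro h0
  apply hf
  have h1 := congrArg (Int.castRingHom ℚ) h0
  rw [RingHom.map_det, map_zero] at h1
  rw [← h1]
  congr 1
  ext i j
  simp only [Matrix.submatrix, A]
  simp

/-- Rows of the determinants that occur when expanding rows of the shape
`∑ i, q ^ i * F i ρ * G i + q ^ n * E ρ`. -/
def expansionRow {κ R : Type*} [CommRing R] {n : ℕ} (F : Fin n → κ → R) (G : Fin n → κ → R)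
    (E : κ → κ → R) (φ : κ → Option (Fin n)) : Matrix κ κ R := fun ρ j =>
  (φ ρ).elim (E ρ j) fun i => F i ρ * G i j

theorem sum_range_le_sum_elim {κ : Type*} [Fintype κ] [DecidableEq κ] {n : ℕ}
    (hn : Fintype.card κ = n)
    (φ : κ → Option (Fin n)) (hφ : ∀ ρ ρ' i, φ ρ = some i → φ ρ' = some i → ρ = ρ') :
    ∑ i ∈ Finset.range n, i ≤ ∑ ρ, (φ ρ).elim n fun i => (i : ℕ) := by
  let A := Finset.univ.filter fun ρ => (φ ρ).isSome
  let B : Finset ℕ := A.image fun ρ => (φ ρ).elim n fun i => (i : ℕ)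
  have hinj : Set.InjOn (fun ρ => (φ ρ).elim n fun i => (i : ℕ)) A := by
    intro ρ h1 ρ' h2 h
    simp only [A, Finset.coe_filter, Set.mem_ofPred_eq, Finset.mem_univ, true_and,
      Option.isSome_iff_exists] at h1 h2
    obtain ⟨i, hi⟩ := h1
    obtain ⟨i', hi'⟩ := h2
    simp only [hi, hi', Option.elim] at h
    have := Fin.ext h
    subst this
    exact hφ _ _ _ hi hi'
  have hB : ∑ ρ ∈ A, ((φ ρ).elim n fun i => (i : ℕ)) = ∑ x ∈ B, x :=
    (Finset.sum_image (f := fun x : ℕ => x) hinj).symm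
  have hBcard : B.card = A.card := Finset.card_image_of_injOn hinj
  have hBsub : B ⊆ Finset.range n := by
    intro x hx
    simp only [B, A, Finset.mem_image, Finset.mem_filter, Finset.mem_univ, true_and,
      Option.isSome_iff_exists] at hx
    obtain ⟨ρ, ⟨i, hi⟩, rfl⟩ := hx
    simp [hi]
  have hA : ∑ ρ ∈ Finset.univ \ A, ((φ ρ).elim n fun i => (i : ℕ)) = (n - A.card) * n := by
    rw [Finset.sum_congr rfl (g := fun _ => n), Finset.sum_const, smul_eq_mul,
      Finset.card_sdiff_of_subset (Finset.subset_univ _), Finset.card_univ, hn]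
    intro ρ hρ
    simp only [A, Finset.mem_sdiff, Finset.mem_filter, Finset.mem_univ, true_and,
      Bool.not_eq_true, Option.isSome_eq_false_iff, Option.isNone_iff_eq_none] at hρ
    simp [hρ]
  rw [← Finset.sum_sdiff (Finset.subset_univ A), hA, hB, ← Finset.sum_sdiff hBsub]
  gcongr
  calc ∑ x ∈ Finset.range n \ B, x ≤ ∑ x ∈ Finset.range n \ B, n :=
        Finset.sum_le_sum fun x hx => (Finset.mem_range.1 (Finset.mem_sdiff.1 hx).1).le
    _ = _ := by
      rw [Finset.sum_const, smul_eq_mul, Finset.card_sdiff_of_subset hBsub, Finset.card_range,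
        hBcard]

theorem exists_det_eq_pow_mul_sum {κ R : Type*} [CommRing R] [Fintype κ] [DecidableEq κ] {n : ℕ}
    (hn : Fintype.card κ = n) (q : R) (F G : Fin n → κ → R) (E : κ → κ → R) (A : Matrix κ κ R)
    (hA : ∀ ρ j, A ρ j = ∑ i : Fin n, q ^ (i : ℕ) * (F i ρ * G i j) + q ^ n * E ρ j) :
    ∃ e : (κ → Option (Fin n)) → ℕ,
      A.det = q ^ (n * (n - 1) / 2) * ∑ φ, q ^ e φ * (expansionRow F G E φ).det := by
  classical
  let w : Option (Fin n) → ℕ := fun o => o.elim n fun i => (i : ℕ)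
  have h1 : A = fun ρ => ∑ o : Option (Fin n), q ^ w o •
      (o.elim (E ρ) fun i => fun j => F i ρ * G i j) := by
    funext ρ j
    rw [hA, Finset.sum_apply, Fintype.sum_option, add_comm]
    simp [w]
  have h2 : A.det = ∑ φ : κ → Option (Fin n),
      q ^ (∑ ρ, w (φ ρ)) * (expansionRow F G E φ).det := by
    change (Matrix.detRowAlternating (R := R) (n := κ)).toMultilinearMap A = _
    rw [h1, MultilinearMap.map_sum]
    refine Finset.sum_congr rfl fun φ _ => ?_
    rw [MultilinearMap.map_smul_univ, Finset.prod_pow_eq_pow_sum, smul_eq_mul]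
    congr 1
    change Matrix.det _ = _
    congr 1
    funext ρ j
    simp only [expansionRow]
    cases φ ρ <;> rfl
  refine ⟨fun φ => (∑ ρ, w (φ ρ)) - n * (n - 1) / 2, ?_⟩
  rw [h2, Finset.mul_sum]
  refine Finset.sum_congr rfl fun φ _ => ?_
  by_cases hφ : ∀ ρ ρ' i, φ ρ = some i → φ ρ' = some i → ρ = ρ'
  · rw [← mul_assoc, ← pow_add]
    congr 2
    have := sum_range_le_sum_elim hn φ hφ
    rw [Finset.sum_range_id] at this
    simp only [w]
    omega
  · push Not at hφ
    obtain ⟨ρ, ρ', i, h3, h4, h5⟩ := hφ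
    have : (expansionRow F G E φ).det = 0 := by
      let M := (expansionRow F G E φ)
      let N : Matrix κ κ R := Matrix.updateRow (Matrix.updateRow M ρ (G i)) ρ' (G i)
      have hM : M = Matrix.updateRow (Matrix.updateRow N ρ (F i ρ • G i)) ρ' (F i ρ' • G i) := by
        ext x j
        by_cases hx' : x = ρ'
        · subst hx'; simp [M, expansionRow, h4]
        · by_cases hx : x = ρ
          · subst hx; simp [M, expansionRow, h3, Matrix.updateRow_ne hx']
          · simp [N, Matrix.updateRow_ne hx', Matrix.updateRow_ne hx]
      change M.det = 0
      rw [hM, Matrix.det_updateRow_smul, Matrix.updateRow_comm _ h5, Matrix.det_updateRow_smul]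
      rw [Matrix.det_zero_of_row_eq h5 (M := _)]
      · simp
      · rw [Matrix.updateRow_self, Matrix.updateRow_ne h5.symm, Matrix.updateRow_self]
    rw [this]; simp

theorem exists_binomial_expansion {g : ℤ} (hg : 8 ∣ g - 1) (k l : ℕ) :
    ∃ G : ℕ → ℤ, (∀ i, 8 ^ i ∣ 8 ^ k * G i) ∧
      ∀ t : ℕ, (t : ℤ) ^ k * g ^ (l * t) = ∑ i ∈ Finset.range (t + 1), (t.choose i : ℤ) * G i := by
  induction k with
  | zero =>
    refine ⟨fun i => (g ^ l - 1) ^ i, fun i => ?_, fun t => ?_⟩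
    · rw [pow_zero, one_mul]
      exact pow_dvd_pow_of_dvd (hg.trans (sub_one_dvd_pow_sub_one g l)) i
    · have := add_pow (g ^ l - 1) 1 t
      rw [sub_add_cancel] at this
      rw [pow_zero, one_mul, pow_mul, this]
      exact Finset.sum_congr rfl fun i _ => by rw [one_pow]; ring
  | succ k ih =>
    obtain ⟨G, hG, hsum⟩ := ih
    refine ⟨fun i => i * (G i + G (i - 1)), fun i => ?_, fun t => ?_⟩
    · rcases i with _ | i
      · simp
      · have h1 := hG (i + 1)
        have h2 := hG i
        change _ ∣ 8 ^ (k + 1) * (((i + 1 : ℕ) : ℤ) * (G (i + 1) + G i))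
        have : (8 : ℤ) ^ (k + 1) * (((i + 1 : ℕ) : ℤ) * (G (i + 1) + G i)) =
          ((i + 1 : ℕ) : ℤ) * (8 * (8 ^ k * G (i + 1)) + 8 * (8 ^ k * G i)) := by ring
        rw [this]
        refine Dvd.dvd.mul_left (dvd_add (h1.mul_left 8) ?_) _
        rw [pow_succ']
        exact mul_dvd_mul_left 8 h2
    · have h1 : (t : ℤ) ^ (k + 1) * g ^ (l * t) =
          ∑ i ∈ Finset.range (t + 1), ((i * t.choose i : ℤ) * G i +
            ((i + 1 : ℕ) * t.choose (i + 1) : ℤ) * G i) := by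
        rw [pow_succ', mul_assoc, hsum, Finset.mul_sum]
        refine Finset.sum_congr rfl fun i hi => ?_
        have hi' : i ≤ t := Nat.lt_succ_iff.1 (Finset.mem_range.1 hi)
        have h2 := Nat.choose_succ_right_eq t i
        zify [hi'] at h2
        push_cast
        linear_combination (-(G i)) * h2
      rw [h1, Finset.sum_add_distrib]
      have h3 : ∑ i ∈ Finset.range (t + 1), (((i + 1 : ℕ) : ℤ) * t.choose (i + 1)) * G i =
          ∑ i ∈ Finset.range (t + 1), ((i : ℤ) * t.choose i) * G (i - 1) := by
        rw [Finset.sum_range_succ, Finset.sum_range_succ' (fun i => ((i : ℤ) * t.choose i) * G (i - 1))]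
        simp
      rw [h3, ← Finset.sum_add_distrib]
      exact Finset.sum_congr rfl fun i _ => by ring

theorem eight_pow_dvd_det {κ : Type*} [Fintype κ] [DecidableEq κ] {n K N : ℕ}
    (hn : Fintype.card κ = n) {g : ℤ} (hg : 8 ∣ g - 1) (hN : 3 * n ≤ N)
    (t : κ → ℕ) (k l : κ → ℕ) (hk : ∀ j, k j ≤ K) (A : Matrix κ κ ℤ)
    (hA : ∀ i j, (2 : ℤ) ^ N ∣ A i j - (t i : ℤ) ^ k j * g ^ (l j * t i)) :
    (8 : ℤ) ^ (n * (n - 1) / 2) ∣ 8 ^ (K * n) * A.det := by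
  choose G hG hsum using fun j : κ => exists_binomial_expansion hg (k j) (l j)
  have hG' : ∀ j i, (8 : ℤ) ^ i ∣ 8 ^ K * G j i := by
    intro j i
    refine (hG j i).trans (mul_dvd_mul_right (pow_dvd_pow 8 (hk j)) _)
  choose H hH using hG'
  have hN' : (8 : ℤ) ^ n ∣ 2 ^ N := by
    rw [show (8 : ℤ) = 2 ^ 3 by norm_num, ← pow_mul]
    exact pow_dvd_pow 2 hN
  have hE : ∀ ρ j, (8 : ℤ) ^ n ∣
      8 ^ K * A ρ j - ∑ i : Fin n, 8 ^ (i : ℕ) * ((t ρ).choose i * H j i) := by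
    intro ρ j
    have h1 : (8 : ℤ) ^ n ∣ 8 ^ K * (A ρ j - (t ρ : ℤ) ^ k j * g ^ (l j * t ρ)) :=
      (hN'.trans (hA ρ j)).mul_left _
    have h2 : (8 : ℤ) ^ n ∣ 8 ^ K * ((t ρ : ℤ) ^ k j * g ^ (l j * t ρ)) -
        ∑ i : Fin n, 8 ^ (i : ℕ) * ((t ρ).choose i * H j i) := by
      have h3 : (8 : ℤ) ^ K * ((t ρ : ℤ) ^ k j * g ^ (l j * t ρ)) =
          ∑ i ∈ Finset.range (n + (t ρ + 1)), 8 ^ i * (((t ρ).choose i : ℤ) * H j i) := by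
        rw [hsum, Finset.mul_sum]
        have h4 : Finset.range (t ρ + 1) ⊆ Finset.range (n + (t ρ + 1)) :=
          Finset.range_subset_range.2 (Nat.le_add_left _ _)
        rw [← Finset.sum_subset h4]
        · exact Finset.sum_congr rfl fun i _ => by linear_combination ((t ρ).choose i : ℤ) * hH j i
        · intro i _ hi
          rw [Nat.choose_eq_zero_of_lt (by simpa using hi)]
          simp
      rw [h3, Finset.sum_range_add, Fin.sum_univ_eq_sum_range
        (fun i => (8 : ℤ) ^ i * (((t ρ).choose i : ℤ) * H j i)), add_sub_cancel_left]
      refine Finset.dvd_sum fun i _ => ?_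
      rw [pow_add, mul_assoc]
      exact Dvd.intro _ rfl
    have := dvd_add h1 h2
    rwa [mul_sub, sub_add_sub_cancel] at this
  choose E hE using hE
  obtain ⟨e, he⟩ := exists_det_eq_pow_mul_sum hn (8 : ℤ) (fun i ρ => ((t ρ).choose i : ℤ))
    (fun i j => H j i) E ((8 ^ K : ℤ) • A) (fun ρ j => by
      rw [← hE]
      simp)
  rw [Matrix.det_smul, hn, ← pow_mul] at he
  rw [he]
  exact Dvd.intro _ rfl

theorem exists_common_root_mod_two_pow {a b X Y N : ℕ} (ha : (8 : ℤ) ∣ a - 1) (hb : (8 : ℤ) ∣ b - 1)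
    (hX : Odd X) (h : (a : ℤ) ^ X ≡ b ^ Y [ZMOD 2 ^ N]) :
    ∃ g : ℤ, 8 ∣ g - 1 ∧ (a : ℤ) ≡ g ^ Y [ZMOD 2 ^ N] ∧ (b : ℤ) ≡ g ^ X [ZMOD 2 ^ N] := by
  have hcop : Nat.Coprime X (2 ^ (N + 1)) := (Nat.coprime_two_right.2 hX).pow_right _
  obtain ⟨Z, hZ⟩ := Nat.exists_mul_mod_eq_one_of_coprime hcop
    (Nat.one_lt_two_pow (by omega))
  have key : ∀ d : ℕ, (8 : ℤ) ∣ d - 1 → (d : ℤ) ^ (X * Z) ≡ d [ZMOD 2 ^ N] := by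
    intro d hd
    have hdodd : Nat.Coprime d (2 ^ (N + 1)) := by
      refine Nat.Coprime.pow_right _ (Nat.coprime_two_right.2 ?_)
      rw [← Nat.not_even_iff_odd]
      rintro ⟨r, hr⟩
      omega
    have h1 := Nat.ModEq.pow_totient hdodd
    rw [Nat.totient_prime_pow Nat.prime_two (by omega)] at h1
    simp only [Nat.add_sub_cancel, Nat.reduceSub, mul_one] at h1
    have h2 : (d : ℤ) ^ (2 ^ N) ≡ 1 [ZMOD 2 ^ N] := by
      have h3 := (Int.natCast_modEq_iff.2 h1)
      push_cast at h3
      exact h3.of_dvd (pow_dvd_pow 2 (by omega))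
    obtain ⟨q, hq⟩ : ∃ q, X * Z = 1 + 2 ^ N * q := by
      refine ⟨2 * (X * Z / 2 ^ (N + 1)), ?_⟩
      have := Nat.div_add_mod (X * Z) (2 ^ (N + 1))
      rw [hZ.2] at this
      rw [← mul_assoc, ← pow_succ]
      omega
    rw [hq, pow_add, pow_one, pow_mul]
    simpa using (h2.pow q).mul_left (d : ℤ)
  refine ⟨(b : ℤ) ^ Z, hb.trans (sub_one_dvd_pow_sub_one _ _), ?_, ?_⟩
  · refine (key a ha).symm.trans ?_
    rw [pow_mul, ← pow_mul (b : ℤ), mul_comm Z Y, pow_mul (b : ℤ)]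
    exact h.pow Z
  · rw [← pow_mul, mul_comm]
    exact (key b hb).symm

theorem not_modEq_two_pow_of_lt {a b X Y K L m N : ℕ} (ha : (8 : ℤ) ∣ a - 1)
    (hb : (8 : ℤ) ∣ b - 1) (ha2 : 2 ≤ a) (hb2 : 2 ≤ b) (hX : 0 < X) (hY : 0 < Y)
    (hXY : Nat.Coprime X Y) (h : m ≤ X ∨ m ≤ Y) (hm : (K - 1) * L < m * m) (hN : 3 * (K * L) ≤ N)
    (hsize : 8 ^ (K * (K * L)) * ((K * L).factorial *
      (((L + m) * Y + m * X) ^ K * (a ^ (L + m) * b ^ m) ^ L) ^ (K * L)) <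
        8 ^ (K * L * (K * L - 1) / 2)) :
    ¬ (a : ℤ) ^ X ≡ b ^ Y [ZMOD 2 ^ N] := by
  intro hmod
  have hroot : ∃ g : ℤ, 8 ∣ g - 1 ∧ (a : ℤ) ≡ g ^ Y [ZMOD 2 ^ N] ∧ (b : ℤ) ≡ g ^ X [ZMOD 2 ^ N] := by
    rcases Nat.even_or_odd X with hXe | hXo
    · have hYo : Odd Y := by
        rw [← Nat.not_even_iff_odd]
        intro hYe
        have := Nat.dvd_gcd hXe.two_dvd hYe.two_dvd
        rw [Nat.Coprime] at hXY
        omega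
      obtain ⟨g, h1, h2, h3⟩ := exists_common_root_mod_two_pow hb ha hYo hmod.symm
      exact ⟨g, h1, h3, h2⟩
    · exact exists_common_root_mod_two_pow ha hb hXo hmod
  obtain ⟨g, hg, hga, hgb⟩ := hroot
  obtain ⟨r, s, hr, hs, hdet⟩ := exists_interpolation_det_ne_zero (K := K) (L := L) (m := m)
    ha2 (by omega : 0 < b) hXY h hX hY hm
  set A := (Matrix.of fun i j : Fin K × Fin L =>
        ((r i * Y + s i * X : ℕ) : ℤ) ^ (j.1 : ℕ) *
          ((a ^ r i * b ^ s i : ℕ) : ℤ) ^ (j.2 : ℕ)) with hA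
  have hcard : Fintype.card (Fin K × Fin L) = K * L := by simp
  have hdvd := eight_pow_dvd_det (K := K) hcard hg hN (fun i => r i * Y + s i * X)
    (fun j => (j.1 : ℕ)) (fun j => (j.2 : ℕ)) (fun j => j.1.2.le) A (by
      intro i j
      rw [← Int.modEq_iff_dvd]
      simp only [hA, Matrix.of_apply]
      refine Int.ModEq.mul_left _ ?_
      rw [mul_comm, pow_mul, Nat.cast_mul, Nat.cast_pow, Nat.cast_pow, pow_add, mul_comm (r i),
        mul_comm (s i), pow_mul, pow_mul]
      exact (((hga.pow _).mul (hgb.pow _)).pow _).symm)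
  have hbound : |A.det| ≤ ((K * L).factorial : ℤ) *
      ((((L + m) * Y + m * X) ^ K * (a ^ (L + m) * b ^ m) ^ L : ℕ) : ℤ) ^ (K * L) := by
    have := Matrix.det_le (A := A) (abv := AbsoluteValue.abs)
      (x := ((((L + m) * Y + m * X) ^ K * (a ^ (L + m) * b ^ m) ^ L : ℕ) : ℤ)) (by
        intro i j
        simp only [hA, Matrix.of_apply]
        rw [AbsoluteValue.abs_apply, abs_of_nonneg (by positivity)]
        norm_cast
        refine Nat.mul_le_mul ?_ ?_
        · calc (r i * Y + s i * X) ^ (j.1 : ℕ) ≤ ((L + m) * Y + m * X) ^ (j.1 : ℕ) := by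
                gcongr
                · exact (hr i).le
                · exact (hs i).le
            _ ≤ _ := by
              apply Nat.pow_le_pow_right _ j.1.2.le
              have := hr i
              exact Nat.add_pos_left (Nat.mul_pos (by omega) hY) _
        · calc (a ^ r i * b ^ s i) ^ (j.2 : ℕ) ≤ (a ^ (L + m) * b ^ m) ^ (j.2 : ℕ) := by
                gcongr
                · omega
                · exact (hr i).le
                · omega
                · exact (hs i).le
            _ ≤ _ := Nat.pow_le_pow_right (by positivity) j.2.2.le)
    rw [hcard, AbsoluteValue.abs_apply, nsmul_eq_mul] at this
    exact_mod_cast this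
  have h1 := Int.le_of_dvd (by positivity) ((dvd_abs _ _).2 hdvd)
  rw [abs_mul, abs_of_nonneg (by positivity : (0 : ℤ) ≤ 8 ^ (K * (K * L)))] at h1
  have h2 := h1.trans (mul_le_mul_of_nonneg_left hbound (by positivity))
  norm_cast at h2
  omega

theorem mul_succ_le_two_pow {s : ℕ} (hs : 1 ≤ s) : 13 * (4 * s + 22) ≤ 2 ^ (s + 8) := by
  induction s, hs using Nat.le_induction with
  | base => norm_num
  | succ s hs ih => rw [show s + 1 + 8 = (s + 8) + 1 by ring, pow_succ]; omega

theorem interpolation_size_two_adic {a b X Y s L : ℕ} (hs : 1 ≤ s) (hL : L = 4 * s + 22)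
    (hab : a ^ 13 * b ^ 12 ≤ 2 ^ 130) (hXY : X + Y ≤ 2 ^ s) :
    8 ^ (144 * L * (144 * L * L)) * ((144 * L * L).factorial *
      (((L + 12 * L) * Y + 12 * L * X) ^ (144 * L) *
        (a ^ (L + 12 * L) * b ^ (12 * L)) ^ L) ^ (144 * L * L)) <
        8 ^ (144 * L * L * (144 * L * L - 1) / 2) := by
  set n := 144 * L * L with hn
  set K := 144 * L with hK
  set T := (L + 12 * L) * Y + 12 * L * X with hT
  have hLpos : 0 < L := by omega
  have hn1 : 1 ≤ n := Nat.mul_pos (by omega) hLpos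
  have hT2 : T ≤ 2 ^ (2 * s + 8) := by
    calc T ≤ 13 * L * (X + Y) := by rw [hT]; nlinarith
      _ ≤ 2 ^ (s + 8) * 2 ^ s := Nat.mul_le_mul (by rw [hL]; exact mul_succ_le_two_pow hs) hXY
      _ = _ := by rw [← pow_add]; congr 1; omega
  have hn2 : n ≤ 2 ^ (8 + 2 * L) := by
    have h1 : L ≤ 2 ^ L := Nat.lt_two_pow_self.le
    calc n ≤ 2 ^ 8 * (2 ^ L * 2 ^ L) := by rw [hn]; nlinarith
      _ = _ := by rw [← pow_add, ← pow_add]; congr 1; omega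
  have hfac : n.factorial ≤ n ^ n := Nat.factorial_le_pow n
  have hAB : (a ^ (L + 12 * L) * b ^ (12 * L)) ^ L ≤ 2 ^ (130 * L * L) := by
    calc (a ^ (L + 12 * L) * b ^ (12 * L)) ^ L = (a ^ 13 * b ^ 12) ^ (L * L) := by
          rw [mul_pow, mul_pow, ← pow_mul, ← pow_mul, ← pow_mul, ← pow_mul]; congr 2 <;> ring
      _ ≤ (2 ^ 130) ^ (L * L) := Nat.pow_le_pow_left hab _
      _ = _ := by rw [← pow_mul, mul_assoc]
  have hmain : 8 ^ (K * n) * (n.factorial * (T ^ K * (a ^ (L + 12 * L) * b ^ (12 * L)) ^ L) ^ n) ≤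
      (2 ^ (3 * K + (8 + 2 * L) + (2 * s + 8) * K + 130 * L * L)) ^ n := by
    calc _ ≤ 8 ^ (K * n) * ((2 ^ (8 + 2 * L)) ^ n *
          ((2 ^ (2 * s + 8)) ^ K * 2 ^ (130 * L * L)) ^ n) := by
          refine Nat.mul_le_mul_left _ (Nat.mul_le_mul (hfac.trans ?_) ?_)
          · exact Nat.pow_le_pow_left hn2 _
          · exact Nat.pow_le_pow_left (Nat.mul_le_mul (Nat.pow_le_pow_left hT2 _) hAB) _
      _ = _ := by
        rw [show 8 = 2 ^ 3 by norm_num, ← pow_mul, ← pow_mul, ← pow_mul, ← pow_add, ← pow_mul,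
          ← pow_add, ← pow_add, ← pow_mul]
        congr 1
        ring
  refine hmain.trans_lt ?_
  rw [show 8 = 2 ^ 3 by norm_num, ← pow_mul, ← pow_mul]
  refine Nat.pow_lt_pow_right (by norm_num) ?_
  have heven : 2 * (n * (n - 1) / 2) = n * (n - 1) := by
    exact Nat.two_mul_div_two_of_even (Nat.even_mul_pred_self n)
  have hexp : 2 * (3 * K + (8 + 2 * L) + (2 * s + 8) * K + 130 * L * L) < 3 * (n - 1) := by
    have h2 : n - 1 + 1 = n := by omega
    have h3 : 4 * s + 22 = L := hL.symm
    have h4 : 3 * n = 432 * (L * L) := by rw [hn]; ring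
    have h5 : 288 * (2 * s + 8) * L + 864 * L ≤ 144 * (L * L) := by
      rw [← h3]; nlinarith
    have h6 : 22 * L ≤ L * L := Nat.mul_le_mul_right _ (by omega)
    have h7 : 2 * (3 * K + (8 + 2 * L) + (2 * s + 8) * K + 130 * L * L) =
      (288 * (2 * s + 8) * L + 864 * L) + 16 + 4 * L + 260 * (L * L) := by rw [hK]; ring
    rw [h7]
    omega
  nlinarith

theorem two_pow_dvd_of_dvd_pow_sub_pow {x y : ℤ} {d N : ℕ} (hd : Odd d) (hx : Odd x)
    (hy : Odd y) (h : (2 : ℤ) ^ N ∣ x ^ d - y ^ d) : (2 : ℤ) ^ N ∣ x - y := by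
  have h1 := emultiplicity_pow_sub_pow_of_prime (p := 2) Int.prime_two
    ((hx.sub_odd hy).two_dvd) (fun h => Int.not_even_iff_odd.2 hx (even_iff_two_dvd.2 h))
    (n := d) (fun h => Nat.not_even_iff_odd.2 hd (even_iff_two_dvd.2 (by exact_mod_cast h)))
  rw [pow_dvd_iff_le_emultiplicity] at h ⊢
  rwa [h1] at h

theorem pow_ne_pow_of_coprime {a b X Y : ℕ} (ha : 2 ≤ a) (hab : Nat.Coprime a b) (hX : 0 < X) :
    a ^ X ≠ b ^ Y := by
  intro h
  have h1 : Nat.Coprime (a ^ X) (b ^ Y) := (hab.pow_left X).pow_right Y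
  rw [← h, Nat.coprime_self] at h1
  have := Nat.one_lt_pow hX.ne' (by omega : 1 < a)
  omega

/-- A lower bound for `2`-adic linear forms in two logarithms. -/
theorem not_two_pow_dvd_pow_sub_pow {a b X Y s : ℕ} (hs : 1 ≤ s) (ha : (8 : ℤ) ∣ a - 1)
    (hb : (8 : ℤ) ∣ b - 1) (ha2 : 2 ≤ a) (hb2 : 2 ≤ b) (hab : a ^ 13 * b ^ 12 ≤ 2 ^ 130)
    (hcop : Nat.Coprime a b) (hX : 0 < X) (hY : 0 < Y) (hodd : Odd X ∨ Odd Y)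
    (hXY : X + Y ≤ 2 ^ s) :
    ¬ (2 : ℤ) ^ (432 * (4 * s + 22) ^ 2) ∣ a ^ X - b ^ Y := by
  intro hdvd
  generalize hN : 432 * (4 * s + 22) ^ 2 = N at hdvd
  obtain ⟨d, x, y, hd, hxy, rfl, rfl⟩ := Nat.exists_coprime' (m := X) (n := Y)
    (Nat.gcd_pos_of_pos_left _ hX)
  have hx : 0 < x := by
    rcases Nat.eq_zero_or_pos x with rfl | h
    · simp at hX
    · exact h
  have hy : 0 < y := by
    rcases Nat.eq_zero_or_pos y with rfl | h
    · simp at hY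
    · exact h
  have hdo : Odd d := by
    rcases hodd with h | h
    · exact (Nat.odd_mul.1 h).2
    · exact (Nat.odd_mul.1 h).2
  have haodd : Odd (a : ℤ) := by
    obtain ⟨r, hr⟩ := ha
    exact ⟨4 * r, by omega⟩
  have hbodd : Odd (b : ℤ) := by
    obtain ⟨r, hr⟩ := hb
    exact ⟨4 * r, by omega⟩
  rw [pow_mul, pow_mul] at hdvd
  have hdvd' := two_pow_dvd_of_dvd_pow_sub_pow hdo haodd.pow hbodd.pow hdvd
  have hxys : x + y ≤ 2 ^ s := by
    refine le_trans ?_ hXY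
    rw [← add_mul]
    exact Nat.le_mul_of_pos_right _ hd
  obtain ⟨L, hL⟩ : ∃ L, L = 4 * s + 22 := ⟨_, rfl⟩
  rw [← hL, pow_two] at hN
  by_cases hbig : 12 * L ≤ x ∨ 12 * L ≤ y
  · refine not_modEq_two_pow_of_lt (K := 144 * L) (L := L) (m := 12 * L) ha hb ha2 hb2 hx hy hxy
      hbig ?_ (by rw [← hN]; linarith : 3 * (144 * L * L) ≤ N)
      (interpolation_size_two_adic hs hL hab hxys) ?_
    · have : 12 * L * (12 * L) = 144 * L * L := by ring
      rw [this]
      exact Nat.mul_lt_mul_of_pos_right (by omega) (by omega)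
    · exact (Int.modEq_iff_dvd.2 hdvd').symm
  · push Not at hbig
    have hne : a ^ x ≠ b ^ y := pow_ne_pow_of_coprime ha2 hcop hx
    have h64 : ∀ c : ℕ, 2 ≤ c → c ^ 12 ≤ 2 ^ 130 → c ≤ 2 ^ 11 := by
      intro c _ hc
      by_contra! h
      have : (2 ^ 11) ^ 12 ≤ c ^ 12 := Nat.pow_le_pow_left h.le 12
      rw [← pow_mul] at this
      exact absurd (this.trans hc) (by norm_num)
    have ha12 : a ≤ 2 ^ 11 := h64 a ha2 (by
      calc a ^ 12 ≤ a ^ 13 * b ^ 12 := by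
            rw [pow_succ a 12, mul_assoc]
            exact Nat.le_mul_of_pos_right _ (by positivity)
        _ ≤ _ := hab)
    have hb12 : b ≤ 2 ^ 11 := h64 b hb2 (by
      calc b ^ 12 ≤ a ^ 13 * b ^ 12 := Nat.le_mul_of_pos_left _ (by positivity)
        _ ≤ _ := hab)
    have hax : a ^ x < 2 ^ N := by
      calc a ^ x ≤ (2 ^ 11) ^ x := Nat.pow_le_pow_left ha12 _
        _ = 2 ^ (11 * x) := by rw [pow_mul]
        _ < _ := Nat.pow_lt_pow_right (by norm_num) (by nlinarith)
    have hby : b ^ y < 2 ^ N := by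
      calc b ^ y ≤ (2 ^ 11) ^ y := Nat.pow_le_pow_left hb12 _
        _ = 2 ^ (11 * y) := by rw [pow_mul]
        _ < _ := Nat.pow_lt_pow_right (by norm_num) (by nlinarith)
    have hmod : a ^ x ≡ b ^ y [MOD 2 ^ N] := by
      refine (Nat.modEq_iff_dvd.2 ?_).symm
      push_cast
      exact hdvd'
    exact hne (Nat.ModEq.eq_of_lt_of_lt hmod hax hby)

theorem exp_sub_sum_range_le {z lam : ℝ} (hz : 0 ≤ z) (hlam : 1 ≤ lam) (M : ℕ) :
    Real.exp z - ∑ m ∈ Finset.range M, z ^ m / m.factorial ≤ Real.exp (lam * z) / lam ^ M := by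
  have h0 : 0 < lam := by linarith
  have hs := Real.summable_pow_div_factorial z
  have hs' := Real.summable_pow_div_factorial (lam * z)
  have he : ∀ x : ℝ, Real.exp x = ∑' m : ℕ, x ^ m / m.factorial := fun x => by
    rw [Real.exp_eq_exp_ℝ, NormedSpace.exp_eq_tsum_div]
  rw [le_div_iff₀ (by positivity), he z, ← hs.sum_add_tsum_nat_add M, add_sub_cancel_left,
    he (lam * z), ← hs'.sum_add_tsum_nat_add M, ← tsum_mul_right]
  refine le_add_of_nonneg_of_le (Finset.sum_nonneg fun i _ => by positivity) ?_
  refine Summable.tsum_le_tsum (fun i => ?_) ?_ ?_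
  · rw [mul_pow, pow_add lam, mul_comm, mul_div_assoc]
    have h1 : (1 : ℝ) ≤ lam ^ i := one_le_pow₀ hlam
    have h2 : 0 ≤ lam ^ M * (z ^ (i + M) / (i + M).factorial) := by positivity
    nlinarith
  · exact ((summable_nat_add_iff M).2 hs).mul_right _
  · exact (summable_nat_add_iff M).2 hs'

theorem abs_det_le_of_expansion {κ : Type*} [Fintype κ] [DecidableEq κ] {n : ℕ}
    (hn : Fintype.card κ = n) {q U : ℝ} (hq : 0 ≤ q) (hq1 : q ≤ 1)
    (F G : Fin n → κ → ℝ) (E A : Matrix κ κ ℝ)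
    (hA : ∀ ρ j, A ρ j = ∑ i : Fin n, q ^ (i : ℕ) * (F i ρ * G i j) + q ^ n * E ρ j)
    (hFG : ∀ i ρ j, |F i ρ * G i j| ≤ U) (hE : ∀ ρ j, |E ρ j| ≤ U) :
    |A.det| ≤ q ^ (n * (n - 1) / 2) * ((n + 1) ^ n * (n.factorial * U ^ n)) := by
  obtain ⟨e, he⟩ := exists_det_eq_pow_mul_sum hn q F G E A hA
  rw [he, abs_mul, abs_of_nonneg (pow_nonneg hq _)]
  refine mul_le_mul_of_nonneg_left ?_ (pow_nonneg hq _)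
  refine (Finset.abs_sum_le_sum_abs _ _).trans ?_
  have : ∀ φ ∈ (Finset.univ : Finset (κ → Option (Fin n))),
      |q ^ e φ * (expansionRow F G E φ).det| ≤ n.factorial * U ^ n := by
    intro φ _
    have h1 := Matrix.det_le (A := expansionRow F G E φ) (abv := AbsoluteValue.abs) (x := U) (by
      intro ρ j
      rw [AbsoluteValue.abs_apply]
      simp only [expansionRow]
      rcases φ ρ with _ | i
      · exact hE ρ j
      · exact hFG i ρ j)
    rw [hn, AbsoluteValue.abs_apply, nsmul_eq_mul] at h1
    rw [abs_mul, abs_of_nonneg (pow_nonneg hq _)]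
    calc _ ≤ 1 * |(expansionRow F G E φ).det| :=
          mul_le_mul_of_nonneg_right (pow_le_one₀ hq hq1) (abs_nonneg _)
      _ ≤ _ := by rw [one_mul]; exact h1
  refine (Finset.sum_le_card_nsmul _ _ _ this).trans_eq ?_
  rw [Finset.card_univ, Fintype.card_fun, Fintype.card_option, Fintype.card_fin, hn, nsmul_eq_mul]
  push_cast
  ring

theorem entry_expansion {n K k : ℕ} {T t z w Z U : ℝ} (hk : k ≤ K) (hkn : k ≤ n) (ht : 0 ≤ t)
    (htT : t ≤ T) (hT : 1 ≤ T) (hz : 0 ≤ z) (hw : w ≤ z) (hzw : z - w ≤ Real.exp (-n))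
    (hZ : Real.exp 1 * z ≤ Z)
    (hU : 2 * ((Real.exp 1 * T) ^ K * Real.exp Z) ≤ U) :
    |Real.exp n * (t ^ k * Real.exp w - t ^ k *
      ∑ m ∈ Finset.range (n - k), z ^ m / m.factorial)| ≤ U := by
  have he1 : 1 ≤ Real.exp 1 := Real.one_le_exp (by norm_num)
  have hzZ : z ≤ Z := le_trans (by nlinarith) hZ
  have hpow : (Real.exp 1 * t) ^ k ≤ (Real.exp 1 * T) ^ K :=
    (pow_le_pow_left₀ (by positivity) (by nlinarith) k).trans
      (pow_le_pow_right₀ (by nlinarith) hk)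
  have h1 := exp_sub_sum_range_le hz he1 (n - k)
  have h1' : 0 ≤ Real.exp z - ∑ m ∈ Finset.range (n - k), z ^ m / m.factorial :=
    sub_nonneg.2 (Real.sum_le_exp_of_nonneg hz _)
  have h2 : Real.exp n * (t ^ k *
      (Real.exp z - ∑ m ∈ Finset.range (n - k), z ^ m / m.factorial)) ≤
      (Real.exp 1 * T) ^ K * Real.exp Z := by
    have h3 : Real.exp n = Real.exp 1 ^ (n - k) * Real.exp 1 ^ k := by
      rw [← pow_add, Nat.sub_add_cancel hkn, ← Real.exp_nat_mul, mul_one]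
    calc _ ≤ Real.exp n * (t ^ k * (Real.exp (Real.exp 1 * z) / Real.exp 1 ^ (n - k))) := by gcongr
      _ = (Real.exp 1 * t) ^ k * Real.exp (Real.exp 1 * z) := by
        rw [h3, mul_pow]; field_simp
      _ ≤ _ := by gcongr
  have h4 : 0 ≤ Real.exp z - Real.exp w := sub_nonneg.2 (Real.exp_le_exp.2 hw)
  have h5 : Real.exp z - Real.exp w ≤ Real.exp z * Real.exp (-n) := by
    have h6 := Real.add_one_le_exp (w - z)
    have h7 : Real.exp w = Real.exp z * Real.exp (w - z) := by rw [← Real.exp_add]; ring_nf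
    rw [h7]
    have := Real.exp_pos z
    nlinarith
  have hpow' : t ^ k ≤ (Real.exp 1 * T) ^ K :=
    le_trans (pow_le_pow_left₀ ht (by nlinarith) k) hpow
  have h8 : Real.exp n * (t ^ k * (Real.exp z - Real.exp w)) ≤
      (Real.exp 1 * T) ^ K * Real.exp Z := by
    calc _ ≤ Real.exp n * (t ^ k * (Real.exp z * Real.exp (-n))) := by gcongr
      _ = t ^ k * Real.exp z * (Real.exp n * Real.exp (-n)) := by ring
      _ = t ^ k * Real.exp z := by rw [← Real.exp_add]; simp
      _ ≤ _ := by gcongr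
  have h9 : 0 ≤ Real.exp n * (t ^ k *
      (Real.exp z - ∑ m ∈ Finset.range (n - k), z ^ m / m.factorial)) := by positivity
  have h10 : 0 ≤ Real.exp n * (t ^ k * (Real.exp z - Real.exp w)) := by positivity
  rw [abs_le]
  constructor <;> nlinarith

theorem linear_form_lower_bound_aux {a b X Y K L m : ℕ} {ω δ : ℝ} (ha : 2 ≤ a) (hb : 2 ≤ b)
    (hX : 0 < X) (hY : 0 < Y) (hL : 0 < L) (hXY : Nat.Coprime X Y)
    (h : m ≤ X ∨ m ≤ Y)
    (hm : (K - 1) * L < m * m) (h1 : Real.log a ≤ ω * Y) (h2 : ω * Y ≤ Real.log a + δ)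
    (h3 : Real.log b ≤ ω * X) (h4 : ω * X ≤ Real.log b + δ)
    (hδ : L * (L + 2 * m) * δ ≤ Real.exp (-(K * L : ℕ)))
    {T U : ℝ} (hT : ((L + m) * Y + m * X : ℕ) ≤ T)
    (hU : 2 * ((Real.exp 1 * T) ^ K * Real.exp (Real.exp 1 * (L * (ω * T)))) ≤ U) :
    Real.exp 1 ^ (K * L * (K * L - 1) / 2) ≤
      ((K * L : ℕ) + 1) ^ (K * L) * ((K * L).factorial * U ^ (K * L)) := by
  obtain ⟨r, s, hr, hs, hdet⟩ := exists_interpolation_det_ne_zero (K := K) (L := L) (m := m)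
    ha (by omega : 0 < b) hXY h hX hY hm
  have hcard : Fintype.card (Fin K × Fin L) = K * L := by simp
  set n := K * L with hn
  have hω : 0 < ω := by
    have : 0 < Real.log a := Real.log_pos (by exact_mod_cast ha)
    have hY' : (0 : ℝ) < Y := by exact_mod_cast hY
    by_contra hneg
    nlinarith
  have hδ0 : 0 ≤ δ := by linarith
  have hT1 : 1 ≤ T := by
    refine le_trans ?_ hT
    have h5 : 1 ≤ (L + m) * Y + m * X := by
      have : 1 ≤ (L + m) * Y := Nat.mul_pos (by omega) hY
      omega
    exact_mod_cast h5
  let t : Fin K × Fin L → ℝ := fun i => ((r i * Y + s i * X : ℕ) : ℝ)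
  have ht0 : ∀ i, 0 ≤ t i := fun i => by positivity
  have htT : ∀ i, t i ≤ T := by
    intro i
    refine le_trans ?_ hT
    simp only [t]
    have h5 : r i * Y + s i * X ≤ (L + m) * Y + m * X := by
      gcongr
      · exact (hr i).le
      · exact (hs i).le
    exact_mod_cast h5
  let w : Fin K × Fin L → Fin K × Fin L → ℝ := fun i j =>
    (j.2 : ℕ) * (r i * Real.log a + s i * Real.log b)
  let z : Fin K × Fin L → Fin K × Fin L → ℝ := fun i j => (j.2 : ℕ) * (ω * t i)
  let A : Matrix (Fin K × Fin L) (Fin K × Fin L) ℝ := fun i j =>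
    t i ^ (j.1 : ℕ) * Real.exp (w i j)
  have hAdet : 1 ≤ |A.det| := by
    have h5 := Int.one_le_abs hdet
    have h6 : A.det = (((Matrix.of fun i j : Fin K × Fin L =>
        ((r i * Y + s i * X : ℕ) : ℤ) ^ (j.1 : ℕ) *
          ((a ^ r i * b ^ s i : ℕ) : ℤ) ^ (j.2 : ℕ)).det : ℤ) : ℝ) := by
      have h7 := RingHom.map_det (Int.castRingHom ℝ) (Matrix.of fun i j : Fin K × Fin L =>
        ((r i * Y + s i * X : ℕ) : ℤ) ^ (j.1 : ℕ) *
          ((a ^ r i * b ^ s i : ℕ) : ℤ) ^ (j.2 : ℕ))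
      rw [eq_intCast] at h7
      rw [h7]
      congr 1
      ext i j
      have ha0 : (0 : ℝ) < a := by positivity
      have hb0 : (0 : ℝ) < b := by positivity
      have h8 : Real.exp (w i j) = ((a : ℝ) ^ r i * (b : ℝ) ^ s i) ^ (j.2 : ℕ) := by
        simp only [w]
        rw [Real.exp_nat_mul, Real.exp_add, Real.exp_nat_mul, Real.exp_nat_mul,
          Real.exp_log ha0, Real.exp_log hb0]
      simp only [A, h8, t, RingHom.mapMatrix_apply, Matrix.map_apply, Matrix.of_apply]
      push_cast
      simp
    rw [h6]
    exact_mod_cast h5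
  let F : Fin n → Fin K × Fin L → ℝ := fun i ρ => (t ρ / T) ^ (i : ℕ)
  let G : Fin n → Fin K × Fin L → ℝ := fun i j =>
    if (j.1 : ℕ) ≤ i then Real.exp 1 ^ (i : ℕ) * (T ^ (j.1 : ℕ) *
      (((j.2 : ℕ) * (ω * T)) ^ ((i : ℕ) - j.1) / ((i : ℕ) - j.1).factorial)) else 0
  let q := Real.exp (-1)
  have hqe : ∀ i : ℕ, q ^ i * Real.exp 1 ^ i = 1 := by
    intro i
    rw [← mul_pow, ← Real.exp_add]; simp
  have hjn : ∀ j : Fin K × Fin L, (j.1 : ℕ) ≤ n := by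
    intro j
    have : K * 1 ≤ K * L := Nat.mul_le_mul_left K hL
    have := j.1.2
    omega
  have hsum : ∀ ρ j, ∑ i : Fin n, q ^ (i : ℕ) * (F i ρ * G i j) = t ρ ^ (j.1 : ℕ) *
      ∑ m ∈ Finset.range (n - j.1), z ρ j ^ m / m.factorial := by
    intro ρ j
    obtain ⟨d, hd⟩ := Nat.exists_eq_add_of_le (hjn j)
    let f : ℕ → ℝ := fun i => if (j.1 : ℕ) ≤ i then t ρ ^ (j.1 : ℕ) *
      (z ρ j ^ (i - j.1) / (i - j.1).factorial) else 0
    have hf : ∀ i : Fin n, q ^ (i : ℕ) * (F i ρ * G i j) = f i := by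
      intro i
      simp only [F, G, f]
      split_ifs with hi
      · obtain ⟨d, hd⟩ := Nat.exists_eq_add_of_le hi
        rw [hd, Nat.add_sub_cancel_left]
        have hT0 : T ≠ 0 := by positivity
        have h5 := hqe ((j.1 : ℕ) + d)
        calc _ = (q ^ ((j.1 : ℕ) + d) * Real.exp 1 ^ ((j.1 : ℕ) + d)) *
              ((t ρ / T) ^ ((j.1 : ℕ) + d) * (T ^ (j.1 : ℕ) *
              (((j.2 : ℕ) * (ω * T)) ^ d / d.factorial))) := by ring
          _ = t ρ ^ (j.1 : ℕ) * (z ρ j ^ d / d.factorial) := by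
            rw [h5, one_mul]
            simp only [z]
            rw [div_pow, pow_add, pow_add, mul_pow, mul_pow, mul_pow, mul_pow]
            field_simp
      · simp
    rw [Finset.sum_congr rfl fun i _ => hf i, Fin.sum_univ_eq_sum_range f n, hd,
      Finset.sum_range_add, Nat.add_sub_cancel_left, Finset.sum_eq_zero, zero_add, Finset.mul_sum]
    · refine Finset.sum_congr rfl fun i _ => ?_
      simp [f]
    · intro i hi
      have := Finset.mem_range.1 hi
      simp only [f]
      rw [if_neg (by omega)]
  have hz0 : ∀ i j, 0 ≤ z i j := fun i j => by
    have := ht0 i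
    positivity
  have hzw : ∀ i j, w i j ≤ z i j ∧ z i j - w i j ≤ Real.exp (-(n : ℕ)) := by
    intro i j
    have h5 : r i * Real.log a + s i * Real.log b ≤ ω * t i := by
      simp only [t]
      push_cast
      have h6 := mul_le_mul_of_nonneg_left h1 (Nat.cast_nonneg (α := ℝ) (r i))
      have h7 := mul_le_mul_of_nonneg_left h3 (Nat.cast_nonneg (α := ℝ) (s i))
      linarith
    have h6 : ω * t i ≤ r i * Real.log a + s i * Real.log b + (L + 2 * m) * δ := by
      simp only [t]
      push_cast
      have h6 := mul_le_mul_of_nonneg_left h2 (Nat.cast_nonneg (α := ℝ) (r i))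
      have h7 := mul_le_mul_of_nonneg_left h4 (Nat.cast_nonneg (α := ℝ) (s i))
      have h8 : (r i : ℝ) ≤ L + m := by exact_mod_cast (hr i).le
      have h9 : (s i : ℝ) ≤ m := by exact_mod_cast (hs i).le
      have h10 := mul_le_mul_of_nonneg_right h8 hδ0
      have h11 := mul_le_mul_of_nonneg_right h9 hδ0
      linarith
    have h7 : ((j.2 : ℕ) : ℝ) ≤ L := by exact_mod_cast j.2.2.le
    have h8 : (0 : ℝ) ≤ ((j.2 : ℕ) : ℝ) := by positivity
    constructor
    · exact mul_le_mul_of_nonneg_left h5 h8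
    · refine le_trans ?_ hδ
      simp only [z, w]
      rw [← mul_sub, mul_assoc]
      exact mul_le_mul h7 (by linarith) (by linarith) (by positivity)
  have hZ : ∀ j : Fin K × Fin L, ∀ x, 0 ≤ x → x ≤ T →
      Real.exp 1 * ((j.2 : ℕ) * (ω * x)) ≤ Real.exp 1 * (L * (ω * T)) := by
    intro j x hx0 hx
    have h7 : ((j.2 : ℕ) : ℝ) ≤ L := by exact_mod_cast j.2.2.le
    gcongr
  have hU0 : 0 ≤ (Real.exp 1 * T) ^ K * Real.exp (Real.exp 1 * (L * (ω * T))) := by positivity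
  have hfinal := abs_det_le_of_expansion hcard (q := q) (U := U) (Real.exp_pos _).le
    (Real.exp_le_one_iff.2 (by norm_num)) F G
    (fun ρ j => Real.exp n * (A ρ j - t ρ ^ (j.1 : ℕ) *
      ∑ m ∈ Finset.range (n - j.1), z ρ j ^ m / m.factorial)) A
    (by
      intro ρ j
      rw [hsum, ← mul_assoc, show q ^ n * Real.exp n = 1 by
        rw [← Real.exp_nat_mul, ← Real.exp_add, mul_neg_one, neg_add_cancel, Real.exp_zero]]
      ring)
    (by
      intro i ρ j
      rw [abs_mul]
      have h5 : |F i ρ| ≤ 1 := by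
        have h6 : 0 ≤ t ρ / T := div_nonneg (ht0 ρ) (by positivity)
        rw [abs_of_nonneg (by positivity)]
        exact pow_le_one₀ h6 ((div_le_one (by positivity)).2 (htT ρ))
      refine (mul_le_mul h5 le_rfl (abs_nonneg _) zero_le_one).trans ?_
      rw [one_mul]
      simp only [G]
      split_ifs with hi
      · rw [abs_of_nonneg (by positivity)]
        obtain ⟨d, hd⟩ := Nat.exists_eq_add_of_le hi
        rw [hd, Nat.add_sub_cancel_left]
        have h7 := Real.pow_div_factorial_le_exp (Real.exp 1 * ((j.2 : ℕ) * (ω * T)))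
          (by positivity) d
        have h8 := Real.exp_le_exp.2 (hZ j T (by positivity) le_rfl)
        have h9 : (Real.exp 1 * T) ^ (j.1 : ℕ) ≤ (Real.exp 1 * T) ^ K := by
          refine pow_le_pow_right₀ ?_ j.1.2.le
          have : 1 ≤ Real.exp 1 := Real.one_le_exp (by norm_num)
          nlinarith
        calc _ = (Real.exp 1 * T) ^ (j.1 : ℕ) *
              ((Real.exp 1 * ((j.2 : ℕ) * (ω * T))) ^ d / d.factorial) := by
              rw [pow_add, mul_pow, mul_pow (Real.exp 1)]; ring
          _ ≤ (Real.exp 1 * T) ^ K * Real.exp (Real.exp 1 * (L * (ω * T))) :=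
              mul_le_mul h9 (h7.trans h8) (by positivity) (by positivity)
          _ ≤ U := by linarith
      · rw [abs_zero]; linarith)
    (fun ρ j => entry_expansion j.1.2.le (hjn j) (ht0 ρ) (htT ρ) hT1 (hz0 ρ j) (hzw ρ j).1
      (hzw ρ j).2 (hZ j _ (ht0 ρ) (htT ρ)) hU)
  have h5 := hAdet.trans hfinal
  have h6 := mul_le_mul_of_nonneg_left h5
    (pow_nonneg (Real.exp_pos 1).le (n * (n - 1) / 2))
  rw [mul_one, ← mul_assoc, mul_comm (Real.exp 1 ^ _) (q ^ _), hqe, one_mul] at h6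
  exact h6

theorem log_le_of_le_ten {a : ℕ} (ha : 2 ≤ a) (ha' : a ≤ 10) : Real.log a ≤ 7 / 3 := by
  have h1 : (a : ℝ) ≤ 10 := by exact_mod_cast ha'
  have h2 : Real.log a ≤ Real.log 10 := Real.log_le_log (by positivity) h1
  have h3 : Real.log (10 ^ 3) ≤ 7 := by
    rw [Real.log_le_iff_le_exp (by norm_num)]
    have h4 : Real.exp 7 = Real.exp 1 ^ 7 := by rw [← Real.exp_nat_mul]; norm_num
    rw [h4]
    have h5 : (2.718 : ℝ) ≤ Real.exp 1 := by linarith [Real.exp_one_gt_d9]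
    calc (10 : ℝ) ^ 3 ≤ 2.718 ^ 7 := by norm_num
      _ ≤ _ := by gcongr
  rw [Real.log_pow] at h3
  push_cast at h3
  linarith

theorem mul_succ_le_two_pow' {s : ℕ} (hs : 1 ≤ s) : 49 * (6 * s + 40) ≤ 2 ^ (s + 11) := by
  induction s, hs using Nat.le_induction with
  | base => norm_num
  | succ s hs ih => rw [show s + 1 + 11 = (s + 11) + 1 by ring, pow_succ]; omega

theorem interpolation_size_real {s L : ℕ} {T E : ℝ} (hs : 1 ≤ s) (hL : L = 6 * s + 40)
    (hT0 : 0 < T) (hT : T ≤ 2 ^ (2 * s + 11)) (hE : E ≤ 616 * L ^ 2 + 3) :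
    ((2304 * L * L : ℕ) + 1 : ℝ) ^ (2304 * L * L) * ((2304 * L * L).factorial *
      (2 * ((Real.exp 1 * T) ^ (2304 * L) * Real.exp E)) ^ (2304 * L * L)) <
      Real.exp 1 ^ (2304 * L * L * (2304 * L * L - 1) / 2) := by
  set n := 2304 * L * L with hn
  have hLpos : 0 < L := by omega
  have hn1 : 1 ≤ n := Nat.mul_pos (by omega) hLpos
  have hfac : (n.factorial : ℝ) ≤ (n : ℝ) ^ n := by exact_mod_cast Nat.factorial_le_pow n
  have hLe : (L : ℝ) ≤ Real.exp L := by linarith [Real.add_one_le_exp (L : ℝ)]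
  have hL1 : (1 : ℝ) ≤ L := by exact_mod_cast hLpos
  have hL2 : (L : ℝ) = 6 * s + 40 := by rw [hL]; push_cast; ring
  have hnr : (n : ℝ) = 2304 * L ^ 2 := by rw [hn]; push_cast; ring
  have he17 : (10700000 : ℝ) ≤ Real.exp 17 := by
    have h4 : Real.exp 17 = Real.exp 1 ^ 17 := by rw [← Real.exp_nat_mul]; norm_num
    rw [h4]
    have h5 : (2.718 : ℝ) ≤ Real.exp 1 := by linarith [Real.exp_one_gt_d9]
    calc (10700000 : ℝ) ≤ 2.718 ^ 17 := by norm_num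
      _ ≤ _ := by gcongr
  have h1 : ((n : ℝ) + 1) * n * 2 ≤ Real.exp (17 + 4 * L) := by
    have h2 : Real.exp (17 + 4 * L) = Real.exp 17 * Real.exp L ^ 4 := by
      rw [Real.exp_add, ← Real.exp_nat_mul]; norm_num
    rw [h2]
    calc ((n : ℝ) + 1) * n * 2 ≤ 10700000 * L ^ 4 := by
          rw [hnr]
          have : (1 : ℝ) ≤ L ^ 2 := one_le_pow₀ hL1
          nlinarith
      _ ≤ _ := by gcongr
  have hlog2 : Real.log 2 ≤ 0.6932 := by linarith [Real.log_two_lt_d9]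
  have hT' : T ≤ Real.exp (0.6932 * ((2 * s + 11 : ℕ) : ℝ)) := by
    refine hT.trans ?_
    have : (2 : ℝ) ^ (2 * s + 11) = Real.exp (Real.log 2 * ((2 * s + 11 : ℕ) : ℝ)) := by
      rw [mul_comm (Real.log 2), Real.exp_nat_mul, Real.exp_log (by norm_num)]
    rw [this]
    gcongr
  have h3 : (Real.exp 1 * T) ^ (2304 * L) ≤
      Real.exp ((2304 * L : ℕ) * (1 + 0.6932 * ((2 * s + 11 : ℕ) : ℝ))) := by
    rw [Real.exp_nat_mul, Real.exp_add]
    gcongr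
  have hlhs : ((n : ℕ) + 1 : ℝ) ^ n * (n.factorial *
      (2 * ((Real.exp 1 * T) ^ (2304 * L) * Real.exp E)) ^ n) ≤
      Real.exp (17 + 4 * L + ((2304 * L : ℕ) * (1 + 0.6932 * ((2 * s + 11 : ℕ) : ℝ))) +
        (616 * L ^ 2 + 3)) ^ n := by
    calc _ ≤ ((n : ℕ) + 1 : ℝ) ^ n * ((n : ℝ) ^ n *
          (2 * (Real.exp ((2304 * L : ℕ) * (1 + 0.6932 * ((2 * s + 11 : ℕ) : ℝ))) *
            Real.exp (616 * L ^ 2 + 3))) ^ n) := by gcongr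
      _ = ((((n : ℝ) + 1) * n * 2) * (Real.exp ((2304 * L : ℕ) *
          (1 + 0.6932 * ((2 * s + 11 : ℕ) : ℝ))) * Real.exp (616 * L ^ 2 + 3))) ^ n := by
          rw [← mul_pow, ← mul_pow]; congr 1; ring
      _ ≤ _ := by
        rw [Real.exp_add _ (616 * (L : ℝ) ^ 2 + 3), Real.exp_add (17 + 4 * (L : ℝ)),
          mul_assoc (Real.exp (17 + 4 * (L : ℝ)))]
        exact pow_le_pow_left₀ (by positivity) (mul_le_mul_of_nonneg_right h1 (by positivity)) n
  refine hlhs.trans_lt ?_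
  rw [← Real.exp_nat_mul, ← Real.exp_nat_mul, mul_one]
  apply Real.exp_lt_exp.2
  have heven : 2 * (n * (n - 1) / 2) = n * (n - 1) :=
    Nat.two_mul_div_two_of_even (Nat.even_mul_pred_self n)
  have heven' : 2 * ((n * (n - 1) / 2 : ℕ) : ℝ) = n * ((n : ℝ) - 1) := by
    have h4 : (n : ℝ) - 1 = ((n - 1 : ℕ) : ℝ) := by rw [Nat.cast_sub hn1, Nat.cast_one]
    rw [h4]
    exact_mod_cast heven
  have hmain : 2 * (17 + 4 * L + ((2304 * L : ℕ) * (1 + 0.6932 * ((2 * s + 11 : ℕ) : ℝ))) +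
        (616 * (L : ℝ) ^ 2 + 3)) < (n : ℝ) - 1 := by
    rw [hnr]
    push_cast
    have hs' : (s : ℝ) = (L - 40) / 6 := by rw [hL2]; ring
    rw [hs']
    have h40 : (40 : ℝ) ≤ L := by rw [hL2]; linarith [Nat.cast_nonneg (α := ℝ) s]
    nlinarith
  have hn0 : (0 : ℝ) < n := by exact_mod_cast hn1
  nlinarith

theorem abs_log_sub_log_ge {u v : ℕ} (hu : 0 < u) (hv : 0 < v) (huv : u ≠ v) {B : ℝ}
    (hB : (u : ℝ) ≤ B) (hB' : (v : ℝ) ≤ B) : 1 / B ≤ |Real.log u - Real.log v| := by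
  wlog h : v < u generalizing u v
  · rw [abs_sub_comm]
    exact this hv hu huv.symm hB' hB (by omega)
  have hu' : (0 : ℝ) < u := by exact_mod_cast hu
  have hv' : (0 : ℝ) < v := by exact_mod_cast hv
  have h1 := Real.log_le_sub_one_of_pos (div_pos hv' hu')
  rw [Real.log_div hv'.ne' hu'.ne'] at h1
  have h2 : (v : ℝ) + 1 ≤ u := by exact_mod_cast h
  have h3 : 1 / (u : ℝ) ≤ 1 - v / u := by
    rw [le_sub_iff_add_le, ← add_div, div_le_one hu']; linarith
  have h4 : 1 / B ≤ 1 / (u : ℝ) := one_div_le_one_div_of_le hu' hB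
  exact le_trans (by linarith) (le_abs_self _)

theorem linear_form_lower_bound_coprime {a b X Y s : ℕ} (hs : 1 ≤ s) (ha : 2 ≤ a) (ha' : a ≤ 10)
    (hb : 2 ≤ b) (hb' : b ≤ 10) (hcop : Nat.Coprime a b) (hX : 0 < X) (hY : 0 < Y)
    (hXYc : Nat.Coprime X Y) (hXY : X + Y ≤ 2 ^ s) :
    Real.exp (-(2305 * (6 * s + 40) ^ 2)) ≤ |X * Real.log a - Y * Real.log b| := by
  by_contra! hlt
  obtain ⟨L, hL⟩ : ∃ L, L = 6 * s + 40 := ⟨_, rfl⟩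
  have hL2 : (6 * s + 40 : ℝ) = L := by rw [hL]; push_cast; ring
  rw [hL2] at hlt
  have h40 : (40 : ℝ) ≤ L := by rw [← hL2]; linarith [Nat.cast_nonneg (α := ℝ) s]
  have hla := log_le_of_le_ten ha ha'
  have hlb := log_le_of_le_ten hb hb'
  have hla0 : 0 < Real.log a := Real.log_pos (by exact_mod_cast ha)
  have hlb0 : 0 < Real.log b := Real.log_pos (by exact_mod_cast hb)
  set δ := |X * Real.log a - Y * Real.log b| with hδdef
  have hδ0 : 0 ≤ δ := abs_nonneg _
  have hX1 : (1 : ℝ) ≤ X := by exact_mod_cast hX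
  have hY1 : (1 : ℝ) ≤ Y := by exact_mod_cast hY
  by_cases hbig : 48 * L ≤ X ∨ 48 * L ≤ Y
  · have hδn : (97 * L ^ 2 : ℝ) * δ ≤ Real.exp (-(2304 * L * L : ℕ)) := by
      have h1 : (97 * L ^ 2 : ℝ) ≤ Real.exp (L ^ 2) := by
        have h2 := Real.quadratic_le_exp_of_nonneg (sq_nonneg (L : ℝ))
        have h3 : (1600 : ℝ) ≤ (L : ℝ) ^ 2 := by nlinarith
        nlinarith
      calc (97 * L ^ 2 : ℝ) * δ ≤ Real.exp (L ^ 2) * Real.exp (-(2305 * L ^ 2)) := by gcongr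
        _ = _ := by rw [← Real.exp_add]; congr 1; push_cast; ring
    have hex : ∃ ω : ℝ, Real.log a ≤ ω * Y ∧ ω * Y ≤ Real.log a + δ ∧
        Real.log b ≤ ω * X ∧ ω * X ≤ Real.log b + δ := by
      rcases le_total (X * Real.log a) (Y * Real.log b) with h | h
      · have h1 : δ = Y * Real.log b - X * Real.log a := by
          rw [hδdef, abs_of_nonpos (by linarith)]; ring
        refine ⟨Real.log b / X, ?_, ?_, ?_, ?_⟩
        · rw [div_mul_eq_mul_div, le_div_iff₀ (by linarith)]; linarith
        · rw [div_mul_eq_mul_div, div_le_iff₀ (by linarith)]; nlinarith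
        · rw [div_mul_cancel₀ _ (by linarith)]
        · rw [div_mul_cancel₀ _ (by linarith)]; linarith
      · have h1 : δ = X * Real.log a - Y * Real.log b := by
          rw [hδdef, abs_of_nonneg (by linarith)]
        refine ⟨Real.log a / Y, ?_, ?_, ?_, ?_⟩
        · rw [div_mul_cancel₀ _ (by linarith)]
        · rw [div_mul_cancel₀ _ (by linarith)]; linarith
        · rw [div_mul_eq_mul_div, le_div_iff₀ (by linarith)]; linarith
        · rw [div_mul_eq_mul_div, div_le_iff₀ (by linarith)]; nlinarith
    obtain ⟨ω, h1, h2, h3, h4⟩ := hex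
    have hLpos : 0 < L := by omega
    have hT : (((L + 48 * L) * Y + 48 * L * X : ℕ) : ℝ) ≤ 2 ^ (2 * s + 11) := by
      have h5 : (L + 48 * L) * Y + 48 * L * X ≤ 2 ^ (2 * s + 11) := by
        calc (L + 48 * L) * Y + 48 * L * X ≤ 49 * L * (X + Y) := by nlinarith
          _ ≤ 2 ^ (s + 11) * 2 ^ s :=
            Nat.mul_le_mul (by rw [hL]; exact mul_succ_le_two_pow' hs) hXY
          _ = _ := by rw [← pow_add]; congr 1; omega
      exact_mod_cast h5
    have hmL : (2304 * L - 1) * L < 48 * L * (48 * L) := by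
      have : 48 * L * (48 * L) = 2304 * L * L := by ring
      rw [this]
      exact Nat.mul_lt_mul_of_pos_right (by omega) (by omega)
    have hmain := linear_form_lower_bound_aux (K := 2304 * L) (L := L) (m := 48 * L) ha hb hX hY
      hLpos hXYc hbig hmL h1 h2 h3 h4 (by
        refine le_trans (le_of_eq ?_) hδn
        push_cast; ring) le_rfl le_rfl
    refine absurd hmain (not_le.2 (interpolation_size_real hs hL ?_ hT ?_))
    · have : 0 < (L + 48 * L) * Y + 48 * L * X :=
        Nat.add_pos_left (Nat.mul_pos (by omega) hY) _
      exact_mod_cast this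
    · have h5 : Real.exp (-(2304 * L * L : ℕ)) ≤ 1 := Real.exp_le_one_iff.2 (by
        rw [neg_nonpos]; positivity)
      have h6 : L * (ω * (((L + 48 * L) * Y + 48 * L * X : ℕ) : ℝ)) ≤ 97 * (7 / 3) * L ^ 2 + 1 := by
        push_cast
        have h7 : (0 : ℝ) ≤ 49 * L ^ 2 := by positivity
        have h8 : (0 : ℝ) ≤ 48 * L ^ 2 := by positivity
        have h9 := mul_le_mul_of_nonneg_left (h2.trans (add_le_add_left hla δ)) h7
        have h10 := mul_le_mul_of_nonneg_left (h4.trans (add_le_add_left hlb δ)) h8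
        nlinarith
      have he : Real.exp 1 ≤ 2.7183 := by linarith [Real.exp_one_lt_d9]
      calc _ ≤ 2.7183 * (97 * (7 / 3) * (L : ℝ) ^ 2 + 1) := by
            refine mul_le_mul he h6 ?_ (by norm_num)
            have : 0 ≤ ω := by
              by_contra! hneg
              nlinarith
            positivity
        _ ≤ _ := by nlinarith
  · push Not at hbig
    have hne : a ^ X ≠ b ^ Y := pow_ne_pow_of_coprime ha hcop hX
    have hbound : ∀ c Z : ℕ, 2 ≤ c → Real.log c ≤ 7 / 3 → Z < 48 * L →
        ((c ^ Z : ℕ) : ℝ) ≤ Real.exp (112 * L) := by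
      intro c Z hc hlc hZ
      have h1 : ((c ^ Z : ℕ) : ℝ) = Real.exp (Z * Real.log c) := by
        rw [Real.exp_nat_mul, Real.exp_log (by positivity)]; push_cast; rfl
      rw [h1]
      apply Real.exp_le_exp.2
      have h2 : (Z : ℝ) ≤ 48 * L := by exact_mod_cast hZ.le
      have h3 : 0 ≤ Real.log c := Real.log_nonneg (by exact_mod_cast (by omega : 1 ≤ c))
      nlinarith
    have h1 := abs_log_sub_log_ge (by positivity) (by positivity) hne (hbound a X ha hla hbig.1)
      (hbound b Y hb hlb hbig.2)
    push_cast at h1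
    rw [Real.log_pow, Real.log_pow, one_div, ← Real.exp_neg] at h1
    have h2 := h1.trans_lt hlt
    rw [Real.exp_lt_exp] at h2
    nlinarith

/-- A lower bound for linear forms in the logarithms of two small integers. -/
theorem linear_form_lower_bound {a b X Y s : ℕ} (hs : 1 ≤ s) (ha : 2 ≤ a) (ha' : a ≤ 10)
    (hb : 2 ≤ b) (hb' : b ≤ 10) (hcop : Nat.Coprime a b) (hX : 0 < X) (hY : 0 < Y)
    (hXY : X + Y ≤ 2 ^ s) :
    Real.exp (-(2305 * (6 * s + 40) ^ 2)) ≤ |X * Real.log a - Y * Real.log b| := by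
  obtain ⟨d, x, y, hd, hxy, rfl, rfl⟩ := Nat.exists_coprime' (m := X) (n := Y)
    (Nat.gcd_pos_of_pos_left _ hX)
  have hx : 0 < x := Nat.pos_of_ne_zero fun h => by simp [h] at hX
  have hy : 0 < y := Nat.pos_of_ne_zero fun h => by simp [h] at hY
  have hxys : x + y ≤ 2 ^ s := by
    refine le_trans ?_ hXY
    rw [← add_mul]
    exact Nat.le_mul_of_pos_right _ hd
  have h1 := linear_form_lower_bound_coprime hs ha ha' hb hb' hcop hx hy hxy hxys
  have h2 : ((x * d : ℕ) : ℝ) * Real.log a - ((y * d : ℕ) : ℝ) * Real.log b =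
      d * (x * Real.log a - y * Real.log b) := by push_cast; ring
  rw [h2, abs_mul, abs_of_nonneg (Nat.cast_nonneg (α := ℝ) d)]
  have h3 : (1 : ℝ) ≤ d := by exact_mod_cast hd
  nlinarith [abs_nonneg ((x : ℝ) * Real.log a - y * Real.log b)]

theorem log_two_three_five_seven_bounds :
    (6931471805599453094172321214581765680755 / 10 ^ 40 ≤ Real.log 2 ∧
      Real.log 2 ≤ 6931471805599453094172321214581765680756 / 10 ^ 40) ∧
    (10986122886681096913952452369225257046474 / 10 ^ 40 ≤ Real.log 3 ∧
      Real.log 3 ≤ 10986122886681096913952452369225257046475 / 10 ^ 40) ∧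
    (16094379124341003746007593332261876395256 / 10 ^ 40 ≤ Real.log 5 ∧
      Real.log 5 ≤ 16094379124341003746007593332261876395257 / 10 ^ 40) ∧
    (19459101490553133051053527434431797296370 / 10 ^ 40 ≤ Real.log 7 ∧
      Real.log 7 ≤ 19459101490553133051053527434431797296371 / 10 ^ 40) := by
  have e1 : Real.log ((1 + 1 / 251) / (1 - 1 / 251)) =
      Real.log 2 + 2 * Real.log 3 + Real.log 7 - 3 * Real.log 5 := by
    rw [show ((1 + 1 / 251) / (1 - 1 / 251) : ℝ) = 2 * 3 ^ 2 * 7 / 5 ^ 3 by norm_num,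
      Real.log_div (by norm_num) (by norm_num), Real.log_mul (by norm_num) (by norm_num),
      Real.log_mul (by norm_num) (by norm_num), Real.log_pow, Real.log_pow]
    push_cast; ring
  have e2 : Real.log ((1 + 1 / 449) / (1 - 1 / 449)) =
      2 * Real.log 3 + 2 * Real.log 5 - 5 * Real.log 2 - Real.log 7 := by
    rw [show ((1 + 1 / 449) / (1 - 1 / 449) : ℝ) = 3 ^ 2 * 5 ^ 2 / (2 ^ 5 * 7) by norm_num,
      Real.log_div (by norm_num) (by norm_num), Real.log_mul (by norm_num) (by norm_num),
      Real.log_mul (by norm_num) (by norm_num), Real.log_pow, Real.log_pow, Real.log_pow]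
    push_cast; ring
  have e3 : Real.log ((1 + 1 / 4801) / (1 - 1 / 4801)) =
      4 * Real.log 7 - 5 * Real.log 2 - Real.log 3 - 2 * Real.log 5 := by
    rw [show ((1 + 1 / 4801) / (1 - 1 / 4801) : ℝ) = 7 ^ 4 / (2 ^ 5 * 3 * 5 ^ 2) by norm_num,
      Real.log_div (by norm_num) (by norm_num), Real.log_mul (by norm_num) (by norm_num),
      Real.log_mul (by norm_num) (by norm_num), Real.log_pow, Real.log_pow, Real.log_pow]
    push_cast; ring
  have e4 : Real.log ((1 + 1 / 8749) / (1 - 1 / 8749)) =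
      4 * Real.log 5 + Real.log 7 - Real.log 2 - 7 * Real.log 3 := by
    rw [show ((1 + 1 / 8749) / (1 - 1 / 8749) : ℝ) = 5 ^ 4 * 7 / (2 * 3 ^ 7) by norm_num,
      Real.log_div (by norm_num) (by norm_num), Real.log_mul (by norm_num) (by norm_num),
      Real.log_mul (by norm_num) (by norm_num), Real.log_pow, Real.log_pow]
    push_cast; ring
  have l1 := Real.sum_range_le_log_div (x := 1 / 251) (by norm_num) (by norm_num) 9
  have l2 := Real.sum_range_le_log_div (x := 1 / 449) (by norm_num) (by norm_num) 9
  have l3 := Real.sum_range_le_log_div (x := 1 / 4801) (by norm_num) (by norm_num) 7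
  have l4 := Real.sum_range_le_log_div (x := 1 / 8749) (by norm_num) (by norm_num) 7
  have u1 := Real.log_div_le_sum_range_add (x := 1 / 251) (by norm_num) (by norm_num) 9
  have u2 := Real.log_div_le_sum_range_add (x := 1 / 449) (by norm_num) (by norm_num) 9
  have u3 := Real.log_div_le_sum_range_add (x := 1 / 4801) (by norm_num) (by norm_num) 7
  have u4 := Real.log_div_le_sum_range_add (x := 1 / 8749) (by norm_num) (by norm_num) 7
  rw [e1] at l1 u1
  rw [e2] at l2 u2
  rw [e3] at l3 u3
  rw [e4] at l4 u4
  norm_num [Finset.sum_range_succ] at l1 l2 l3 l4 u1 u2 u3 u4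
  refine ⟨⟨?_, ?_⟩, ⟨?_, ?_⟩, ⟨?_, ?_⟩, ⟨?_, ?_⟩⟩ <;> linarith

theorem abs_linear_form_ge_of_basis {α β δ : ℝ} {X₀ Y₀ X₁ Y₁ ε : ℤ} {B X Y : ℕ}
    (hX₀ : 0 ≤ X₀) (hdet : ε * (X₀ * Y₁ - X₁ * Y₀) = 1) (hB : B < X₁) (hδ : 0 ≤ δ)
    (h₀ : δ ≤ X₀ * α - Y₀ * β) (h₁ : X₁ * α - Y₁ * β ≤ 0)
    (hX : 0 < X) (hXB : X ≤ B) : δ ≤ |X * α - Y * β| := by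
  obtain ⟨m, hm⟩ : ∃ m : ℤ, m = ε * (X * Y₁ - Y * X₁) := ⟨_, rfl⟩
  obtain ⟨n, hn⟩ : ∃ n : ℤ, n = ε * (Y * X₀ - X * Y₀) := ⟨_, rfl⟩
  have e1 : (X : ℤ) = m * X₀ + n * X₁ := by rw [hm, hn]; linear_combination (-(X : ℤ)) * hdet
  have e2 : (Y : ℤ) = m * Y₀ + n * Y₁ := by rw [hm, hn]; linear_combination (-(Y : ℤ)) * hdet
  have e3 : (X : ℝ) * α - Y * β = m * (X₀ * α - Y₀ * β) + n * (X₁ * α - Y₁ * β) := by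
    have e1' : (X : ℝ) = m * X₀ + n * X₁ := by exact_mod_cast e1
    have e2' : (Y : ℝ) = m * Y₀ + n * Y₁ := by exact_mod_cast e2
    rw [e1', e2']; ring
  have hX' : (0 : ℤ) < X := by exact_mod_cast hX
  have hXB' : (X : ℤ) ≤ B := by exact_mod_cast hXB
  rw [e3]
  rcases lt_trichotomy m 0 with h | h | h
  · have hn0 : 0 ≤ n := by
      by_contra! hneg
      nlinarith
    have h1 : (m : ℝ) ≤ -1 := by exact_mod_cast Int.le_sub_one_of_lt h
    have h2 : (0 : ℝ) ≤ n := by exact_mod_cast hn0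
    refine le_trans ?_ (neg_le_abs _)
    nlinarith
  · exfalso
    rw [h, zero_mul, zero_add] at e1
    have : 0 < n := by
      by_contra! hneg
      nlinarith
    nlinarith
  · have hn0 : n ≤ 0 := by
      by_contra! hpos
      nlinarith
    have h1 : (1 : ℝ) ≤ m := by exact_mod_cast h
    have h2 : (n : ℝ) ≤ 0 := by exact_mod_cast hn0
    refine le_trans ?_ (le_abs_self _)
    nlinarith

theorem abs_linear_form_ge_of_basis' {α β δ : ℝ} {X₀ Y₀ X₁ Y₁ ε : ℤ} {B X Y : ℕ}
    (hX₀ : 0 ≤ X₀) (hdet : ε * (X₀ * Y₁ - X₁ * Y₀) = 1) (hB : B < X₁) (hδ : 0 ≤ δ)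
    (h₀ : δ ≤ Y₀ * β - X₀ * α) (h₁ : 0 ≤ X₁ * α - Y₁ * β)
    (hX : 0 < X) (hXB : X ≤ B) : δ ≤ |X * α - Y * β| := by
  have := abs_linear_form_ge_of_basis (α := -α) (β := -β) (Y := Y) hX₀ hdet hB hδ (by linarith)
    (by linarith) hX hXB
  rwa [mul_neg, mul_neg, sub_neg_eq_add, neg_add_eq_sub, abs_sub_comm] at this

/-- The pairs of coprime integers between `2` and `10` that are not perfect powers. -/
def smallPairs : List (ℕ × ℕ) :=
  [(2, 3), (2, 5), (2, 7), (3, 5), (3, 7), (3, 10), (5, 6), (5, 7), (6, 7), (7, 10)]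

theorem abs_linear_form_ge {a b X Y : ℕ}
    (hab : (a, b) ∈ smallPairs)
    (hX : 0 < X) (hXB : X ≤ 2 ^ 55) : 1 / 2 ^ 58 ≤ |X * Real.log a - Y * Real.log b| := by
  obtain ⟨⟨h2, h2'⟩, ⟨h3, h3'⟩, ⟨h5, h5'⟩, ⟨h7, h7'⟩⟩ := log_two_three_five_seven_bounds
  have h6 : Real.log 6 = Real.log 2 + Real.log 3 := by
    rw [← Real.log_mul (by norm_num) (by norm_num)]; norm_num
  have h10 : Real.log 10 = Real.log 2 + Real.log 5 := by
    rw [← Real.log_mul (by norm_num) (by norm_num)]; norm_num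
  simp only [smallPairs, List.mem_cons, Prod.mk.injEq, List.not_mem_nil, or_false] at hab
  rcases hab with ⟨rfl, rfl⟩ | ⟨rfl, rfl⟩ | ⟨rfl, rfl⟩ | ⟨rfl, rfl⟩ | ⟨rfl, rfl⟩ | ⟨rfl, rfl⟩ | ⟨rfl, rfl⟩ | ⟨rfl, rfl⟩ | ⟨rfl, rfl⟩ | ⟨rfl, rfl⟩
  · exact abs_linear_form_ge_of_basis' (X₀ := 9881527843552324) (Y₀ := 6234549927241963)
      (X₁ := 206745572560704147) (Y₁ := 130441933147714940) (ε := -1) (B := 2 ^ 55)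
      (by norm_num) (by norm_num) (by norm_num) (by norm_num) (by push_cast; linarith)
      (by push_cast; linarith) hX hXB
  · exact abs_linear_form_ge_of_basis (X₀ := 8009031126156845) (Y₀ := 3449301958915901)
      (X₁ := 70558300318610924) (Y₁ := 30387805924728145) (ε := 1) (B := 2 ^ 55)
      (by norm_num) (by norm_num) (by norm_num) (by norm_num) (by push_cast; linarith)
      (by push_cast; linarith) hX hXB
  · exact abs_linear_form_ge_of_basis' (X₀ := 20322052289942035) (Y₀ := 7238861082462393)
      (X₁ := 105678769858468227) (Y₁ := 37643537348321006) (ε := -1) (B := 2 ^ 55)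
      (by norm_num) (by norm_num) (by norm_num) (by norm_num) (by push_cast; linarith)
      (by push_cast; linarith) hX hXB
  · exact abs_linear_form_ge_of_basis (X₀ := 9204617821470977) (Y₀ := 6283129142812184)
      (X₁ := 108541843848649526) (Y₁ := 74091334972018705) (ε := 1) (B := 2 ^ 55)
      (by norm_num) (by norm_num) (by norm_num) (by norm_num) (by push_cast; linarith)
      (by push_cast; linarith) hX hXB
  · exact abs_linear_form_ge_of_basis' (X₀ := 31808191124006747) (Y₀ := 17958110587018878)
      (X₁ := 46454387823411612) (Y₁ := 26226987587340805) (ε := -1) (B := 2 ^ 55)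
      (by norm_num) (by norm_num) (by norm_num) (by norm_num) (by push_cast; linarith)
      (by push_cast; linarith) hX hXB
  · exact abs_linear_form_ge_of_basis' (X₀ := 20523070088120133) (Y₀ := 9791992951143451)
      (X₁ := 40392269098419613) (Y₁ := 19272010113212214) (ε := -1) (B := 2 ^ 55)
      (by norm_num) (by norm_num) (by norm_num) (by norm_num) (by push_cast; linarith)
      (by push_cast; linarith) hX hXB
  · exact abs_linear_form_ge_of_basis' (X₀ := 30508113238678541) (Y₀ := 27403741923192466)
      (X₁ := 39453600596157343) (Y₁ := 35438975862561057) (ε := -1) (B := 2 ^ 55)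
      (by norm_num) (by norm_num) (by norm_num) (by norm_num) (by push_cast; linarith)
      (by push_cast; linarith) hX hXB
  · exact abs_linear_form_ge_of_basis' (X₀ := 23262365510622659) (Y₀ := 19240011160778071)
      (X₁ := 75299752740645869) (Y₁ := 62279482388507822) (ε := -1) (B := 2 ^ 55)
      (by norm_num) (by norm_num) (by norm_num) (by norm_num) (by push_cast; linarith)
      (by push_cast; linarith) hX hXB
  · exact abs_linear_form_ge_of_basis (X₀ := 24538223693636095) (Y₀ := 22594360115986488)
      (X₁ := 38085782422008633) (Y₁ := 35068711333214599) (ε := 1) (B := 2 ^ 55)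
      (by norm_num) (by norm_num) (by norm_num) (by norm_num) (by push_cast; linarith)
      (by push_cast; linarith) hX hXB
  · exact abs_linear_form_ge_of_basis (X₀ := 2430566867534421) (Y₀ := 2054067295876931)
      (X₁ := 51517003497969220) (Y₁ := 43536918683541401) (ε := 1) (B := 2 ^ 55)
      (by norm_num) (by norm_num) (by norm_num) (by norm_num) (by push_cast; linarith)
      (by push_cast; linarith) hX hXB

theorem abs_linear_form_ge_of_le_two_pow_fourteen {a b X Y : ℕ}
    (hab : (a, b) ∈ [(3, 5), (3, 7), (5, 7)])
    (hX : 0 < X) (hXB : X ≤ 2 ^ 14) : 1 / 2 ^ 17 ≤ |X * Real.log a - Y * Real.log b| := by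
  obtain ⟨⟨h2, h2'⟩, ⟨h3, h3'⟩, ⟨h5, h5'⟩, ⟨h7, h7'⟩⟩ := log_two_three_five_seven_bounds
  simp only [List.mem_cons, Prod.mk.injEq, List.not_mem_nil, or_false] at hab
  rcases hab with ⟨rfl, rfl⟩ | ⟨rfl, rfl⟩ | ⟨rfl, rfl⟩
  · exact abs_linear_form_ge_of_basis' (X₀ := 12171) (Y₀ := 8308)
      (X₁ := 140803) (Y₁ := 96113) (ε := -1) (B := 2 ^ 14)
      (by norm_num) (by norm_num) (by norm_num) (by norm_num) (by push_cast; linarith)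
      (by push_cast; linarith) hX hXB
  · exact abs_linear_form_ge_of_basis (X₀ := 6024) (Y₀ := 3401)
      (X₁ := 193039) (Y₁ := 108985) (ε := 1) (B := 2 ^ 14)
      (by norm_num) (by norm_num) (by norm_num) (by norm_num) (by push_cast; linarith)
      (by push_cast; linarith) hX hXB
  · exact abs_linear_form_ge_of_basis (X₀ := 1521) (Y₀ := 1258)
      (X₁ := 18599) (Y₁ := 15383) (ε := 1) (B := 2 ^ 14)
      (by norm_num) (by norm_num) (by norm_num) (by norm_num) (by push_cast; linarith)
      (by push_cast; linarith) hX hXB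

theorem abs_linear_form_ge_of_le_two_pow_ten {a b X Y : ℕ}
    (hab : (a, b) ∈ [(3, 5), (3, 7), (5, 7)])
    (hX : 0 < X) (hXB : X ≤ 2 ^ 10) : 1 / 2 ^ 12 ≤ |X * Real.log a - Y * Real.log b| := by
  obtain ⟨⟨h2, h2'⟩, ⟨h3, h3'⟩, ⟨h5, h5'⟩, ⟨h7, h7'⟩⟩ := log_two_three_five_seven_bounds
  simp only [List.mem_cons, Prod.mk.injEq, List.not_mem_nil, or_false] at hab
  rcases hab with ⟨rfl, rfl⟩ | ⟨rfl, rfl⟩ | ⟨rfl, rfl⟩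
  · exact abs_linear_form_ge_of_basis' (X₀ := 230) (Y₀ := 157)
      (X₁ := 1673) (Y₁ := 1142) (ε := -1) (B := 2 ^ 10)
      (by norm_num) (by norm_num) (by norm_num) (by norm_num) (by push_cast; linarith)
      (by push_cast; linarith) hX hXB
  · exact abs_linear_form_ge_of_basis' (X₀ := 271) (Y₀ := 153)
      (X₁ := 6024) (Y₁ := 3401) (ε := -1) (B := 2 ^ 10)
      (by norm_num) (by norm_num) (by norm_num) (by norm_num) (by push_cast; linarith)
      (by push_cast; linarith) hX hXB
  · exact abs_linear_form_ge_of_basis' (X₀ := 347) (Y₀ := 287)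
      (X₁ := 1521) (Y₁ := 1258) (ε := -1) (B := 2 ^ 10)
      (by norm_num) (by norm_num) (by norm_num) (by norm_num) (by push_cast; linarith)
      (by push_cast; linarith) hX hXB

/-- Binary form of `linear_form_lower_bound`. -/
theorem linear_form_lower_bound_two_pow {a b X Y s : ℕ} (hs : 1 ≤ s) (ha : 2 ≤ a) (ha' : a ≤ 10)
    (hb : 2 ≤ b) (hb' : b ≤ 10) (hcop : Nat.Coprime a b) (hX : 0 < X) (hY : 0 < Y)
    (hXY : X + Y ≤ 2 ^ s) :
    1 / 2 ^ (3326 * (6 * s + 40) ^ 2) ≤ |X * Real.log a - Y * Real.log b| := by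
  refine le_trans ?_ (linear_form_lower_bound hs ha ha' hb hb' hcop hX hY hXY)
  rw [Real.exp_neg, one_div]
  refine inv_anti₀ (Real.exp_pos _) ?_
  generalize hE : (6 * s + 40) ^ 2 = E
  have hE' : (6 * (s : ℝ) + 40) ^ 2 = E := by rw [← hE]; push_cast; ring
  rw [hE', ← Real.exp_log (show (0 : ℝ) < 2 ^ (3326 * E) by positivity), Real.log_pow]
  apply Real.exp_le_exp.2
  push_cast
  have := Real.log_two_gt_d9
  have h0 : (0 : ℝ) ≤ E := Nat.cast_nonneg _
  nlinarith

theorem pow_dvd_mul_of_pow_dvd_pow_sub_one {p e x q b k : ℕ} (hp : p.Prime)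
    (hpb : (p : ℤ) ∣ (b : ℤ) ^ k - 1) (h4 : p = 2 → (4 : ℤ) ∣ (b : ℤ) ^ k - 1)
    (he : ¬ (p : ℤ) ^ (e + 1) ∣ (b : ℤ) ^ k - 1) (h : (p : ℤ) ^ x ∣ (b : ℤ) ^ q - 1) :
    p ^ x ∣ p ^ e * q := by
  have hpb' : ¬ (p : ℤ) ∣ (b : ℤ) ^ k := by
    intro h1
    have h2 : (p : ℤ) ∣ 1 := by simpa using dvd_sub h1 hpb
    exact hp.one_lt.ne' (by exact_mod_cast Int.natAbs_dvd_natAbs.2 h2 |> Nat.dvd_one.1)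
  have hx : (p : ℤ) ^ x ∣ ((b : ℤ) ^ k) ^ q - 1 ^ q := by
    rw [← pow_mul, mul_comm, pow_mul, one_pow]
    exact h.trans (by simpa using sub_dvd_pow_sub_pow ((b : ℤ) ^ q) 1 k)
  rw [pow_dvd_iff_le_emultiplicity] at hx ⊢
  have hmul : emultiplicity (p : ℤ) (((b : ℤ) ^ k) ^ q - 1 ^ q) =
      emultiplicity (p : ℤ) ((b : ℤ) ^ k - 1) + emultiplicity p q := by
    rcases hp.eq_two_or_odd' with h2 | h2
    · subst h2
      have := Int.two_pow_sub_pow' (x := (b : ℤ) ^ k) (y := 1) q (h4 rfl) (by exact_mod_cast hpb')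
      rw [Nat.cast_ofNat, this]
      congr 1
      exact_mod_cast Int.natCast_emultiplicity 2 q
    · exact Int.emultiplicity_pow_sub_pow hp h2 hpb hpb' q
  rw [hmul] at hx
  rw [emultiplicity_mul hp.prime, emultiplicity_pow_self hp.ne_zero hp.prime.not_isUnit]
  refine hx.trans (add_le_add_left ?_ _)
  have := emultiplicity_lt_iff_not_dvd.2 he
  rw [Nat.cast_add_one] at this
  exact ENat.lt_add_one_iff (by simp) |>.1 this

theorem two_pow_le_of_pow_dvd_pow_sub_one {p e x q a b k : ℕ} (hp : p.Prime) (he4 : e ≤ 4)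
    (hq : 0 < q) (hpa : p ∣ a) (hpb : (p : ℤ) ∣ (b : ℤ) ^ k - 1)
    (h4 : p = 2 → (4 : ℤ) ∣ (b : ℤ) ^ k - 1)
    (he : ¬ (p : ℤ) ^ (e + 1) ∣ (b : ℤ) ^ k - 1) (h : (a : ℤ) ^ x ∣ (b : ℤ) ^ q - 1) :
    2 ^ x ≤ 16 * q := by
  have h1 := pow_dvd_mul_of_pow_dvd_pow_sub_one hp hpb h4 he
    ((pow_dvd_pow_of_dvd (Int.natCast_dvd_natCast.2 hpa) x).trans h)
  rcases le_total x e with hxe | hxe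
  · calc 2 ^ x ≤ 2 ^ 4 := Nat.pow_le_pow_right (by norm_num) (hxe.trans he4)
      _ ≤ 16 * q := by omega
  · obtain ⟨d, rfl⟩ := Nat.exists_eq_add_of_le hxe
    rw [pow_add] at h1
    have h2 := Nat.le_of_dvd hq (Nat.dvd_of_mul_dvd_mul_left (pow_pos hp.pos e) h1)
    have h3 : 2 ^ d ≤ p ^ d := Nat.pow_le_pow_left hp.two_le d
    have h5 : 2 ^ e ≤ 2 ^ 4 := Nat.pow_le_pow_right (by norm_num) he4
    calc 2 ^ (e + d) = 2 ^ e * 2 ^ d := pow_add _ _ _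
      _ ≤ 2 ^ 4 * q := Nat.mul_le_mul h5 (h3.trans h2)
      _ = _ := by norm_num

theorem two_pow_le_of_pow_dvd_pow_sub_one_left {a b x q : ℕ}
    (hab : (a, b) ∈ smallPairs)
    (hq : 0 < q) (h : (a : ℤ) ^ x ∣ (b : ℤ) ^ q - 1) : 2 ^ x ≤ 16 * q := by
  simp only [smallPairs, List.mem_cons, Prod.mk.injEq, List.not_mem_nil, or_false] at hab
  rcases hab with ⟨rfl, rfl⟩ | ⟨rfl, rfl⟩ | ⟨rfl, rfl⟩ | ⟨rfl, rfl⟩ | ⟨rfl, rfl⟩ | ⟨rfl, rfl⟩ |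
    ⟨rfl, rfl⟩ | ⟨rfl, rfl⟩ | ⟨rfl, rfl⟩ | ⟨rfl, rfl⟩
  · exact two_pow_le_of_pow_dvd_pow_sub_one (p := 2) (k := 2) (e := 3) Nat.prime_two (by norm_num)
      hq (by norm_num) (by norm_num) (by norm_num) (by norm_num) h
  · exact two_pow_le_of_pow_dvd_pow_sub_one (p := 2) (k := 2) (e := 3) Nat.prime_two (by norm_num)
      hq (by norm_num) (by norm_num) (by norm_num) (by norm_num) h
  · exact two_pow_le_of_pow_dvd_pow_sub_one (p := 2) (k := 2) (e := 4) Nat.prime_two (by norm_num)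
      hq (by norm_num) (by norm_num) (by norm_num) (by norm_num) h
  · exact two_pow_le_of_pow_dvd_pow_sub_one (p := 3) (k := 2) (e := 1) Nat.prime_three (by norm_num)
      hq (by norm_num) (by norm_num) (by norm_num) (by norm_num) h
  · exact two_pow_le_of_pow_dvd_pow_sub_one (p := 3) (k := 2) (e := 1) Nat.prime_three (by norm_num)
      hq (by norm_num) (by norm_num) (by norm_num) (by norm_num) h
  · exact two_pow_le_of_pow_dvd_pow_sub_one (p := 3) (k := 2) (e := 2) Nat.prime_three (by norm_num)
      hq (by norm_num) (by norm_num) (by norm_num) (by norm_num) h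
  · exact two_pow_le_of_pow_dvd_pow_sub_one (p := 5) (k := 4) (e := 1) Nat.prime_five (by norm_num)
      hq (by norm_num) (by norm_num) (by norm_num) (by norm_num) h
  · exact two_pow_le_of_pow_dvd_pow_sub_one (p := 5) (k := 4) (e := 2) Nat.prime_five (by norm_num)
      hq (by norm_num) (by norm_num) (by norm_num) (by norm_num) h
  · exact two_pow_le_of_pow_dvd_pow_sub_one (p := 3) (k := 2) (e := 1) Nat.prime_three (by norm_num)
      hq (by norm_num) (by norm_num) (by norm_num) (by norm_num) h
  · exact two_pow_le_of_pow_dvd_pow_sub_one (p := 7) (k := 6) (e := 1) Nat.prime_seven (by norm_num)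
      hq (by norm_num) (by norm_num) (by norm_num) (by norm_num) h

theorem two_pow_le_of_pow_dvd_pow_sub_one_right {a b x q : ℕ}
    (hab : (a, b) ∈ smallPairs)
    (hq : 0 < q) (h : (b : ℤ) ^ x ∣ (a : ℤ) ^ q - 1) : 2 ^ x ≤ 16 * q := by
  simp only [smallPairs, List.mem_cons, Prod.mk.injEq, List.not_mem_nil, or_false] at hab
  rcases hab with ⟨rfl, rfl⟩ | ⟨rfl, rfl⟩ | ⟨rfl, rfl⟩ | ⟨rfl, rfl⟩ | ⟨rfl, rfl⟩ | ⟨rfl, rfl⟩ |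
    ⟨rfl, rfl⟩ | ⟨rfl, rfl⟩ | ⟨rfl, rfl⟩ | ⟨rfl, rfl⟩
  · exact two_pow_le_of_pow_dvd_pow_sub_one (p := 3) (k := 2) (e := 1) Nat.prime_three (by norm_num)
      hq (by norm_num) (by norm_num) (by norm_num) (by norm_num) h
  · exact two_pow_le_of_pow_dvd_pow_sub_one (p := 5) (k := 4) (e := 1) Nat.prime_five (by norm_num)
      hq (by norm_num) (by norm_num) (by norm_num) (by norm_num) h
  · exact two_pow_le_of_pow_dvd_pow_sub_one (p := 7) (k := 6) (e := 1) Nat.prime_seven (by norm_num)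
      hq (by norm_num) (by norm_num) (by norm_num) (by norm_num) h
  · exact two_pow_le_of_pow_dvd_pow_sub_one (p := 5) (k := 4) (e := 1) Nat.prime_five (by norm_num)
      hq (by norm_num) (by norm_num) (by norm_num) (by norm_num) h
  · exact two_pow_le_of_pow_dvd_pow_sub_one (p := 7) (k := 6) (e := 1) Nat.prime_seven (by norm_num)
      hq (by norm_num) (by norm_num) (by norm_num) (by norm_num) h
  · exact two_pow_le_of_pow_dvd_pow_sub_one (p := 5) (k := 4) (e := 1) Nat.prime_five (by norm_num)
      hq (by norm_num) (by norm_num) (by norm_num) (by norm_num) h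
  · exact two_pow_le_of_pow_dvd_pow_sub_one (p := 3) (k := 2) (e := 1) Nat.prime_three (by norm_num)
      hq (by norm_num) (by norm_num) (by norm_num) (by norm_num) h
  · exact two_pow_le_of_pow_dvd_pow_sub_one (p := 7) (k := 6) (e := 1) Nat.prime_seven (by norm_num)
      hq (by norm_num) (by norm_num) (by norm_num) (by norm_num) h
  · exact two_pow_le_of_pow_dvd_pow_sub_one (p := 7) (k := 6) (e := 1) Nat.prime_seven (by norm_num)
      hq (by norm_num) (by norm_num) (by norm_num) (by norm_num) h
  · exact two_pow_le_of_pow_dvd_pow_sub_one (p := 5) (k := 4) (e := 2) Nat.prime_five (by norm_num)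
      hq (by norm_num) (by norm_num) (by norm_num) (by norm_num) h

theorem le_mul_two_pow_of_abs_log_sub {u v D E : ℕ} (hu : 0 < u) (hv : 0 < v) (h1 : u ≤ v + D)
    (h2 : v ≤ u + D) (hE : 1 / 2 ^ E ≤ |Real.log u - Real.log v|) :
    max u v ≤ 2 * D * 2 ^ E := by
  wlog h : v ≤ u generalizing u v
  · rw [max_comm]
    exact this hv hu h2 h1 (by rwa [abs_sub_comm]) (by omega)
  have hu' : (0 : ℝ) < u := by exact_mod_cast hu
  have hv' : (0 : ℝ) < v := by exact_mod_cast hv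
  have h3 := Real.log_le_sub_one_of_pos (div_pos hu' hv')
  rw [Real.log_div hu'.ne' hv'.ne'] at h3
  rw [abs_of_nonneg (sub_nonneg.2 (Real.log_le_log hv' (by exact_mod_cast h)))] at hE
  have h4 : (u : ℝ) / v - 1 ≤ D / v := by
    rw [div_sub_one hv'.ne']
    gcongr
    have : (u : ℝ) ≤ v + D := by exact_mod_cast h1
    linarith
  have h5 := (hE.trans h3).trans h4
  rw [div_le_div_iff₀ (by positivity) hv', one_mul] at h5
  have h6 : v ≤ D * 2 ^ E := by exact_mod_cast h5
  rw [max_eq_left h]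
  nlinarith [Nat.one_le_two_pow (n := E)]

theorem arch_exponent_lt_two_pow {s : ℕ} (hs : 40 ≤ s) :
    13 + 4 * s + 3326 * (6 * s + 40) ^ 2 < 2 ^ (s - 2) := by
  induction s, hs using Nat.le_induction with
  | base => norm_num
  | succ s hs ih =>
    obtain ⟨t, rfl⟩ := Nat.exists_eq_add_of_le hs
    rw [show 40 + t + 1 - 2 = (40 + t - 2) + 1 by omega, pow_succ 2]
    generalize 2 ^ (40 + t - 2) = P at ih ⊢
    nlinarith

theorem two_pow_mul_pow_four_lt {W : ℕ} (hW : 102 ≤ W) : 2 * (16 * W) ^ 4 * 2 ^ 58 < 2 ^ W := by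
  induction W, hW using Nat.le_induction with
  | base => norm_num
  | succ W hW ih =>
    rw [pow_succ]
    have h1 : (W + 1) ^ 4 ≤ 2 * W ^ 4 := by
      have h2 : W + 1 ≤ 2 * W := by omega
      nlinarith [pow_pos (show 0 < W by omega) 2, pow_pos (show 0 < W by omega) 3]
    calc 2 * (16 * (W + 1)) ^ 4 * 2 ^ 58 = 2 * 16 ^ 4 * (W + 1) ^ 4 * 2 ^ 58 := by
          rw [mul_pow]; ring
      _ ≤ 2 * 16 ^ 4 * (2 * W ^ 4) * 2 ^ 58 := by gcongr
      _ = 2 * (16 * W) ^ 4 * 2 ^ 58 * 2 := by rw [mul_pow]; ring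
      _ < _ := by omega

theorem mem_smallPairs_bounds {a b : ℕ} (hab : (a, b) ∈ smallPairs) :
    2 ≤ a ∧ a ≤ 10 ∧ 2 ≤ b ∧ b ≤ 10 ∧ Nat.Coprime a b := by
  have : ∀ p ∈ smallPairs, 2 ≤ p.1 ∧ p.1 ≤ 10 ∧ 2 ≤ p.2 ∧ p.2 ≤ 10 ∧ Nat.Coprime p.1 p.2 := by
    decide
  exact this _ hab

theorem pow_le_pow_four_of_two_pow_le {a t W : ℕ} (ha : a ≤ 10) (h : 2 ^ t ≤ W) :
    a ^ t ≤ W ^ 4 := by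
  calc a ^ t ≤ (2 ^ 4) ^ t := Nat.pow_le_pow_left (by omega) t
    _ = (2 ^ t) ^ 4 := by rw [← pow_mul, ← pow_mul, mul_comm]
    _ ≤ _ := Nat.pow_le_pow_left h 4

theorem pillai_exponents_bounded {a b x₁ y₁ x₂ y₂ : ℕ} (hab : (a, b) ∈ smallPairs)
    (hx : x₂ < x₁) (hy : y₁ < y₂)
    (h : a ^ x₁ + b ^ y₁ = a ^ x₂ + b ^ y₂) :
    x₁ ≤ 101 ∧ y₂ ≤ 101 ∧ (a : ℤ) ^ x₂ ∣ (b : ℤ) ^ (y₂ - y₁) - 1 ∧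
      (b : ℤ) ^ y₁ ∣ (a : ℤ) ^ (x₁ - x₂) - 1 ∧ 2 ^ x₂ ≤ 1616 ∧ 2 ^ y₁ ≤ 1616 := by
  obtain ⟨ha, ha', hb, hb', hcop⟩ := mem_smallPairs_bounds hab
  have hz : (a : ℤ) ^ x₂ * ((a : ℤ) ^ (x₁ - x₂) - 1) =
      (b : ℤ) ^ y₁ * ((b : ℤ) ^ (y₂ - y₁) - 1) := by
    rw [mul_sub, mul_sub, ← pow_add, ← pow_add, Nat.add_sub_cancel' hx.le,
      Nat.add_sub_cancel' hy.le]
    have : (a : ℤ) ^ x₁ + (b : ℤ) ^ y₁ = (a : ℤ) ^ x₂ + (b : ℤ) ^ y₂ := by exact_mod_cast h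
    linarith
  have hcop' : IsCoprime ((a : ℤ) ^ x₂) ((b : ℤ) ^ y₁) :=
    (Nat.isCoprime_iff_coprime.2 hcop).pow
  have hd1 : (a : ℤ) ^ x₂ ∣ (b : ℤ) ^ (y₂ - y₁) - 1 := hcop'.dvd_of_dvd_mul_left ⟨_, hz.symm⟩
  have hd2 : (b : ℤ) ^ y₁ ∣ (a : ℤ) ^ (x₁ - x₂) - 1 := hcop'.symm.dvd_of_dvd_mul_left ⟨_, hz⟩
  have h2x := two_pow_le_of_pow_dvd_pow_sub_one_left hab (by omega) hd1
  have h2y := two_pow_le_of_pow_dvd_pow_sub_one_right hab (by omega) hd2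
  obtain ⟨W, hW⟩ : ∃ W, W = max x₁ y₂ := ⟨_, rfl⟩
  have hxW : x₁ ≤ W := by omega
  have hyW : y₂ ≤ W := by omega
  have hax : a ^ x₂ ≤ (16 * W) ^ 4 := pow_le_pow_four_of_two_pow_le ha' (h2x.trans (by omega))
  have hby : b ^ y₁ ≤ (16 * W) ^ 4 := pow_le_pow_four_of_two_pow_le hb' (h2y.trans (by omega))
  have key : ∀ E : ℕ, 1 / 2 ^ E ≤ |x₁ * Real.log a - y₂ * Real.log b| →
      2 ^ W ≤ 2 * (16 * W) ^ 4 * 2 ^ E := by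
    intro E hE
    rw [← Real.log_pow, ← Real.log_pow, ← Nat.cast_pow, ← Nat.cast_pow] at hE
    have h1 := le_mul_two_pow_of_abs_log_sub (D := (16 * W) ^ 4) (by positivity) (by positivity)
      (by omega) (by omega) hE
    refine le_trans ?_ h1
    rcases le_total x₁ y₂ with h3 | h3
    · rw [hW, max_eq_right h3]
      exact (Nat.pow_le_pow_left hb _).trans (le_max_right _ _)
    · rw [hW, max_eq_left h3]
      exact (Nat.pow_le_pow_left ha _).trans (le_max_left _ _)
  have hbig : W ≤ 2 ^ 55 := by
    by_contra! hlt
    obtain ⟨s, hs⟩ : ∃ s, s = Nat.clog 2 (2 * W) := ⟨_, rfl⟩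
    have hs1 : 2 * W ≤ 2 ^ s := by rw [hs]; exact Nat.le_pow_clog (by norm_num) _
    have hs2 : 2 ^ (s - 1) < 2 * W := by
      rw [hs]; exact Nat.pow_pred_clog_lt_self (by norm_num) (by omega)
    have hs3 : 40 ≤ s := by
      by_contra! h4
      have : 2 ^ s ≤ 2 ^ 40 := Nat.pow_le_pow_right (by norm_num) h4.le
      omega
    have hE := key _ (linear_form_lower_bound_two_pow (s := s) (by omega) ha ha' hb hb' hcop
      (by omega) (by omega) (by omega))
    have hW2 : 16 * W ≤ 2 ^ (3 + s) := by rw [pow_add]; omega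
    have h7 := arch_exponent_lt_two_pow hs3
    generalize 3326 * (6 * s + 40) ^ 2 = E at hE h7
    have h5 : 2 ^ W ≤ 2 ^ (13 + 4 * s + E) := by
      calc 2 ^ W ≤ _ := hE
        _ ≤ 2 * (2 ^ (3 + s)) ^ 4 * 2 ^ E := by gcongr
        _ = _ := by rw [← pow_mul, ← pow_succ', ← pow_add]; congr 1; ring
    have h6 := (Nat.pow_le_pow_iff_right (by norm_num)).1 h5
    have h8 : 2 ^ (s - 1) = 2 * 2 ^ (s - 2) := by
      rw [← pow_succ']; congr 1; omega
    omega
  have hW101 : W ≤ 101 := by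
    by_contra! hlt
    have h58 := abs_linear_form_ge (Y := y₂) hab (by omega : 0 < x₁) (hxW.trans hbig)
    exact absurd (key 58 h58) (not_le.2 (two_pow_mul_pow_four_lt hlt))
  exact ⟨by omega, by omega, hd1, hd2, h2x.trans (by omega), h2y.trans (by omega)⟩

theorem pillai_finite_check : (smallPairs.all fun p => (List.range 11).all fun y =>
    (List.range 102).all fun u => y == 0 || u == 0 || (p.1 ^ u - 1) % p.2 ^ y != 0 ||
      (List.range 11).all fun x => x == 0 ||
        p.2 ^ 101 % (p.1 ^ x * (p.1 ^ u - 1) / p.2 ^ y + 1) != 0 ||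
        (p.1 ^ x * (p.1 ^ u - 1) / p.2 ^ y + 1) % p.2 != 0 ||
        decide ((p.1, p.2, p.1 ^ (x + u) + p.2 ^ y) ∈
          [(2, 3, 11), (2, 3, 35), (2, 3, 259), (2, 5, 133)])) = true := by
  decide +kernel

/-- Coincidences between sums of two powers of fixed small integers. -/
theorem pillai_small {a b x₁ y₁ x₂ y₂ : ℕ} (hab : (a, b) ∈ smallPairs)
    (hx₂ : 1 ≤ x₂) (hy₁ : 1 ≤ y₁) (hx : x₂ < x₁) (hy : y₁ < y₂)
    (h : a ^ x₁ + b ^ y₁ = a ^ x₂ + b ^ y₂) :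
    (a, b, a ^ x₁ + b ^ y₁) ∈ [(2, 3, 11), (2, 3, 35), (2, 3, 259), (2, 5, 133)] := by
  obtain ⟨ha, ha', hb, hb', hcop⟩ := mem_smallPairs_bounds hab
  obtain ⟨h1, h2, -, h4, h5, h6⟩ := pillai_exponents_bounded hab hx hy h
  have hsmall : ∀ t, 2 ^ t ≤ 1616 → t < 11 := by
    intro t ht
    by_contra! hlt
    have := Nat.pow_le_pow_right (n := 2) (by norm_num) hlt
    omega
  have e1 : x₁ = x₂ + (x₁ - x₂) := by omega
  have e2 : y₂ = y₁ + (y₂ - y₁) := by omega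
  obtain ⟨u, hu⟩ : ∃ u, u = x₁ - x₂ := ⟨_, rfl⟩
  obtain ⟨w, hw⟩ : ∃ w, w = y₂ - y₁ := ⟨_, rfl⟩
  rw [← hu] at e1 h4
  rw [← hw] at e2
  subst e1 e2
  have hau : 1 ≤ a ^ u := Nat.one_le_pow _ _ (by omega)
  have hbw : 1 ≤ b ^ w := Nat.one_le_pow _ _ (by omega)
  have heq : a ^ x₂ * (a ^ u - 1) = b ^ y₁ * (b ^ w - 1) := by
    zify [hau, hbw]
    have : (a : ℤ) ^ (x₂ + u) + (b : ℤ) ^ y₁ = (a : ℤ) ^ x₂ + (b : ℤ) ^ (y₁ + w) := by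
      exact_mod_cast h
    rw [pow_add, pow_add] at this
    linarith
  have hdvd : b ^ y₁ ∣ a ^ u - 1 := by
    zify [hau]; exact h4
  have h7 := pillai_finite_check
  simp only [List.all_eq_true, List.mem_range, Bool.or_eq_true, beq_iff_eq, bne_iff_ne,
    decide_eq_true_eq] at h7
  have h8 := h7 _ hab y₁ (hsmall _ h6) u (by omega)
  change ((y₁ = 0 ∨ u = 0) ∨ (a ^ u - 1) % b ^ y₁ ≠ 0) ∨ _ at h8
  have h9 := (h8.resolve_left (by
    rintro ((h9 | h9) | h9)
    · omega
    · omega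
    · exact h9 (Nat.mod_eq_zero_of_dvd hdvd))) x₂ (hsmall _ h5)
  change ((x₂ = 0 ∨ b ^ 101 % (a ^ x₂ * (a ^ u - 1) / b ^ y₁ + 1) ≠ 0) ∨
    (a ^ x₂ * (a ^ u - 1) / b ^ y₁ + 1) % b ≠ 0) ∨ _ at h9
  rw [heq, Nat.mul_div_cancel_left _ (by positivity), Nat.sub_add_cancel hbw] at h9
  refine h9.resolve_left ?_
  rintro ((h10 | h10) | h10)
  · omega
  · exact h10 (Nat.mod_eq_zero_of_dvd (pow_dvd_pow _ (by omega)))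
  · exact h10 (Nat.mod_eq_zero_of_dvd (dvd_pow_self b (by omega)))

theorem mul_sub_lt_pow_sub_pow {C B : ℤ} (hB : 1 ≤ B) (hCB : B < C) {n : ℕ} (hn : 2 ≤ n) :
    n * (C - B) < C ^ n - B ^ n := by
  induction n, hn using Nat.le_induction with
  | base => push_cast; nlinarith
  | succ n hn ih =>
    have h1 : (1 : ℤ) ≤ B ^ n := one_le_pow₀ hB
    have h2 : (0 : ℤ) ≤ n * (C - B) := mul_nonneg (by positivity) (by linarith)
    have e : C ^ (n + 1) - B ^ (n + 1) = C * (C ^ n - B ^ n) + B ^ n * (C - B) := by ring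
    rw [e]
    push_cast
    nlinarith

theorem dvd_sub_of_dvd_pow_sub_pow_of_coprime {P C B : ℤ} {m n : ℕ} (hB : IsCoprime P B)
    (hmn : Nat.Coprime m n) (hm : P ∣ C ^ m - B ^ m) (hn : P ∣ C ^ n - B ^ n) : P ∣ C - B := by
  obtain ⟨B', u, h⟩ : ∃ B' u : ℤ, B' * P + u * B = 1 := hB
  have hu : ∀ k : ℕ, P ∣ C ^ k - B ^ k → P ∣ (u * C) ^ k - 1 := by
    intro k hk
    have h1 : P ∣ (u * B) ^ k - 1 ^ k :=
      (show P ∣ u * B - 1 from ⟨-B', by linarith⟩).trans (sub_dvd_pow_sub_pow _ _ k)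
    have e : (u * C) ^ k - 1 = u ^ k * (C ^ k - B ^ k) + ((u * B) ^ k - 1 ^ k) := by ring
    rw [e]
    exact dvd_add (Dvd.dvd.mul_left hk _) h1
  have key : P ∣ u * C - 1 := by
    have h1 := hu m hm
    have h2 := hu n hn
    rw [← Int.natAbs_dvd] at h1 h2 ⊢
    have e1 : ((u : ZMod P.natAbs) * C) ^ m = 1 := by
      have := (ZMod.intCast_eq_intCast_iff_dvd_sub _ _ _).2 h1
      push_cast at this
      exact this.symm
    have e2 : ((u : ZMod P.natAbs) * C) ^ n = 1 := by
      have := (ZMod.intCast_eq_intCast_iff_dvd_sub _ _ _).2 h2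
      push_cast at this
      exact this.symm
    rw [← ZMod.intCast_eq_intCast_iff_dvd_sub]
    push_cast
    have e3 := Nat.dvd_gcd (orderOf_dvd_of_pow_eq_one e1) (orderOf_dvd_of_pow_eq_one e2)
    rw [hmn.gcd_eq_one, Nat.dvd_one, orderOf_eq_one_iff] at e3
    exact e3.symm
  have e : C - B = B * (u * C - 1) - C * (u * B - 1) := by ring
  rw [e]
  exact dvd_sub (Dvd.dvd.mul_left key _) (Dvd.dvd.mul_left ⟨-B', by linarith⟩ _)

theorem exponent_ratio_ne {p b c x₁ y₁ z₁ x₂ y₂ z₂ : ℕ} (hp : p.Prime) (hodd : Odd p)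
    (hb : 2 ≤ b) (hpb : ¬ p ∣ b) (hx₁ : 0 < x₁) (hy₁ : 0 < y₁) (hz₁ : 0 < z₁) (hz : z₁ < z₂)
    (h₁ : p ^ x₁ + b ^ y₁ = c ^ z₁) (h₂ : p ^ x₂ + b ^ y₂ = c ^ z₂) :
    y₁ * z₂ ≠ y₂ * z₁ := by
  intro heq
  obtain ⟨g, m, n, hg, hmn, rfl, rfl⟩ := Nat.exists_coprime' (m := z₁) (n := z₂)
    (Nat.gcd_pos_of_pos_left _ hz₁)
  have hm : 0 < m := Nat.pos_of_mul_pos_right hz₁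
  have hmn' : m < n := lt_of_mul_lt_mul_right hz (Nat.zero_le _)
  have heq' : y₁ * n = y₂ * m := by
    have : (y₁ * n) * g = (y₂ * m) * g := by linarith
    exact Nat.eq_of_mul_eq_mul_right hg this
  obtain ⟨h, rfl⟩ : m ∣ y₁ := hmn.dvd_of_dvd_mul_right (Dvd.intro_left _ heq'.symm)
  have hy2 : y₂ = h * n := by
    have : (h * n) * m = y₂ * m := by linarith
    exact (Nat.eq_of_mul_eq_mul_right hm this).symm
  subst hy2
  have hh : 0 < h := Nat.pos_of_mul_pos_left hy₁
  obtain ⟨C, hC⟩ : ∃ C : ℤ, C = (c : ℤ) ^ g := ⟨_, rfl⟩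
  obtain ⟨B, hB⟩ : ∃ B : ℤ, B = (b : ℤ) ^ h := ⟨_, rfl⟩
  have e1 : C ^ m - B ^ m = (p : ℤ) ^ x₁ := by
    have : (p : ℤ) ^ x₁ + (b : ℤ) ^ (m * h) = (c : ℤ) ^ (m * g) := by exact_mod_cast h₁
    rw [hC, hB, ← pow_mul, ← pow_mul, mul_comm g, mul_comm h]; linarith
  have e2 : C ^ n - B ^ n = (p : ℤ) ^ x₂ := by
    have : (p : ℤ) ^ x₂ + (b : ℤ) ^ (h * n) = (c : ℤ) ^ (n * g) := by exact_mod_cast h₂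
    rw [hC, hB, ← pow_mul, ← pow_mul, mul_comm g]; linarith
  have hB1 : 1 ≤ B := by rw [hB]; exact one_le_pow₀ (by exact_mod_cast (by omega : 1 ≤ b))
  have hC0 : 0 ≤ C := by rw [hC]; positivity
  have hp1 : (1 : ℤ) < p := by exact_mod_cast hp.one_lt
  have hBC : B < C := by
    have : B ^ m < C ^ m := by
      have : (0 : ℤ) < (p : ℤ) ^ x₁ := by positivity
      linarith
    exact lt_of_pow_lt_pow_left₀ m hC0 this
  have hle : (p : ℤ) ^ x₁ ≤ (p : ℤ) ^ x₂ := by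
    rw [← e1, ← e2]
    obtain ⟨d, rfl⟩ := Nat.exists_eq_add_of_le hmn'.le
    have h3 : B ^ d ≤ C ^ d := pow_le_pow_left₀ (by linarith) hBC.le d
    have h4 : B ^ m ≤ C ^ m := pow_le_pow_left₀ (by linarith) hBC.le m
    have h5 : 1 ≤ B ^ d := one_le_pow₀ hB1
    have h6 : 1 ≤ B ^ m := one_le_pow₀ hB1
    rw [pow_add, pow_add]
    nlinarith
  have hx : x₁ ≤ x₂ := (pow_le_pow_iff_right₀ hp1).1 hle
  have hcopB : IsCoprime ((p : ℤ) ^ x₁) B := by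
    rw [hB]
    exact (Nat.isCoprime_iff_coprime.2 ((Nat.Prime.coprime_iff_not_dvd hp).2 hpb)).pow
  have hdvd : (p : ℤ) ^ x₁ ∣ C - B :=
    dvd_sub_of_dvd_pow_sub_pow_of_coprime hcopB hmn (by rw [e1])
      (by rw [e2]; exact pow_dvd_pow _ hx)
  have hPle := Int.le_of_dvd (by linarith) hdvd
  have hm1 : m = 1 := by
    by_contra hne
    have := mul_sub_lt_pow_sub_pow hB1 hBC (n := m) (by omega)
    have h7 : (1 : ℤ) ≤ m := by exact_mod_cast hm
    nlinarith
  subst hm1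
  rw [pow_one, pow_one] at e1
  have hpC : ¬ (p : ℤ) ∣ C := by
    intro h8
    have h9 : (p : ℤ) ∣ C - B := by rw [e1]; exact dvd_pow_self _ hx₁.ne'
    have h10 : (p : ℤ) ∣ B := by simpa using dvd_sub h8 h9
    rw [hB] at h10
    exact hpb (by exact_mod_cast (Nat.prime_iff_prime_int.1 hp).dvd_of_dvd_pow h10)
  have hlte := Int.emultiplicity_pow_sub_pow hp hodd (x := C) (y := B)
    (by rw [e1]; exact dvd_pow_self _ hx₁.ne') hpC n
  have hpi := Nat.prime_iff_prime_int.1 hp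
  rw [e2, e1, emultiplicity_pow_self hpi.ne_zero hpi.not_isUnit,
    emultiplicity_pow_self hpi.ne_zero hpi.not_isUnit] at hlte
  obtain ⟨d, rfl⟩ := Nat.exists_eq_add_of_le hx
  have hdn : p ^ d ∣ n := by
    rw [pow_dvd_iff_le_emultiplicity]
    rw [Nat.cast_add] at hlte
    exact (ENat.add_right_injective_of_ne_top (ENat.natCast_ne_top x₁) hlte).le
  have h11 : (p : ℤ) ^ d ≤ n := by exact_mod_cast Nat.le_of_dvd (by omega) hdn
  have h12 := mul_sub_lt_pow_sub_pow hB1 hBC (n := n) (by omega)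
  rw [e1, e2, pow_add] at h12
  have h13 : (0 : ℤ) < (p : ℤ) ^ x₁ := by positivity
  nlinarith

theorem pow_min_le_of_coprime {p e k b c x₁ y₁ z₁ x₂ y₂ z₂ m K : ℕ} (hp : p.Prime)
    (hp2 : p ≠ 2) (hpk : (p : ℤ) ∣ (b : ℤ) ^ k - 1) (he : ¬ (p : ℤ) ^ (e + 1) ∣ (b : ℤ) ^ k - 1)
    (hpe : p ^ e ≤ 25) (hcop : Nat.Coprime p b) (h₁ : p ^ x₁ + b ^ y₁ = c ^ z₁)
    (h₂ : p ^ x₂ + b ^ y₂ = c ^ z₂) (hne : y₁ * z₂ ≠ y₂ * z₁) (hm₁ : m ≤ x₁) (hm₂ : m ≤ x₂)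
    (hK₁ : y₁ * z₂ ≤ K) (hK₂ : y₂ * z₁ ≤ K) : p ^ m ≤ 25 * K := by
  have d1 : ((p : ℤ) ^ m) ∣ (c : ℤ) ^ (z₁ * z₂) - (b : ℤ) ^ (y₁ * z₂) := by
    rw [pow_mul, pow_mul]
    refine dvd_trans ?_ (sub_dvd_pow_sub_pow _ _ z₂)
    have : (p : ℤ) ^ x₁ + (b : ℤ) ^ y₁ = (c : ℤ) ^ z₁ := by exact_mod_cast h₁
    rw [← this, add_sub_cancel_right]
    exact pow_dvd_pow _ hm₁
  have d2 : ((p : ℤ) ^ m) ∣ (c : ℤ) ^ (z₁ * z₂) - (b : ℤ) ^ (y₂ * z₁) := by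
    rw [mul_comm z₁, pow_mul, pow_mul]
    refine dvd_trans ?_ (sub_dvd_pow_sub_pow _ _ z₁)
    have : (p : ℤ) ^ x₂ + (b : ℤ) ^ y₂ = (c : ℤ) ^ z₂ := by exact_mod_cast h₂
    rw [← this, add_sub_cancel_right]
    exact pow_dvd_pow _ hm₂
  have key : ∀ u v : ℕ, u < v → v ≤ K → ((p : ℤ) ^ m) ∣ (b : ℤ) ^ v - (b : ℤ) ^ u →
      p ^ m ≤ 25 * K := by
    intro u v huv hv hd
    have e1 : (b : ℤ) ^ v - (b : ℤ) ^ u = (b : ℤ) ^ u * ((b : ℤ) ^ (v - u) - 1) := by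
      rw [mul_sub, ← pow_add, Nat.add_sub_cancel' huv.le, mul_one]
    rw [e1] at hd
    have h3 := (Nat.isCoprime_iff_coprime.2 hcop).pow (m := m) (n := u) |>.dvd_of_dvd_mul_left hd
    have h4 := pow_dvd_mul_of_pow_dvd_pow_sub_one hp hpk (fun h => absurd h hp2) he h3
    calc p ^ m ≤ p ^ e * (v - u) := Nat.le_of_dvd (Nat.mul_pos (pow_pos hp.pos e) (by omega)) h4
      _ ≤ 25 * K := Nat.mul_le_mul hpe (by omega)
  rcases lt_or_gt_of_ne hne with h | h
  · exact key _ _ h hK₂ (by simpa using dvd_sub d1 d2)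
  · exact key _ _ h hK₁ (by simpa using dvd_sub d2 d1)

theorem pow_min_le {a b c x₁ y₁ z₁ x₂ y₂ z₂ m K : ℕ}
    (hab : (a, b) ∈ [(3, 5), (3, 7), (5, 7), (5, 3), (7, 3), (7, 5)])
    (hx₁ : 0 < x₁) (hy₁ : 0 < y₁) (hz₁ : 0 < z₁) (hz : z₁ < z₂)
    (h₁ : a ^ x₁ + b ^ y₁ = c ^ z₁) (h₂ : a ^ x₂ + b ^ y₂ = c ^ z₂)
    (hm₁ : m ≤ x₁) (hm₂ : m ≤ x₂)
    (hK₁ : y₁ * z₂ ≤ K) (hK₂ : y₂ * z₁ ≤ K) : a ^ m ≤ 25 * K := by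
  simp only [List.mem_cons, Prod.mk.injEq, List.not_mem_nil, or_false] at hab
  rcases hab with ⟨rfl, rfl⟩ | ⟨rfl, rfl⟩ | ⟨rfl, rfl⟩ | ⟨rfl, rfl⟩ | ⟨rfl, rfl⟩ | ⟨rfl, rfl⟩
  · exact pow_min_le_of_coprime (e := 1) (k := 2) Nat.prime_three (by norm_num) (by norm_num)
      (by norm_num) (by norm_num) (by norm_num) h₁ h₂ (exponent_ratio_ne Nat.prime_three
        (by decide) (by norm_num) (by norm_num) hx₁ hy₁ hz₁ hz h₁ h₂) hm₁ hm₂ hK₁ hK₂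
  · exact pow_min_le_of_coprime (e := 1) (k := 2) Nat.prime_three (by norm_num) (by norm_num)
      (by norm_num) (by norm_num) (by norm_num) h₁ h₂ (exponent_ratio_ne Nat.prime_three
        (by decide) (by norm_num) (by norm_num) hx₁ hy₁ hz₁ hz h₁ h₂) hm₁ hm₂ hK₁ hK₂
  · exact pow_min_le_of_coprime (e := 2) (k := 4) Nat.prime_five (by norm_num) (by norm_num)
      (by norm_num) (by norm_num) (by norm_num) h₁ h₂ (exponent_ratio_ne Nat.prime_five
        (by decide) (by norm_num) (by norm_num) hx₁ hy₁ hz₁ hz h₁ h₂) hm₁ hm₂ hK₁ hK₂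
  · exact pow_min_le_of_coprime (e := 1) (k := 4) Nat.prime_five (by norm_num) (by norm_num)
      (by norm_num) (by norm_num) (by norm_num) h₁ h₂ (exponent_ratio_ne Nat.prime_five
        (by decide) (by norm_num) (by norm_num) hx₁ hy₁ hz₁ hz h₁ h₂) hm₁ hm₂ hK₁ hK₂
  · exact pow_min_le_of_coprime (e := 1) (k := 6) Nat.prime_seven (by norm_num) (by norm_num)
      (by norm_num) (by norm_num) (by norm_num) h₁ h₂ (exponent_ratio_ne Nat.prime_seven
        (by decide) (by norm_num) (by norm_num) hx₁ hy₁ hz₁ hz h₁ h₂) hm₁ hm₂ hK₁ hK₂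
  · exact pow_min_le_of_coprime (e := 1) (k := 6) Nat.prime_seven (by norm_num) (by norm_num)
      (by norm_num) (by norm_num) (by norm_num) h₁ h₂ (exponent_ratio_ne Nat.prime_seven
        (by decide) (by norm_num) (by norm_num) hx₁ hy₁ hz₁ hz h₁ h₂) hm₁ hm₂ hK₁ hK₂

/-- If `b ^ y < c ^ z` and `c ^ z₁ < 2 ^ l`, then `y * z₁ < l * z`. -/
theorem mul_lt_mul_of_pow_lt {b c y z z₁ l : ℕ} (hb : 2 ≤ b) (hz : 0 < z) (hz₁ : 0 < z₁)
    (h : b ^ y < c ^ z) (hl : c ^ z₁ < 2 ^ l) : y * z₁ < l * z := by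
  have h1 : 2 ^ (y * z₁) < 2 ^ (l * z) := by
    calc 2 ^ (y * z₁) ≤ b ^ (y * z₁) := Nat.pow_le_pow_left hb _
      _ = (b ^ y) ^ z₁ := pow_mul _ _ _
      _ < (c ^ z) ^ z₁ := Nat.pow_lt_pow_left h hz₁.ne'
      _ = (c ^ z₁) ^ z := by rw [← pow_mul, ← pow_mul, mul_comm]
      _ < (2 ^ l) ^ z := Nat.pow_lt_pow_left hl hz.ne'
      _ = _ := (pow_mul _ _ _).symm
  exact (Nat.pow_lt_pow_iff_right (by norm_num)).1 h1

theorem log_add_le {A T : ℕ} (hA : 0 < A) :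
    Real.log A ≤ Real.log (A + T : ℕ) ∧ Real.log (A + T : ℕ) ≤ Real.log A + T / A := by
  have hA' : (0 : ℝ) < A := by exact_mod_cast hA
  refine ⟨Real.log_le_log hA' (by exact_mod_cast Nat.le_add_right _ _), ?_⟩
  have h1 : (0 : ℝ) < (A + T : ℕ) := by exact_mod_cast Nat.add_pos_left hA T
  have h2 := Real.log_le_sub_one_of_pos (div_pos h1 hA')
  rw [Real.log_div h1.ne' hA'.ne', div_sub_one hA'.ne'] at h2
  push_cast at h2 ⊢
  rw [add_sub_cancel_left] at h2
  linarith

theorem two_pow_size_le_aux {a b c x₁ y₁ z₁ x₂ y₂ z₂ l E : ℕ} (ha : 2 ≤ a) (hb : 2 ≤ b)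
    (hab : (a, b) ∈ [(3, 5), (3, 7), (5, 7), (5, 3), (7, 3), (7, 5)])
    (hx₁ : 0 < x₁) (hy₁ : 0 < y₁) (hz₁ : 0 < z₁) (hx₂ : 0 < x₂) (hz : z₁ < z₂)
    (h₁ : a ^ x₁ + b ^ y₁ = c ^ z₁) (h₂ : a ^ x₂ + b ^ y₂ = c ^ z₂)
    (hl : c ^ z₁ < 2 ^ l) (hl' : 2 ^ l ≤ 2 * c ^ z₁)
    (hE : ∀ X Y : ℕ, 0 < X → 0 < Y → X ≤ l * z₂ → Y ≤ l * z₂ →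
      1 / 2 ^ E ≤ |X * Real.log a - Y * Real.log b|)
    (hx : x₁ ≤ x₂) : 2 ^ l ≤ 100 * (l * z₂) * z₂ * 2 ^ E := by
  have hba : (b, a) ∈ [(3, 5), (3, 7), (5, 7), (5, 3), (7, 3), (7, 5)] := by
    simp only [List.mem_cons, Prod.mk.injEq, List.not_mem_nil, or_false] at hab ⊢
    omega
  have hz₂ : 0 < z₂ := by omega
  obtain ⟨K, hK⟩ : ∃ K, K = l * z₂ := ⟨_, rfl⟩
  have ha0 : ∀ x, 0 < a ^ x := fun x => by positivity
  have hb0 : ∀ x, 0 < b ^ x := fun x => by positivity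
  have k1 := mul_lt_mul_of_pow_lt ha hz₂ hz₁ (y := x₂) (c := c) (by have := hb0 y₂; omega) hl
  have k2 := mul_lt_mul_of_pow_lt hb hz₂ hz₁ (y := y₂) (c := c) (by have := ha0 x₂; omega) hl
  have k3 : x₁ * z₂ < l * z₂ := by
    have := mul_lt_mul_of_pow_lt ha hz₁ hz₁ (y := x₁) (c := c) (by have := hb0 y₁; omega) hl
    exact Nat.mul_lt_mul_of_pos_right (Nat.lt_of_mul_lt_mul_right this) hz₂
  have k4 : y₁ * z₂ < l * z₂ := by
    have := mul_lt_mul_of_pow_lt hb hz₁ hz₁ (y := y₁) (c := c) (by have := ha0 x₁; omega) hl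
    exact Nat.mul_lt_mul_of_pos_right (Nat.lt_of_mul_lt_mul_right this) hz₂
  rw [← hK] at k1 k2 k3 k4 hE ⊢
  have hE1 := Nat.one_le_two_pow (n := E)
  have hT := pow_min_le hab hx₁ hy₁ hz₁ hz h₁ h₂ le_rfl hx k4.le k2.le
  have hle : 100 * K ≤ 100 * K * z₂ * 2 ^ E := by
    rw [mul_assoc]; exact Nat.le_mul_of_pos_right _ (by positivity)
  rcases le_total y₁ y₂ with hy | hy
  · have hS := pow_min_le hba hy₁ hx₁ hz₁ hz (by rw [add_comm]; exact h₁)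
      (by rw [add_comm]; exact h₂) le_rfl hy k3.le k1.le
    omega
  · have hS := pow_min_le hba hy₁ hx₁ hz₁ hz (by rw [add_comm]; exact h₁)
      (by rw [add_comm]; exact h₂) hy le_rfl k3.le k1.le
    by_contra! hlt
    have hc0 : 0 < c := by
      rcases Nat.eq_zero_or_pos c with h | h
      · rw [h, zero_pow hz₁.ne'] at h₁
        have := ha0 x₁; omega
      · exact h
    have hN : c ^ z₁ ≤ c ^ z₂ := Nat.pow_le_pow_right hc0 hz.le
    have hB : 2 ^ l ≤ 4 * b ^ y₁ := by omega
    have hA : 2 ^ l ≤ 4 * a ^ x₂ := by omega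
    have hΛ := hE (x₂ * z₁) (y₁ * z₂) (by positivity) (by positivity) k1.le k4.le
    have L1 := log_add_le (T := a ^ x₁) (hb0 y₁)
    have L2 := log_add_le (T := b ^ y₂) (ha0 x₂)
    rw [add_comm (b ^ y₁), h₁] at L1
    rw [h₂] at L2
    have hlog : (z₂ : ℝ) * Real.log (c ^ z₁ : ℕ) = z₁ * Real.log (c ^ z₂ : ℕ) := by
      push_cast
      rw [Real.log_pow, Real.log_pow]; ring
    have hbd : ∀ A T : ℕ, 2 ^ l ≤ 4 * A → T ≤ 25 * K → (T : ℝ) / A ≤ 100 * K / 2 ^ l := by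
      intro A T hA hT
      have hA0 : 0 < A := by have := Nat.one_le_two_pow (n := l); omega
      have hA0' : (0 : ℝ) < A := by exact_mod_cast hA0
      rw [div_le_div_iff₀ hA0' (by positivity)]
      have : T * 2 ^ l ≤ 100 * K * A := by
        calc T * 2 ^ l ≤ (25 * K) * (4 * A) := Nat.mul_le_mul hT hA
          _ = _ := by ring
      exact_mod_cast this
    have b1 := hbd _ _ hB hT
    have b2 := hbd _ _ hA hS
    push_cast at L1 L2 b1 b2 hlog hΛ
    rw [Real.log_pow] at L1 L2
    have hz1' : (0 : ℝ) ≤ z₁ := Nat.cast_nonneg _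
    have hz2' : (0 : ℝ) ≤ z₂ := Nat.cast_nonneg _
    have hzz : (z₁ : ℝ) ≤ z₂ := by exact_mod_cast hz.le
    have hq : (0 : ℝ) ≤ 100 * K / 2 ^ l := by positivity
    have hup : |x₂ * z₁ * Real.log a - y₁ * z₂ * Real.log b| ≤ z₂ * (100 * K / 2 ^ l) := by
      rw [abs_le]
      constructor
      · nlinarith [mul_le_mul_of_nonneg_left L1.1 hz2', mul_le_mul_of_nonneg_left
          (L2.2.trans (add_le_add_right b2 _)) hz1', mul_le_mul_of_nonneg_right hzz hq]
      · nlinarith [mul_le_mul_of_nonneg_left L2.1 hz1', mul_le_mul_of_nonneg_left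
          (L1.2.trans (add_le_add_right b1 _)) hz2']
    have h3 := hΛ.trans hup
    rw [mul_div_assoc', div_le_div_iff₀ (by positivity) (by positivity), one_mul] at h3
    have h4 : 2 ^ l ≤ z₂ * (100 * K) * 2 ^ E := by exact_mod_cast h3
    rw [mul_comm z₂] at h4
    omega

/-- The size of `c ^ z₁` is controlled by lower bounds for linear forms in logarithms. -/
theorem two_pow_size_le {a b c x₁ y₁ z₁ x₂ y₂ z₂ l E : ℕ}
    (hab : (a, b) ∈ [(3, 5), (3, 7), (5, 7)])
    (hx₁ : 0 < x₁) (hy₁ : 0 < y₁) (hz₁ : 0 < z₁) (hx₂ : 0 < x₂) (hy₂ : 0 < y₂) (hz : z₁ < z₂)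
    (hc : 1 < c) (h₁ : a ^ x₁ + b ^ y₁ = c ^ z₁) (h₂ : a ^ x₂ + b ^ y₂ = c ^ z₂)
    (hl : c ^ z₁ < 2 ^ l) (hl' : 2 ^ l ≤ 2 * c ^ z₁)
    (hE : ∀ X Y : ℕ, 0 < X → 0 < Y → X ≤ l * z₂ → Y ≤ l * z₂ →
      1 / 2 ^ E ≤ |X * Real.log a - Y * Real.log b|) : 2 ^ l ≤ 100 * (l * z₂) * z₂ * 2 ^ E := by
  have h2 : 2 ≤ a ∧ 2 ≤ b := by
    simp only [List.mem_cons, Prod.mk.injEq, List.not_mem_nil, or_false] at hab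
    omega
  rcases le_total x₁ x₂ with hx | hx
  · refine two_pow_size_le_aux h2.1 h2.2 ?_ hx₁ hy₁ hz₁ hx₂ hz h₁ h₂ hl hl' hE hx
    simp only [List.mem_cons, Prod.mk.injEq, List.not_mem_nil, or_false] at hab ⊢
    omega
  · have hy : y₁ ≤ y₂ := by
      by_contra! hlt
      have e1 : a ^ x₂ ≤ a ^ x₁ := Nat.pow_le_pow_right (by omega) hx
      have e2 : b ^ y₂ ≤ b ^ y₁ := Nat.pow_le_pow_right (by omega) hlt.le
      have e3 : c ^ z₁ < c ^ z₂ := Nat.pow_lt_pow_right hc hz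
      omega
    refine two_pow_size_le_aux h2.2 h2.1 ?_ hy₁ hx₁ hz₁ hy₂ hz (by rw [add_comm]; exact h₁)
      (by rw [add_comm]; exact h₂) hl hl' (fun X Y hX hY hXK hYK => ?_) hy
    · simp only [List.mem_cons, Prod.mk.injEq, List.not_mem_nil, or_false] at hab ⊢
      omega
    · rw [abs_sub_comm]
      exact hE Y X hY hX hYK hXK

theorem two_pow_le_of_mul_pow_modEq {A B p q X Y M K : ℕ} (hA : 8 ∣ (A : ℤ) - 1)
    (hA' : ¬ 16 ∣ (A : ℤ) - 1) (hpq : A ^ p * B ^ q ≡ 1 [MOD 2 ^ M]) (hp : 0 < p)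
    (hY : 0 < Y) (hXK : X ≤ K) (hYK : Y ≤ K)
    (h : (2 : ℤ) ^ M ∣ (A : ℤ) ^ X - (B : ℤ) ^ Y) : 2 ^ M ≤ 8 * (K * (p + q)) := by
  have h1 : (2 : ℤ) ^ M ∣ (A : ℤ) ^ (X * q) - (B : ℤ) ^ (Y * q) := by
    rw [pow_mul, pow_mul]
    exact h.trans (sub_dvd_pow_sub_pow _ _ q)
  have h2 : (2 : ℤ) ^ M ∣ ((A : ℤ) ^ p * (B : ℤ) ^ q) ^ Y - 1 := by
    have h3 : (2 : ℤ) ^ M ∣ (A : ℤ) ^ p * (B : ℤ) ^ q - 1 := by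
      have := Nat.modEq_iff_dvd.1 hpq.symm
      push_cast at this
      exact this
    refine h3.trans ?_
    simpa using sub_dvd_pow_sub_pow ((A : ℤ) ^ p * (B : ℤ) ^ q) 1 Y
  have h3 : (2 : ℤ) ^ M ∣ (A : ℤ) ^ (X * q + p * Y) - 1 := by
    have e : (A : ℤ) ^ (X * q + p * Y) - 1 = ((A : ℤ) ^ (X * q) - (B : ℤ) ^ (Y * q)) *
        (A : ℤ) ^ (p * Y) + (((A : ℤ) ^ p * (B : ℤ) ^ q) ^ Y - 1) := by
      rw [mul_pow, ← pow_mul, ← pow_mul, pow_add]; ring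
    rw [e]
    exact dvd_add (h1.mul_right _) h2
  have h4 := pow_dvd_mul_of_pow_dvd_pow_sub_one (p := 2) (e := 3) (k := 1) (b := A) Nat.prime_two
    (by rw [pow_one]; exact (by norm_num : ((2 : ℕ) : ℤ) ∣ 8).trans hA)
    (fun _ => by rw [pow_one]; exact (by norm_num : (4 : ℤ) ∣ 8).trans hA)
    (by rw [pow_one]; norm_num; exact hA') (by exact_mod_cast h3)
  refine (Nat.le_of_dvd (by positivity) h4).trans ?_
  have : X * q + p * Y ≤ K * (p + q) := by nlinarith
  omega

theorem lt_of_two_pow_dvd_sq_pow_sub {a b X Y z K M p q : ℕ} (h8 : 8 ∣ ((a ^ 2 : ℕ) : ℤ) - 1)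
    (h16 : ¬ 16 ∣ ((a ^ 2 : ℕ) : ℤ) - 1) (hp : 0 < p) (hM : 8 * (K * (p + q)) < 2 ^ M)
    (hpq : ((a ^ 2 : ℕ) : ZMod (2 ^ M)) ^ p * ((b ^ 2 : ℕ) : ZMod (2 ^ M)) ^ q = 1)
    (hY : 0 < Y) (hXK : X ≤ K) (hYK : Y ≤ K)
    (h : (2 : ℤ) ^ z ∣ ((a : ℤ) ^ 2) ^ X - ((b : ℤ) ^ 2) ^ Y) : z < M := by
  by_contra! hz
  have h1 := two_pow_le_of_mul_pow_modEq (K := K) (X := X) (Y := Y) (B := b ^ 2) h8 h16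
    ((ZMod.natCast_eq_natCast_iff _ _ _).1 (by exact_mod_cast hpq)) hp hY hXK hYK
    (by push_cast; exact (pow_dvd_pow _ hz).trans h)
  omega

/-- Bounds for the `2`-adic valuation of `a ^ (2 * X) - b ^ (2 * Y)`. -/
theorem two_pow_exponent_lt {a b X Y z K : ℕ} (hab : (a, b) ∈ [(3, 5), (3, 7), (5, 7)])
    (hY : 0 < Y) (hXK : X ≤ K) (hYK : Y ≤ K)
    (h : (2 : ℤ) ^ z ∣ ((a : ℤ) ^ 2) ^ X - ((b : ℤ) ^ 2) ^ Y) :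
    (K ≤ 2 ^ 54 → z < 113) ∧ (K ≤ 9408 → z < 33) ∧ (K ≤ 1216 → z < 26) := by
  simp only [List.mem_cons, Prod.mk.injEq, List.not_mem_nil, or_false] at hab
  rcases hab with ⟨rfl, rfl⟩ | ⟨rfl, rfl⟩ | ⟨rfl, rfl⟩
  · refine ⟨fun hK => ?_, fun hK => ?_, fun hK => ?_⟩
    · refine (lt_of_two_pow_dvd_sq_pow_sub (K := K) (M := 111) (p := 8875468705372325)
        (q := 3616860632207601) (by norm_num) (by norm_num) (by norm_num) (by omega) ?_ hY hXK hYK h).trans_le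
          (by norm_num)
      norm_num1
      reduce_mod_char
    · refine (lt_of_two_pow_dvd_sq_pow_sub (K := K) (M := 32) (p := 2353)
        (q := 24525) (by norm_num) (by norm_num) (by norm_num) (by omega) ?_ hY hXK hYK h).trans_le
          (by norm_num)
      norm_num1
      reduce_mod_char
    · refine (lt_of_two_pow_dvd_sq_pow_sub (K := K) (M := 24) (p := 805)
        (q := 369) (by norm_num) (by norm_num) (by norm_num) (by omega) ?_ hY hXK hYK h).trans_le
          (by norm_num)
      norm_num1
      reduce_mod_char
  · refine ⟨fun hK => ?_, fun hK => ?_, fun hK => ?_⟩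
    · refine (lt_of_two_pow_dvd_sq_pow_sub (K := K) (M := 111) (p := 13758797856782434)
        (q := 1875187745419081) (by norm_num) (by norm_num) (by norm_num) (by omega) ?_ hY hXK hYK h).trans_le
          (by norm_num)
      norm_num1
      reduce_mod_char
    · refine (lt_of_two_pow_dvd_sq_pow_sub (K := K) (M := 33) (p := 60982)
        (q := 8483) (by norm_num) (by norm_num) (by norm_num) (by omega) ?_ hY hXK hYK h).trans_le
          (by norm_num)
      norm_num1
      reduce_mod_char
    · refine (lt_of_two_pow_dvd_sq_pow_sub (K := K) (M := 25) (p := 1742)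
        (q := 655) (by norm_num) (by norm_num) (by norm_num) (by omega) ?_ hY hXK hYK h).trans_le
          (by norm_num)
      norm_num1
      reduce_mod_char
  · refine ⟨fun hK => ?_, fun hK => ?_, fun hK => ?_⟩
    · refine (lt_of_two_pow_dvd_sq_pow_sub (K := K) (M := 113) (p := 13334729019525366)
        (q := 31942837888258465) (by norm_num) (by norm_num) (by norm_num) (by omega) ?_ hY hXK hYK h).trans_le
          (by norm_num)
      norm_num1
      reduce_mod_char
    · refine (lt_of_two_pow_dvd_sq_pow_sub (K := K) (M := 31) (p := 15018)
        (q := 10447) (by norm_num) (by norm_num) (by norm_num) (by omega) ?_ hY hXK hYK h).trans_le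
          (by norm_num)
      norm_num1
      reduce_mod_char
    · refine (lt_of_two_pow_dvd_sq_pow_sub (K := K) (M := 26) (p := 3546)
        (q := 791) (by norm_num) (by norm_num) (by norm_num) (by omega) ?_ hY hXK hYK h).trans_le
          (by norm_num)
      norm_num1
      reduce_mod_char

theorem two_pow_gt_of_fifty_six_le {s : ℕ} (hs : 56 ≤ s) :
    2 * (7 + 2 * s + 3326 * (6 * s + 40) ^ 2) * (432 * (4 * s + 22) ^ 2) < 2 ^ (s - 1) := by
  induction s, hs using Nat.le_induction with
  | base => norm_num
  | succ s hs ih =>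
    obtain ⟨t, rfl⟩ := Nat.exists_eq_add_of_le hs
    rw [show 56 + t + 1 - 1 = (56 + t - 1) + 1 by omega, pow_succ 2]
    generalize 2 ^ (56 + t - 1) = P at ih ⊢
    refine lt_of_le_of_lt ?_ (show _ < _ from Nat.mul_lt_mul_of_pos_right ih (by norm_num : 0 < 2))
    ring_nf
    nlinarith

theorem lt_of_two_pow_le {l m C : ℕ} (h : 2 ^ l ≤ C * l) (hC : C * m < 2 ^ m) (hC' : C < 2 ^ m) :
    l < m := by
  by_contra! hlm
  induction l, hlm using Nat.le_induction with
  | base => omega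
  | succ k hk ih =>
    apply ih
    have : 2 ^ m ≤ 2 ^ k := Nat.pow_le_pow_right (by norm_num) hk
    rw [pow_succ] at h
    have e : C * (k + 1) = C * k + C := by ring
    by_contra! hlt
    omega

theorem even_of_pow_add_pow_eq {a b c x y z : ℕ} (ha : Odd a) (hb : Odd b) (hz : 0 < z)
    (h : a ^ x + b ^ y = c ^ z) : Even c := by
  have h1 : Even (a ^ x + b ^ y) := (ha.pow).add_odd hb.pow
  rw [h, Nat.even_pow' hz.ne'] at h1
  exact h1

theorem odd_or_odd_of_pow_add_pow_eq {a b c x y z : ℕ} (ha : Odd a) (hb : Odd b) (hc : Even c)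
    (hz : 2 ≤ z) (h : a ^ x + b ^ y = c ^ z) : Odd x ∨ Odd y := by
  by_contra! hxy
  rw [Nat.not_odd_iff_even, Nat.not_odd_iff_even] at hxy
  obtain ⟨⟨u, rfl⟩, ⟨v, rfl⟩⟩ := hxy
  have h4 : 2 ^ 2 ∣ c ^ z := (pow_dvd_pow_of_dvd hc.two_dvd 2).trans (pow_dvd_pow c hz)
  rw [← h, ← two_mul, ← two_mul, mul_comm 2, mul_comm 2, pow_mul, pow_mul] at h4
  have e : ∀ t : ℕ, Odd t → t ^ 2 % 4 = 1 := by
    rintro t ⟨k, rfl⟩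
    have : (2 * k + 1) ^ 2 = 4 * (k ^ 2 + k) + 1 := by ring
    omega
  have e1 := e _ (ha.pow (n := u))
  have e2 := e _ (hb.pow (n := v))
  omega

theorem two_pow_size_bounds {a b c x₁ y₁ z₁ x₂ y₂ z₂ : ℕ}
    (hab : (a, b) ∈ [(3, 5), (3, 7), (5, 7)])
    (hx₁ : 0 < x₁) (hy₁ : 0 < y₁) (hz₁ : 0 < z₁) (hx₂ : 0 < x₂) (hy₂ : 0 < y₂) (hz : z₁ < z₂)
    (hc : 1 < c) (h₁ : a ^ x₁ + b ^ y₁ = c ^ z₁) (h₂ : a ^ x₂ + b ^ y₂ = c ^ z₂) :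
    c ^ z₁ < 2 ^ 32 ∧ z₂ < 26 ∧ ¬ 2 ^ 26 ∣ c ^ z₂ := by
  have hab' : (a, b) ∈ smallPairs ∧ Odd a ∧ Odd b ∧ 2 ≤ a ∧ a ≤ 10 ∧ 2 ≤ b ∧ b ≤ 10 ∧
      Nat.Coprime a b ∧ (8 : ℤ) ∣ (a ^ 2 : ℕ) - 1 ∧ (8 : ℤ) ∣ (b ^ 2 : ℕ) - 1 ∧
      (a ^ 2) ^ 13 * (b ^ 2) ^ 12 ≤ 2 ^ 130 := by
    simp only [List.mem_cons, Prod.mk.injEq, List.not_mem_nil, or_false] at hab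
    rcases hab with ⟨rfl, rfl⟩ | ⟨rfl, rfl⟩ | ⟨rfl, rfl⟩ <;> simp [smallPairs] <;> decide
  obtain ⟨hsp, hao, hbo, ha2, ha10, hb2, hb10, hcop, ha8, hb8, hab13⟩ := hab'
  have hz₂ : 2 ≤ z₂ := by omega
  have hce := even_of_pow_add_pow_eq hao hbo hz₁ h₁
  have hodd := odd_or_odd_of_pow_add_pow_eq hao hbo hce hz₂ h₂
  obtain ⟨l, hl⟩ : ∃ l, l = Nat.log 2 (c ^ z₁) + 1 := ⟨_, rfl⟩
  have hc0 : c ^ z₁ ≠ 0 := by positivity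
  have hl1 : c ^ z₁ < 2 ^ l := by rw [hl]; exact Nat.lt_pow_succ_log_self (by norm_num) _
  have hl2 : 2 ^ l ≤ 2 * c ^ z₁ := by
    rw [hl, pow_succ, mul_comm]
    exact Nat.mul_le_mul_left 2 (Nat.pow_log_le_self 2 hc0)
  have hx2 : x₂ < l * z₂ := by
    have := mul_lt_mul_of_pow_lt ha2 (show 0 < z₂ by omega) hz₁ (y := x₂) (c := c)
      (by have : 0 < b ^ y₂ := by positivity
          omega) hl1
    exact lt_of_le_of_lt (Nat.le_mul_of_pos_right _ hz₁) this
  have hy2 : y₂ < l * z₂ := by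
    have := mul_lt_mul_of_pow_lt hb2 (show 0 < z₂ by omega) hz₁ (y := y₂) (c := c)
      (by have : 0 < a ^ x₂ := by positivity
          omega) hl1
    exact lt_of_le_of_lt (Nat.le_mul_of_pos_right _ hz₁) this
  have hdvd' : ∀ z, 2 ^ z ∣ c ^ z₂ → (2 : ℤ) ^ z ∣ ((a : ℤ) ^ 2) ^ x₂ - ((b : ℤ) ^ 2) ^ y₂ := by
    intro z hzd
    have e1 : (2 : ℤ) ^ z ∣ (a : ℤ) ^ x₂ + (b : ℤ) ^ y₂ := by
      rw [← h₂] at hzd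
      exact_mod_cast hzd
    have e2 : ((a : ℤ) ^ 2) ^ x₂ - ((b : ℤ) ^ 2) ^ y₂ =
        ((a : ℤ) ^ x₂ + (b : ℤ) ^ y₂) * ((a : ℤ) ^ x₂ - (b : ℤ) ^ y₂) := by ring
    rw [e2]
    exact e1.mul_right _
  have hdvd := hdvd' z₂ (pow_dvd_pow_of_dvd hce.two_dvd _)
  have h2adic := two_pow_exponent_lt hab hy₂ hx2.le hy2.le hdvd
  have hsize : ∀ E : ℕ, (∀ X Y : ℕ, 0 < X → 0 < Y → X ≤ l * z₂ → Y ≤ l * z₂ →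
      1 / 2 ^ E ≤ |X * Real.log a - Y * Real.log b|) → 2 ^ l ≤ 100 * (l * z₂) * z₂ * 2 ^ E :=
    fun E hE => two_pow_size_le hab hx₁ hy₁ hz₁ hx₂ hy₂ hz hc h₁ h₂ hl1 hl2 hE
  have hK0 : l * z₂ ≤ 2 ^ 54 := by
    obtain ⟨s, hs⟩ : ∃ s, s = Nat.log 2 (2 * (l * z₂)) + 1 := ⟨_, rfl⟩
    have hs1 : 2 * (l * z₂) < 2 ^ s := by rw [hs]; exact Nat.lt_pow_succ_log_self (by norm_num) _
    have hs2 : 2 ^ (s - 1) ≤ 2 * (l * z₂) := by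
      rw [hs, Nat.add_sub_cancel]
      exact Nat.pow_log_le_self 2 (by omega)
    have hs0 : 1 ≤ s := by omega
    have hzle : z₂ ≤ 432 * (4 * s + 22) ^ 2 := by
      by_contra! hlt
      exact not_two_pow_dvd_pow_sub_pow (a := a ^ 2) (b := b ^ 2) (s := s) hs0
        (by exact_mod_cast ha8) (by exact_mod_cast hb8) (by nlinarith) (by nlinarith) hab13
        (hcop.pow 2 2) hx₂ hy₂ hodd (by omega)
        (by push_cast; exact (pow_dvd_pow _ hlt.le).trans hdvd)
    have hlle : l ≤ 7 + 2 * s + 3326 * (6 * s + 40) ^ 2 := by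
      have h3 := hsize _ (fun X Y hX hY hXK hYK => linear_form_lower_bound_two_pow (s := s) hs0
        ha2 ha10 hb2 hb10 hcop hX hY (by omega))
      generalize 3326 * (6 * s + 40) ^ 2 = E at h3 ⊢
      have hzl : z₂ ≤ l * z₂ := Nat.le_mul_of_pos_left _ (by omega)
      have h4 : 100 * (l * z₂) * z₂ * 2 ^ E ≤ 2 ^ 7 * 2 ^ s * 2 ^ s * 2 ^ E := by
        gcongr
        · norm_num
        · omega
        · omega
      rw [← pow_add, ← pow_add, ← pow_add] at h4
      have := (Nat.pow_le_pow_iff_right (a := 2) (by norm_num)).1 (h3.trans h4)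
      omega
    by_contra! hlt
    have hs56 : 56 ≤ s := by
      have h5 : 2 ^ 55 < 2 ^ s := by omega
      exact (Nat.pow_lt_pow_iff_right (by norm_num)).1 h5
    have h6 := two_pow_gt_of_fifty_six_le hs56
    have h7 := Nat.mul_le_mul hlle hzle
    rw [mul_assoc 2] at h6
    omega
  have hE0 := hsize 58 (fun X Y hX _ hXK _ => abs_linear_form_ge hsp hX (by omega))
  have hz0 := h2adic.1 hK0
  have hmul : ∀ Z E C : ℕ, z₂ ≤ Z → 2 ^ l ≤ 100 * (l * z₂) * z₂ * 2 ^ E →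
      100 * Z * Z * 2 ^ E ≤ C → 2 ^ l ≤ C * l := by
    intro Z E C hZ h hC
    calc 2 ^ l ≤ 100 * (l * z₂) * z₂ * 2 ^ E := h
      _ ≤ 100 * (l * Z) * Z * 2 ^ E := by gcongr
      _ = (100 * Z * Z * 2 ^ E) * l := by ring
      _ ≤ _ := Nat.mul_le_mul_right _ hC
  have hl84 := lt_of_two_pow_le (m := 85) (hmul 112 58 _ (by omega) hE0 le_rfl) (by norm_num)
    (by norm_num)
  have hK1 : l * z₂ ≤ 84 * 112 := Nat.mul_le_mul (by omega) (by omega)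
  have hE1 := hsize 17 (fun X Y hX _ hXK _ =>
    abs_linear_form_ge_of_le_two_pow_fourteen hab hX (by omega))
  have hz1 := h2adic.2.1 (by omega)
  have hl38 := lt_of_two_pow_le (m := 39) (hmul 32 17 _ (by omega) hE1 le_rfl) (by norm_num)
    (by norm_num)
  have hK2 : l * z₂ ≤ 38 * 32 := Nat.mul_le_mul (by omega) (by omega)
  have hz2 := h2adic.2.2 (by omega)
  have hK3 : l * z₂ ≤ 38 * 25 := Nat.mul_le_mul (by omega) (by omega)
  have hE2 := hsize 12 (fun X Y hX _ hXK _ =>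
    abs_linear_form_ge_of_le_two_pow_ten hab hX (by omega))
  have hl32 := lt_of_two_pow_le (m := 33) (hmul 25 12 _ (by omega) hE2 le_rfl) (by norm_num)
    (by norm_num)
  exact ⟨hl1.trans_le (Nat.pow_le_pow_right (by norm_num) (by omega)), hz2, fun h26 =>
    absurd ((two_pow_exponent_lt hab hy₂ hx2.le hy2.le (hdvd' 26 h26)).2.2 (by omega)) (by norm_num)⟩

/-- The largest `r < 2 ^ i` with `P r`, by bisection. -/
def bisect (P : ℕ → Bool) : ℕ → ℕ → ℕ
  | 0, r => r
  | i + 1, r => bif P (r + 2 ^ i) then bisect P i (r + 2 ^ i) else bisect P i r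

theorem bisect_eq {P : ℕ → Bool} {c : ℕ} (h₁ : ∀ t ≤ c, P t = true) (h₂ : ∀ t, c < t → P t = false)
    {i r : ℕ} (hr : r ≤ c) (hc : c < r + 2 ^ i) : bisect P i r = c := by
  induction i generalizing r with
  | zero => simp [bisect]; omega
  | succ i ih =>
    rw [bisect]
    rw [pow_succ] at hc
    rcases le_or_gt (r + 2 ^ i) c with h | h
    · rw [h₁ _ h, cond_true]
      exact ih h (by omega)
    · rw [h₂ _ h, cond_false]
      exact ih hr h

/-- A necessary condition for `V` to be the sum of a power of `a` and a smaller power of `b`. -/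
def sumTest (a b V : ℕ) : Bool :=
  b ^ 800 % (V - a ^ bisect (fun x => decide (a ^ x < V)) 9 0) == 0

/-- `M` encodes the sums of powers modulo `1680`. -/
def rootTest (a b M N z c : ℕ) : Bool :=
  c ^ z != N || (a == 3 && b == 5 && c == 2) || (List.range (25 - z)).all fun i =>
    c ^ (z + 1 + i) % 2 ^ 26 == 0 || !M.testBit (c ^ (z + 1 + i) % 1680) ||
      (!sumTest a b (c ^ (z + 1 + i)) && !sumTest b a (c ^ (z + 1 + i)))

def evenTest (a b M : ℕ) : Bool :=
  (List.range 20).all fun x => (List.range 13).all fun y =>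
    decide (2 ^ 32 ≤ a ^ (x + 1) + b ^ (y + 1)) || (List.range 25).all fun i =>
      (a ^ (x + 1) + b ^ (y + 1)) % 2 ^ (i + 1) != 0 ||
      rootTest a b M (a ^ (x + 1) + b ^ (y + 1)) (i + 1)
        (bisect (fun t => decide (t ^ (i + 1) ≤ a ^ (x + 1) + b ^ (y + 1)))
          (32 / (i + 1) + 1) 0)

def maskTest (a b M : ℕ) : Bool :=
  (List.range 12).all fun x => a ^ (x + 1 + 12) % 1680 == a ^ (x + 1) % 1680 &&
    b ^ (x + 1 + 12) % 1680 == b ^ (x + 1) % 1680 &&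
    (List.range 12).all fun y => M.testBit ((a ^ (x + 1) + b ^ (y + 1)) % 1680)

theorem exists_mask_evenTest {a b : ℕ} (hab : (a, b) ∈ [(3, 5), (3, 7), (5, 7)]) :
    ∃ M, maskTest a b M = true ∧ evenTest a b M = true := by
  simp only [List.mem_cons, Prod.mk.injEq, List.not_mem_nil, or_false] at hab
  rcases hab with ⟨rfl, rfl⟩ | ⟨rfl, rfl⟩ | ⟨rfl, rfl⟩
  · exact ⟨3128764410779502387929470522414805312330555198956427145547017336715681018533919943416864620722290901837882109669867975590254863436200603753598271257332502299876254631349697242875508507734032608708729335092294332113716483528129097256037807238066085010476040824512296721841229266099304655190725137604140454833501283810529432277897798229844215394449727024135821932139604020128738260091524140195560480786909749189863923507363173416073067742549507112390843235449928005865370946769525923391702889939200,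
      by decide +kernel, by decide +kernel⟩
  · exact ⟨41408854655242240220062326584629214400684389330613684238078833247006580640527491889116949761546437727420866210736583100504486869428597078129157856821891585385662107705429421731996361248980418917403906425481189597990887133029058423138451184811918167757316760032279685899102658598724310263791330677415315443142994954290469857289930915618138005540174552501279104462943768518295552003844468279918858692492003093004926713634485424144434802359448084036924174745250382599568819200,
      by decide +kernel, by decide +kernel⟩
  · exact ⟨2713773124985271251384008413384083835065388646270971381537705244567106862441317986280499371431584277075620551954040850783603669312607392177178264171160908210083244909566835606199016314131420404396219642069377785558008621659528352896262632021766354145031087515612058469664390747798446422479525546934280099202211231772916373106470208691155224084704185483260786914224340344696451182096933624043935600012234086717691250434756003972607315725371220798337959442479768483272279755592000,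
      by decide +kernel, by decide +kernel⟩

theorem sumTest_eq_true {a b x y V : ℕ} (ha : 2 ≤ a) (hx : x < 512) (hy : y ≤ 800)
    (hlt : b ^ y < a ^ x) (hb : 0 < b) (hV : a ^ x + b ^ y = V) : sumTest a b V = true := by
  have h0 : 0 < b ^ y := by positivity
  have h1 : bisect (fun x => decide (a ^ x < V)) 9 0 = x := by
    refine bisect_eq (fun t ht => decide_eq_true ?_) (fun t ht => decide_eq_false ?_)
      (Nat.zero_le _) (by omega)
    · have := Nat.pow_le_pow_right (show 0 < a by omega) ht
      omega
    · have h2 := Nat.pow_le_pow_right (show 0 < a by omega) (Nat.succ_le_of_lt ht)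
      rw [Nat.succ_eq_add_one, pow_succ] at h2
      have := Nat.mul_le_mul_left (a ^ x) ha
      omega
  rw [sumTest, h1, ← hV, Nat.add_sub_cancel_left, beq_iff_eq]
  exact Nat.mod_eq_zero_of_dvd (pow_dvd_pow b hy)

theorem testBit_of_maskTest {a b M x y : ℕ} (h : maskTest a b M = true) (hx : 0 < x)
    (hy : 0 < y) : M.testBit ((a ^ x + b ^ y) % 1680) = true := by
  simp only [maskTest, List.all_eq_true, List.mem_range, Bool.and_eq_true, beq_iff_eq] at h
  obtain ⟨⟨ha, hb⟩, -⟩ := h 0 (by norm_num)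
  have key : ∀ t : ℕ, t ^ (0 + 1 + 12) % 1680 = t ^ (0 + 1) % 1680 → ∀ x, 0 < x →
      t ^ x % 1680 = t ^ ((x - 1) % 12 + 1) % 1680 := by
    intro t ht x hx
    have hper : Function.Periodic (fun n => t ^ (n + 1) % 1680) 12 := by
      intro n
      change t ^ (n + 12 + 1) ≡ t ^ (n + 1) [MOD 1680]
      rw [show n + 12 + 1 = n + (0 + 1 + 12) by ring, pow_add t n, pow_add t n 1]
      exact Nat.ModEq.mul_left _ (by simpa [Nat.ModEq] using ht)
    have h1 := hper.map_mod_nat (x - 1)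
    change t ^ ((x - 1) % 12 + 1) % 1680 = t ^ (x - 1 + 1) % 1680 at h1
    rw [h1, Nat.sub_add_cancel hx]
  rw [Nat.add_mod, key a ha x hx, key b hb y hy, ← Nat.add_mod]
  exact (h _ (Nat.mod_lt _ (by norm_num))).2 _ (Nat.mod_lt _ (by norm_num))

set_option exponentiation.threshold 1000 in
/-- Uniqueness for even `c`, up to the exceptional case `(3, 5, 2)`. -/
theorem eq_three_five_two {a b c x₁ y₁ z₁ x₂ y₂ z₂ : ℕ}
    (hab : (a, b) ∈ [(3, 5), (3, 7), (5, 7)])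
    (hx₁ : 0 < x₁) (hy₁ : 0 < y₁) (hz₁ : 0 < z₁) (hx₂ : 0 < x₂) (hy₂ : 0 < y₂) (hz : z₁ < z₂)
    (hc : 1 < c) (h₁ : a ^ x₁ + b ^ y₁ = c ^ z₁) (h₂ : a ^ x₂ + b ^ y₂ = c ^ z₂) :
    (a, b, c) = (3, 5, 2) := by
  obtain ⟨hN, hz26, hdvd⟩ := two_pow_size_bounds hab hx₁ hy₁ hz₁ hx₂ hy₂ hz hc h₁ h₂
  have hab' : Odd a ∧ Odd b ∧ 3 ≤ a ∧ 5 ≤ b ∧ Nat.Coprime a b := by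
    simp only [List.mem_cons, Prod.mk.injEq, List.not_mem_nil, or_false] at hab
    rcases hab with ⟨rfl, rfl⟩ | ⟨rfl, rfl⟩ | ⟨rfl, rfl⟩ <;> decide
  obtain ⟨hao, hbo, ha3, hb5, hcop⟩ := hab'
  have hce := even_of_pow_add_pow_eq hao hbo hz₁ h₁
  obtain ⟨M, hM, hT⟩ := exists_mask_evenTest hab
  have hV : c ^ z₂ < 2 ^ 800 := by
    calc c ^ z₂ ≤ (c ^ z₁) ^ z₂ := Nat.pow_le_pow_left (Nat.le_self_pow hz₁.ne' c) _
      _ < (2 ^ 32) ^ z₂ := Nat.pow_lt_pow_left hN (by omega)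
      _ ≤ (2 ^ 32) ^ 25 := Nat.pow_le_pow_right (by norm_num) (by omega)
      _ = 2 ^ 800 := (pow_mul 2 32 25).symm
  have hsmall : ∀ {t n : ℕ}, 3 ≤ t → t ^ n < 2 ^ 800 → n < 512 := by
    intro t n ht h
    by_contra! hn
    have h3 : 3 ^ 512 ≤ t ^ n :=
      (Nat.pow_le_pow_left ht _).trans (Nat.pow_le_pow_right (by omega) hn)
    have h4 : (2 : ℕ) ^ 800 < 3 ^ 512 := by
      rw [pow_mul 2 25 32, pow_mul 3 16 32]
      exact Nat.pow_lt_pow_left (by norm_num) (by norm_num)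
    exact absurd (h4.trans_le h3) h.not_gt
  have pa := pow_pos (show 0 < a by omega) x₂
  have pb := pow_pos (show 0 < b by omega) y₂
  have pa1 := pow_pos (show 0 < a by omega) x₁
  have pb1 := pow_pos (show 0 < b by omega) y₁
  have hx512 := hsmall ha3 ((show a ^ x₂ < c ^ z₂ by omega).trans hV)
  have hy512 := hsmall (show 3 ≤ b by omega) ((show b ^ y₂ < c ^ z₂ by omega).trans hV)
  have hx21 : x₁ < 21 := by
    by_contra! hn
    have h3 : 3 ^ 21 ≤ a ^ x₁ :=
      (Nat.pow_le_pow_left ha3 _).trans (Nat.pow_le_pow_right (by omega) hn)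
    omega
  have hy14 : y₁ < 14 := by
    by_contra! hn
    have h3 : 5 ^ 14 ≤ b ^ y₁ :=
      (Nat.pow_le_pow_left hb5 _).trans (Nat.pow_le_pow_right (by omega) hn)
    omega
  simp only [evenTest, List.all_eq_true, List.mem_range, Bool.or_eq_true, bne_iff_ne,
    decide_eq_true_eq] at hT
  obtain ⟨x, rfl⟩ := Nat.exists_eq_add_of_lt hx₁
  obtain ⟨y, rfl⟩ := Nat.exists_eq_add_of_lt hy₁
  obtain ⟨z, rfl⟩ := Nat.exists_eq_add_of_lt hz₁
  simp only [zero_add] at *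
  have hT' := (hT x (by omega) y (by omega)).resolve_left (by omega) z (by omega)
  rw [h₁] at hT'
  replace hT' := hT'.resolve_left (fun h => h (Nat.mod_eq_zero_of_dvd
    (pow_dvd_pow_of_dvd hce.two_dvd _)))
  rw [bisect_eq (c := c) (fun t ht => decide_eq_true (Nat.pow_le_pow_left ht _))
    (fun t ht => decide_eq_false (not_le.2 (Nat.pow_lt_pow_left ht (by omega))))
    (Nat.zero_le _) ?_] at hT'
  · simp only [rootTest, List.all_eq_true, List.mem_range, Bool.or_eq_true, bne_iff_ne,
      Bool.and_eq_true, beq_iff_eq, Bool.not_eq_true', ne_eq, not_true_eq_false,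
      false_or] at hT'
    rcases hT' with ⟨⟨rfl, rfl⟩, rfl⟩ | hT'
    · rfl
    · exfalso
      have h3 := hT' (z₂ - (z + 1) - 1) (by omega)
      rw [show z + 1 + 1 + (z₂ - (z + 1) - 1) = z₂ by omega] at h3
      rcases h3 with (h3 | h3) | ⟨h3, h4⟩
      · exact hdvd (Nat.dvd_of_mod_eq_zero h3)
      · rw [← h₂, testBit_of_maskTest hM hx₂ hy₂] at h3
        exact absurd h3 (by decide)
      · have hne : a ^ x₂ ≠ b ^ y₂ := by
          intro h
          have := hcop.pow x₂ y₂
          rw [h, Nat.coprime_self] at this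
          have := Nat.le_self_pow hy₂.ne' b
          omega
        rcases lt_or_gt_of_ne hne with h | h
        · rw [sumTest_eq_true (by omega) hy512 (by omega) h (by omega)
            ((add_comm _ _).trans h₂)] at h4
          exact absurd h4 (by decide)
        · rw [sumTest_eq_true (by omega) hx512 (by omega) h (by omega) h₂] at h3
          exact absurd h3 (by decide)
  · rw [zero_add]
    by_contra! hge
    have h3 : (2 ^ (32 / (z + 1) + 1)) ^ (z + 1) ≤ c ^ (z + 1) := Nat.pow_le_pow_left hge _
    rw [← pow_mul] at h3
    have h4 : 32 ≤ (32 / (z + 1) + 1) * (z + 1) := by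
      rw [mul_comm]
      exact (Nat.lt_mul_div_succ 32 (Nat.succ_pos z)).le
    have := Nat.pow_le_pow_right (show 0 < 2 by norm_num) h4
    omega

theorem isCoprime_of_dvd_sq_add_sq {c d e x y k l A : ℤ} (hc : c ≠ 0) (hd : IsCoprime c d)
    (he : IsCoprime c e) (h : c ∣ d * x ^ 2 + e * y ^ 2) (hA : IsCoprime c A)
    (hxy : A = k * x + l * y) : IsCoprime c x ∧ IsCoprime c y := by
  have key : ∀ p : ℤ, Prime p → p ∣ c → p ∣ x → p ∣ y → False := fun p hp hpc hpx hpy =>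
    hp.not_isUnit (hA.isUnit_of_dvd' hpc
      (hxy ▸ dvd_add (hpx.mul_left k) (hpy.mul_left l)))
  constructor
  · refine isCoprime_of_prime_dvd (fun h => hc h.1) fun p hp hpc hpx => key p hp hpc hpx ?_
    have h1 := (Int.dvd_add_right ((dvd_pow hpx two_ne_zero).mul_left d)).1 (hpc.trans h)
    rcases hp.dvd_or_dvd h1 with h2 | h2
    · exact absurd (he.isUnit_of_dvd' hpc h2) hp.not_isUnit
    · exact hp.dvd_of_dvd_pow h2
  · refine isCoprime_of_prime_dvd (fun h => hc h.1) fun p hp hpc hpy => key p hp hpc ?_ hpy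
    have h1 := (Int.dvd_add_left ((dvd_pow hpy two_ne_zero).mul_left e)).1 (hpc.trans h)
    rcases hp.dvd_or_dvd h1 with h2 | h2
    · exact absurd (hd.isUnit_of_dvd' hpc h2) hp.not_isUnit
    · exact hp.dvd_of_dvd_pow h2

/-- The coefficients of `(r * √d + s * √-e) ^ (2 * m + 1) = r * P * √d + s * Q * √-e`, where
`u = d * r ^ 2` and `v = e * s ^ 2`. -/
def oddPowCoeff {R : Type*} [CommRing R] (u v : R) : ℕ → R × R
  | 0 => (1, 1)
  | m + 1 => ((u - v) * (oddPowCoeff u v m).1 - 2 * v * (oddPowCoeff u v m).2,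
      (u - v) * (oddPowCoeff u v m).2 + 2 * u * (oddPowCoeff u v m).1)

theorem eq_oddPowCoeff_of_dvd {c d e r s : ℤ} (hc : 0 < c) (hd : 0 < d) (he : 0 < e)
    (hcd : IsCoprime c d) (hce : IsCoprime c e) (hrs : c = d * r ^ 2 + e * s ^ 2) (m : ℕ) :
    ∀ A B : ℤ, d * A ^ 2 + e * B ^ 2 = c ^ (2 * m + 1) → IsCoprime c A → IsCoprime c B →
      c ∣ B * r - A * s → ∃ ε : ℤ, ε ^ 2 = 1 ∧
        ((A = ε * r * (oddPowCoeff (d * r ^ 2) (e * s ^ 2) m).1 ∧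
          B = ε * s * (oddPowCoeff (d * r ^ 2) (e * s ^ 2) m).2) ∨
        (d = 1 ∧ e = 1 ∧ A = -ε * s * (oddPowCoeff (d * r ^ 2) (e * s ^ 2) m).2 ∧
          B = ε * r * (oddPowCoeff (d * r ^ 2) (e * s ^ 2) m).1)) := by
  induction m with
  | zero =>
    intro A B hAB hA hB ⟨Y, hY⟩
    have hX : c ∣ d * A * r + e * B * s := by
      refine hB.dvd_of_dvd_mul_left (Dvd.intro (d * A * Y + s * c ^ (2 * 0)) ?_)
      linear_combination -d * A * hY - s * hAB
    obtain ⟨X, hX⟩ := hX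
    have e1 : A = X * r - e * Y * s := by
      apply mul_left_cancel₀ hc.ne'
      linear_combination A * hrs + r * hX - e * s * hY
    have e2 : B = X * s + d * Y * r := by
      apply mul_left_cancel₀ hc.ne'
      linear_combination B * hrs + s * hX + d * r * hY
    have e3 : X ^ 2 + d * e * Y ^ 2 = 1 := by
      apply mul_left_cancel₀ hc.ne'
      rw [e1, e2] at hAB
      linear_combination hAB + (X ^ 2 + d * e * Y ^ 2) * hrs
    simp only [oddPowCoeff, mul_one]
    rcases eq_or_ne Y 0 with rfl | hY0
    · exact ⟨X, by linarith, Or.inl ⟨by linear_combination e1, by linear_combination e2⟩⟩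
    · have hY1 : 0 < Y ^ 2 := by positivity
      have hde : 0 < d * e := by positivity
      have hX0 : X = 0 := by
        have : X ^ 2 ≤ 0 := by nlinarith
        nlinarith [sq_nonneg X]
      subst hX0
      have hde1 : d * e ≤ 1 := by nlinarith
      have hd1 : d = 1 := by nlinarith
      subst hd1
      have he1 : e = 1 := by omega
      subst he1
      exact ⟨Y, by linarith, Or.inr ⟨rfl, rfl, by linear_combination e1, by linear_combination e2⟩⟩
  | succ m ih =>
    intro A B hAB hA hB ⟨Y, hY⟩
    have hX : c ∣ d * A * r + e * B * s := by
      refine hB.dvd_of_dvd_mul_left (Dvd.intro (d * A * Y + s * c ^ (2 * (m + 1))) ?_)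
      linear_combination -d * A * hY - s * hAB
    obtain ⟨X, hX⟩ := hX
    have e1 : A = X * r - e * Y * s := by
      apply mul_left_cancel₀ hc.ne'
      linear_combination A * hrs + r * hX - e * s * hY
    have e2 : B = X * s + d * Y * r := by
      apply mul_left_cancel₀ hc.ne'
      linear_combination B * hrs + s * hX + d * r * hY
    have e3 : X ^ 2 + d * e * Y ^ 2 = c ^ (2 * m + 2) := by
      apply mul_left_cancel₀ hc.ne'
      rw [e1, e2] at hAB
      linear_combination hAB + (X ^ 2 + d * e * Y ^ 2) * hrs
    have hA1 : c ∣ X * r + e * Y * s := by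
      refine hA.dvd_of_dvd_mul_left (Dvd.intro (r ^ 2 * c ^ (2 * m + 1) - e * Y ^ 2) ?_)
      linear_combination -(X * r + e * Y * s) * e1 - r ^ 2 * e3 - e * Y ^ 2 * hrs
    have hB1 : c ∣ d * Y * r - X * s := by
      refine hB.dvd_of_dvd_mul_left (Dvd.intro (d * Y ^ 2 - s ^ 2 * c ^ (2 * m + 1)) ?_)
      linear_combination -(d * Y * r - X * s) * e2 + s ^ 2 * e3 + d * Y ^ 2 * hrs
    obtain ⟨A₁, hA₁⟩ := hA1
    obtain ⟨B₁, hB₁⟩ := hB1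
    have f1 : X = d * r * A₁ - e * s * B₁ := by
      apply mul_left_cancel₀ hc.ne'
      linear_combination X * hrs + d * r * hA₁ - e * s * hB₁
    have f2 : Y = s * A₁ + r * B₁ := by
      apply mul_left_cancel₀ hc.ne'
      linear_combination Y * hrs + s * hA₁ + r * hB₁
    have f3 : d * A₁ ^ 2 + e * B₁ ^ 2 = c ^ (2 * m + 1) := by
      apply mul_left_cancel₀ hc.ne'
      rw [f1, f2] at e3
      linear_combination e3 + (d * A₁ ^ 2 + e * B₁ ^ 2) * hrs
    have hXY := isCoprime_of_dvd_sq_add_sq (x := X) (y := Y) (d := 1) (e := d * e) (k := r)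
      (l := -(e * s)) hc.ne' isCoprime_one_right (hcd.mul_right hce)
      (by rw [one_mul, e3]; exact dvd_pow_self c (by omega)) hA (by linear_combination e1)
    have hAB₁ := isCoprime_of_dvd_sq_add_sq (x := A₁) (y := B₁) (d := d) (e := e) (k := d * r)
      (l := -(e * s)) hc.ne' hcd hce (by rw [f3]; exact dvd_pow_self c (by omega)) hXY.1
      (by linear_combination f1)
    have hdvd : c ∣ B₁ * r - A₁ * s := by
      refine (hcd.mul_right hXY.2).dvd_of_dvd_mul_left
        (Dvd.intro (B₁ ^ 2 - s ^ 2 * c ^ (2 * m)) ?_)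
      linear_combination B₁ ^ 2 * hrs + s ^ 2 * f3 - d * (B₁ * r - A₁ * s) * f2
    obtain ⟨ε, hε, h⟩ := ih A₁ B₁ f3 hAB₁.1 hAB₁.2 hdvd
    refine ⟨ε, hε, ?_⟩
    have g1 : A = A₁ * (d * r ^ 2 - e * s ^ 2) - 2 * r * s * e * B₁ := by
      rw [e1, f1, f2]; ring
    have g2 : B = B₁ * (d * r ^ 2 - e * s ^ 2) + 2 * r * s * d * A₁ := by
      rw [e2, f1, f2]; ring
    simp only [oddPowCoeff]
    rcases h with ⟨h1, h2⟩ | ⟨rfl, rfl, h1, h2⟩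
    · exact Or.inl ⟨by rw [g1, h1, h2]; ring, by rw [g2, h1, h2]; ring⟩
    · exact Or.inr ⟨rfl, rfl, by rw [g1, h1, h2]; ring, by rw [g2, h1, h2]; ring⟩

theorem two_mul_sq_add_seven_mul_sq_ne_pow {c r s : ℤ} (hc : 0 < c) (hc14 : IsCoprime c 14)
    (hrs : c = r ^ 2 + 14 * s ^ 2) (n : ℕ) :
    ∀ A B : ℤ, IsCoprime c B → c ∣ B * r - 2 * A * s → 2 * A ^ 2 + 7 * B ^ 2 ≠ c ^ n := by
  induction n with
  | zero =>
    intro A B _ _ h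
    have hB : B ^ 2 ≤ 0 := by nlinarith [sq_nonneg A]
    have hB0 : B ^ 2 = 0 := le_antisymm hB (sq_nonneg B)
    rw [hB0, pow_zero] at h
    omega
  | succ n ih =>
    intro A B hB ⟨Y, hY⟩ hAB
    have hX : c ∣ A * r + 7 * B * s := by
      refine hB.dvd_of_dvd_mul_left (Dvd.intro (A * Y + s * c ^ n) ?_)
      linear_combination -A * hY - s * hAB
    obtain ⟨X, hX⟩ := hX
    have e1 : A = X * r - 7 * Y * s := by
      apply mul_left_cancel₀ hc.ne'
      linear_combination A * hrs + r * hX - 7 * s * hY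
    have e2 : B = 2 * X * s + Y * r := by
      apply mul_left_cancel₀ hc.ne'
      linear_combination B * hrs + 2 * s * hX + r * hY
    have e3 : 2 * X ^ 2 + 7 * Y ^ 2 = c ^ n := by
      apply mul_left_cancel₀ hc.ne'
      rw [e1, e2] at hAB
      linear_combination hAB + (2 * X ^ 2 + 7 * Y ^ 2) * hrs
    rcases Nat.eq_zero_or_pos n with rfl | hn
    · have hB : Y ^ 2 ≤ 0 := by nlinarith [sq_nonneg X]
      have hB0 : Y ^ 2 = 0 := le_antisymm hB (sq_nonneg Y)
      rw [hB0, pow_zero] at e3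
      omega
    obtain ⟨k, rfl⟩ := Nat.exists_eq_add_of_lt hn
    have h2 : IsCoprime c 2 := hc14.of_isCoprime_of_dvd_right (by norm_num)
    have h7 : IsCoprime c 7 := hc14.of_isCoprime_of_dvd_right (by norm_num)
    have hXY := isCoprime_of_dvd_sq_add_sq (x := X) (y := Y) (d := 2) (e := 7) (k := 2 * s)
      (l := r) hc.ne' h2 h7 (by rw [e3]; exact dvd_pow_self c (by omega)) hB
      (by linear_combination e2)
    refine ih X Y hXY.2 ?_ e3
    refine hB.dvd_of_dvd_mul_left (Dvd.intro (Y ^ 2 - 2 * s ^ 2 * c ^ k) ?_)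
    rw [e2]
    rw [zero_add, pow_succ] at e3
    linear_combination Y ^ 2 * hrs + 2 * s ^ 2 * e3

/-- Reduction of a basis of the lattice of all `(r, s)` with `c ∣ B * r - A * s`, on which the form
`d * r ^ 2 + e * s ^ 2` is divisible by `c`. -/
theorem exists_reduced_basis_aux {c d e A B : ℤ} (hde : 0 < d * e) (N : ℕ) :
    ∀ k m h r₁ s₁ r₂ s₂ i j : ℤ, k + m ≤ N → 0 < k → 0 < m →
      d * r₁ ^ 2 + e * s₁ ^ 2 = k * c → d * r₂ ^ 2 + e * s₂ ^ 2 = m * c →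
      d * r₁ * r₂ + e * s₁ * s₂ = h * c → k * m - h ^ 2 = d * e →
      c ∣ B * r₁ - A * s₁ → c ∣ B * r₂ - A * s₂ → A = i * r₁ + j * r₂ → B = i * s₁ + j * s₂ →
    ∃ k m h r₁ s₁ r₂ s₂ i j : ℤ, 0 < k ∧ k ≤ m ∧ 2 * |h| ≤ k ∧
      d * r₁ ^ 2 + e * s₁ ^ 2 = k * c ∧ d * r₂ ^ 2 + e * s₂ ^ 2 = m * c ∧
      d * r₁ * r₂ + e * s₁ * s₂ = h * c ∧ k * m - h ^ 2 = d * e ∧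
      c ∣ B * r₁ - A * s₁ ∧ A = i * r₁ + j * r₂ ∧ B = i * s₁ + j * s₂ := by
  induction N with
  | zero => intro k m h r₁ s₁ r₂ s₂ i j hN hk hm; push_cast at hN; omega
  | succ N ih =>
    intro k m h r₁ s₁ r₂ s₂ i j hN hk hm e1 e2 e3 e4 h1 h2 hA hB
    push_cast at hN
    by_cases hr : 2 * |h| ≤ k ∧ 2 * |h| ≤ m
    · rcases le_total k m with hkm | hkm
      · exact ⟨k, m, h, r₁, s₁, r₂, s₂, i, j, hk, hkm, hr.1, e1, e2, e3, e4, h1, hA, hB⟩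
      · exact ⟨m, k, h, r₂, s₂, r₁, s₁, j, i, hm, hkm, hr.2, e2, e1, by linear_combination e3,
          by linear_combination e4, h2, by linear_combination hA, by linear_combination hB⟩
    · obtain ⟨σ, hσ, hσh⟩ : ∃ σ : ℤ, σ ^ 2 = 1 ∧ σ * h = |h| := by
        rcases abs_cases h with ⟨h', _⟩ | ⟨h', _⟩
        · exact ⟨1, by norm_num, by linarith⟩
        · exact ⟨-1, by norm_num, by linarith⟩
      by_cases hkh : 2 * |h| ≤ k
      · have hmh : m < 2 * |h| := lt_of_not_ge fun h' => hr ⟨hkh, h'⟩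
        have hpos : (k - 2 * |h| + m) * m = (h - σ * m) ^ 2 + d * e := by
          linear_combination e4 - m ^ 2 * hσ + 2 * m * hσh
        refine ih (k - 2 * |h| + m) m (h - σ * m) (r₁ - σ * r₂) (s₁ - σ * s₂) r₂ s₂ i (j + σ * i)
          (by omega) (by nlinarith [sq_nonneg (h - σ * m)]) hm ?_ e2 ?_
          (by linear_combination hpos) ?_ h2 ?_ ?_
        · linear_combination e1 - 2 * σ * e3 + (d * r₂ ^ 2 + e * s₂ ^ 2) * hσ + e2 - 2 * c * hσh
        · linear_combination e3 - σ * e2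
        · obtain ⟨x, hx⟩ := h1
          obtain ⟨y, hy⟩ := h2
          exact ⟨x - σ * y, by linear_combination hx - σ * hy⟩
        · linear_combination hA
        · linear_combination hB
      · have hpos : k * (m - 2 * |h| + k) = (h - σ * k) ^ 2 + d * e := by
          linear_combination e4 - k ^ 2 * hσ + 2 * k * hσh
        refine ih k (m - 2 * |h| + k) (h - σ * k) r₁ s₁ (r₂ - σ * r₁) (s₂ - σ * s₁) (i + σ * j) j
          (by omega) hk (by nlinarith [sq_nonneg (h - σ * k)]) e1 ?_ ?_
          (by linear_combination hpos) h1 ?_ ?_ ?_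
        · linear_combination e2 - 2 * σ * e3 + (d * r₁ ^ 2 + e * s₁ ^ 2) * hσ + e1 - 2 * c * hσh
        · linear_combination e3 - σ * e1
        · obtain ⟨x, hx⟩ := h1
          obtain ⟨y, hy⟩ := h2
          exact ⟨y - σ * x, by linear_combination hy - σ * hx⟩
        · linear_combination hA
        · linear_combination hB

theorem exists_reduced_basis {c d e A B : ℤ} (hc : 0 < c) (hd : 0 < d) (he : 0 < e)
    (hB : IsCoprime c B) (h : c ∣ d * A ^ 2 + e * B ^ 2) :
    ∃ k m h r₁ s₁ r₂ s₂ i j : ℤ, 0 < k ∧ k ≤ m ∧ 2 * |h| ≤ k ∧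
      d * r₁ ^ 2 + e * s₁ ^ 2 = k * c ∧ d * r₂ ^ 2 + e * s₂ ^ 2 = m * c ∧
      d * r₁ * r₂ + e * s₁ * s₂ = h * c ∧ k * m - h ^ 2 = d * e ∧
      c ∣ B * r₁ - A * s₁ ∧ A = i * r₁ + j * r₂ ∧ B = i * s₁ + j * s₂ := by
  obtain ⟨u, v, huv⟩ := id hB
  have hdvd : c ∣ d * (A * v) ^ 2 + e := by
    obtain ⟨q, hq⟩ := h
    exact ⟨v ^ 2 * q + e * u * (1 + v * B), by
      linear_combination v ^ 2 * hq - e * (1 + v * B) * huv⟩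
  obtain ⟨m, hm⟩ := hdvd
  have hm0 : 0 < m := by
    have : 0 < c * m := by rw [← hm]; positivity
    exact pos_of_mul_pos_right this hc.le
  refine exists_reduced_basis_aux (mul_pos hd he) (d * c + m).toNat (d * c) m (d * (A * v)) c 0
    (A * v) 1 (A * u) B (Int.self_le_toNat _) (by positivity) hm0 (by ring)
    (by linear_combination hm) (by ring) (by linear_combination -d * hm) ⟨B, by ring⟩
    ⟨-A * u, by linear_combination A * huv⟩ (by linear_combination -A * huv) (by ring)

/-- The pairs of coefficients of the forms `d * A ^ 2 + e * B ^ 2` that arise from sums of powers of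
one of `2`, `6`, `10` and one of `3`, `5`, `7`. -/
def formCoeffs : List (ℤ × ℤ) :=
  [(1, 1), (1, 3), (1, 5), (1, 7), (2, 1), (6, 1), (10, 1), (2, 3), (2, 5), (2, 7), (10, 3), (6, 5),
    (6, 7), (10, 7)]

theorem reduced_form_check : (formCoeffs.all fun de =>
    (List.range 8).all fun k => (List.range 9).all fun h =>
      let K : ℤ := k + 2
      let H : ℤ := h - 4
      let M : ℤ := (de.1 * de.2 + H ^ 2) / K
      K * M != de.1 * de.2 + H ^ 2 || decide (K < 2 * |H|) || decide (M < K)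
      || (de == (2, 7) && K == 2 && H == 0)
      || [2, 3, 5, 7].any fun p : ℕ => (2 * de.1 * de.2) % p == 0 &&
        (List.range p).all fun i => (List.range p).all fun j => (List.range p).all fun w =>
          w == 0 || (K * i ^ 2 + 2 * H * i * j + M * j ^ 2 - w ^ 2) % p != 0) = true := by
  decide +kernel

theorem eq_one_or_of_reduced_form {d e k m h i j w : ℤ} (hde : (d, e) ∈ formCoeffs) (hk : 0 < k)
    (hkm : k ≤ m) (hh : 2 * |h| ≤ k) (hD : k * m - h ^ 2 = d * e)
    (hw : IsCoprime w (2 * d * e)) (hform : w ^ 2 = k * i ^ 2 + 2 * h * i * j + m * j ^ 2) :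
    k = 1 ∨ (d = 2 ∧ e = 7 ∧ k = 2 ∧ h = 0) := by
  by_contra! hne
  have hde70 : d * e ≤ 70 := by
    simp only [formCoeffs, List.mem_cons, Prod.mk.injEq, List.not_mem_nil, or_false] at hde
    rcases hde with h | h | h | h | h | h | h | h | h | h | h | h | h | h <;> rw [h.1, h.2] <;>
      norm_num
  have hsq : (2 * |h|) ^ 2 ≤ k ^ 2 := pow_le_pow_left₀ (by positivity) hh 2
  have hsq' : |h| ^ 2 = h ^ 2 := sq_abs h
  have hk9 : k ≤ 9 := by nlinarith
  have hh4 : |h| ≤ 4 := by omega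
  have hh4' := abs_le.1 hh4
  have := reduced_form_check
  simp only [List.all_eq_true, List.mem_range, Bool.or_eq_true, Bool.and_eq_true, beq_iff_eq,
    bne_iff_ne, decide_eq_true_eq, List.any_eq_true] at this
  have h1 := this (d, e) hde (k - 2).toNat (by omega) (h + 4).toNat (by omega)
  have hK : (((k - 2).toNat : ℕ) : ℤ) + 2 = k := by omega
  have hH : (((h + 4).toNat : ℕ) : ℤ) - 4 = h := by omega
  simp only [hK, hH] at h1
  have hM : (d * e + h ^ 2) / k = m :=
    Int.ediv_eq_of_eq_mul_right hk.ne' (by linear_combination -hD)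
  rw [hM] at h1
  rcases h1 with (((h1 | h1) | h1) | h1) | ⟨p, hp, hpD, h1⟩
  · exact h1 (by linear_combination hD)
  · omega
  · omega
  · simp only [Prod.mk.injEq] at h1
    exact hne.2 h1.1.1.1 h1.1.1.2 h1.1.2 h1.2
  · have hp0 : (p : ℤ) ≠ 0 ∧ 2 ≤ p := by
      simp only [List.mem_cons, List.not_mem_nil, or_false] at hp
      omega
    have hlt : ∀ x : ℤ, (x % p).toNat < p := fun x => by
      have := Int.emod_lt_of_pos x (by omega : (0 : ℤ) < p)
      have := Int.emod_nonneg x hp0.1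
      omega
    have hcast : ∀ x : ℤ, (((x % p).toNat : ℕ) : ℤ) ≡ x [ZMOD p] := fun x => by
      rw [Int.toNat_of_nonneg (Int.emod_nonneg x hp0.1)]
      exact Int.mod_modEq x p
    rcases h1 _ (hlt i) _ (hlt j) _ (hlt w) with h2 | h2
    · have hpw : (p : ℤ) ∣ w := by
        apply Int.dvd_of_emod_eq_zero
        have := Int.emod_nonneg w hp0.1
        omega
      have := Int.isUnit_iff.1 (hw.isUnit_of_dvd' hpw (Int.dvd_of_emod_eq_zero hpD))
      omega
    · apply h2
      have : k * ((i % p).toNat : ℤ) ^ 2 + 2 * h * ((i % p).toNat : ℤ) * ((j % p).toNat : ℤ) +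
          m * ((j % p).toNat : ℤ) ^ 2 - ((w % p).toNat : ℤ) ^ 2 ≡
          k * i ^ 2 + 2 * h * i * j + m * j ^ 2 - w ^ 2 [ZMOD p] := by
        have hi := hcast i
        have hj := hcast j
        have hw := hcast w
        gcongr
      rw [this, ← hform, sub_self, Int.zero_emod]

theorem exists_eq_mul_sq_add_mul_sq {c d e A B : ℤ} {n : ℕ} (hde : (d, e) ∈ formCoeffs)
    (hc : 0 < c) (hcd : IsCoprime c (2 * d * e)) (hB : IsCoprime c B)
    (h : d * A ^ 2 + e * B ^ 2 = c ^ (2 * n + 1)) :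
    ∃ r s : ℤ, c = d * r ^ 2 + e * s ^ 2 ∧ c ∣ B * r - A * s := by
  have hpos : 0 < d ∧ 0 < e := by
    simp only [formCoeffs, List.mem_cons, Prod.mk.injEq, List.not_mem_nil, or_false] at hde
    omega
  obtain ⟨k, m, l, r₁, s₁, r₂, s₂, i, j, hk, hkm, hl, e1, e2, e3, e4, h1, hA', hB'⟩ :=
    exists_reduced_basis (A := A) hc hpos.1 hpos.2 hB
      (by rw [h]; exact dvd_pow_self c (by omega))
  have hform : (c ^ n) ^ 2 = k * i ^ 2 + 2 * l * i * j + m * j ^ 2 := by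
    apply mul_left_cancel₀ hc.ne'
    rw [hA', hB'] at h
    linear_combination -h + i ^ 2 * e1 + 2 * i * j * e3 + j ^ 2 * e2
  rcases eq_one_or_of_reduced_form hde hk hkm hl e4 hcd.pow_left hform with rfl |
    ⟨rfl, rfl, rfl, rfl⟩
  · exact ⟨r₁, s₁, by linear_combination -e1, h1⟩
  · exfalso
    obtain ⟨s, rfl⟩ : (2 : ℤ) ∣ s₁ :=
      Int.prime_two.dvd_of_dvd_pow (n := 2) (by omega)
    refine two_mul_sq_add_seven_mul_sq_ne_pow (s := s) (r := r₁) hc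
      (hcd.of_isCoprime_of_dvd_right (by norm_num)) (by linarith) _ A B hB ?_ h
    convert h1 using 1
    ring

theorem oddPowCoeff_swap {R : Type*} [CommRing R] (u v : R) (n : ℕ) :
    (oddPowCoeff v u n).1 = (-1) ^ n * (oddPowCoeff u v n).2 ∧
      (oddPowCoeff v u n).2 = (-1) ^ n * (oddPowCoeff u v n).1 := by
  induction n with
  | zero => simp [oddPowCoeff]
  | succ n ih =>
    simp only [oddPowCoeff, ih.1, ih.2]
    constructor <;> ring

theorem oddPowCoeff_map {R S : Type*} [CommRing R] [CommRing S] (f : R →+* S) (u v : R) (n : ℕ) :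
    (oddPowCoeff (f u) (f v) n).1 = f (oddPowCoeff u v n).1 ∧
      (oddPowCoeff (f u) (f v) n).2 = f (oddPowCoeff u v n).2 := by
  induction n with
  | zero => simp [oddPowCoeff]
  | succ n ih => simp [oddPowCoeff, ih.1, ih.2, map_ofNat f 2]

theorem dvd_oddPowCoeff_sub {R : Type*} [CommRing R] (u v : R) (n : ℕ) :
    u ∣ (oddPowCoeff u v n).1 - (2 * n + 1) * (-v) ^ n ∧ u ∣ (oddPowCoeff u v n).2 - (-v) ^ n := by
  induction n with
  | zero => simp [oddPowCoeff]
  | succ n ih =>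
    obtain ⟨⟨x, hx⟩, y, hy⟩ := ih
    simp only [oddPowCoeff]
    push_cast
    exact ⟨⟨(oddPowCoeff u v n).1 - v * x - 2 * v * y, by linear_combination -v * hx - 2 * v * hy⟩,
      ⟨(oddPowCoeff u v n).2 + 2 * (oddPowCoeff u v n).1 - v * y, by linear_combination -v * hy⟩⟩

theorem odd_oddPowCoeff {u v : ℤ} (h : Odd (u + v)) (n : ℕ) :
    Odd (oddPowCoeff u v n).1 ∧ Odd (oddPowCoeff u v n).2 := by
  have h' : Odd (u - v) := by grind
  induction n with
  | zero => simp [oddPowCoeff]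
  | succ n ih =>
    simp only [oddPowCoeff, mul_assoc]
    exact ⟨(h'.mul ih.1).sub_even (even_two_mul _), (h'.mul ih.2).add_even (even_two_mul _)⟩

theorem oddPowCoeff_add_of_eq {R : Type*} [CommRing R] {u v κ : R} {t : ℕ}
    (h : oddPowCoeff u v t = (κ, κ)) (n : ℕ) :
    (oddPowCoeff u v (n + t)).1 = κ * (oddPowCoeff u v n).1 ∧
      (oddPowCoeff u v (n + t)).2 = κ * (oddPowCoeff u v n).2 := by
  induction n with
  | zero => simp [h, oddPowCoeff]
  | succ n ih =>
    rw [add_right_comm]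
    simp only [oddPowCoeff, ih.1, ih.2]
    constructor <;> ring

/-- The rank of apparition of each of `3`, `5`, `7` divides `12`, and is not prime to `3` unless it
is even. -/
theorem oddPowCoeff_check {p : ℕ} (hp : p ∈ [3, 5, 7]) : ∀ u v : ZMod p, u ≠ 0 → v ≠ 0 → u + v ≠ 0 →
    (oddPowCoeff u v 12).1 = (oddPowCoeff u v 12).2 ∧ (oddPowCoeff u v 12).1 ≠ 0 ∧
      ∀ j < 12, (2 * j + 1) % 3 ≠ 0 → (oddPowCoeff u v j).1 ≠ 0 := by
  fin_cases hp <;> decide +kernel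

theorem oddPowCoeff_ne_zero {p : ℕ} (hp : p ∈ [3, 5, 7]) {u v : ZMod p} (hu : u ≠ 0) (hv : v ≠ 0)
    (huv : u + v ≠ 0) (n : ℕ) (hn : (2 * n + 1) % 3 ≠ 0) : (oddPowCoeff u v n).1 ≠ 0 := by
  have hp' : Fact p.Prime := ⟨by fin_cases hp <;> norm_num⟩
  induction n using Nat.strong_induction_on with
  | _ n ih =>
    obtain ⟨h1, h0, h2⟩ := oddPowCoeff_check hp u v hu hv huv
    rcases lt_or_ge n 12 with hn12 | hn12
    · exact h2 n hn12 hn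
    · obtain ⟨m, rfl⟩ := Nat.exists_eq_add_of_le' hn12
      have hm : (oddPowCoeff u v m).1 ≠ 0 := ih m (by omega) (by omega)
      rw [(oddPowCoeff_add_of_eq (κ := (oddPowCoeff u v 12).1) (Prod.ext rfl h1.symm) m).1]
      exact mul_ne_zero h0 hm

theorem natAbs_oddPowCoeff_le {u v : ℤ} {n r k : ℕ} (hr : r ∈ [3, 5, 7]) (hq : (2 * n + 1).Prime)
    (hq5 : 5 ≤ 2 * n + 1) (hv : ¬ (r : ℤ) ∣ v) (huv : ¬ (r : ℤ) ∣ u + v)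
    (h : (oddPowCoeff u v n).1.natAbs = r ^ k) : (oddPowCoeff u v n).1.natAbs ≤ 2 * n + 1 := by
  have hrp : r.Prime := by fin_cases hr <;> norm_num
  rcases Nat.eq_zero_or_pos k with rfl | hk
  · rw [h, pow_zero]; omega
  have hdvd : (r : ℤ) ∣ (oddPowCoeff u v n).1 := by
    rw [← Int.dvd_natAbs, h]
    exact_mod_cast dvd_pow_self r hk.ne'
  have hq3 : (2 * n + 1) % 3 ≠ 0 := by
    intro h3
    have := (Nat.prime_dvd_prime_iff_eq Nat.prime_three hq).1 (Nat.dvd_of_mod_eq_zero h3)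
    omega
  have hu : (r : ℤ) ∣ u := by
    by_contra hu
    refine oddPowCoeff_ne_zero hr (u := (u : ZMod r)) (v := (v : ZMod r)) ?_ ?_ ?_ n hq3 ?_
    · rwa [Ne, ZMod.intCast_zmod_eq_zero_iff_dvd]
    · rwa [Ne, ZMod.intCast_zmod_eq_zero_iff_dvd]
    · rwa [← Int.cast_add, Ne, ZMod.intCast_zmod_eq_zero_iff_dvd]
    · have := (oddPowCoeff_map (Int.castRingHom (ZMod r)) u v n).1
      simp only [eq_intCast] at this
      rwa [this, ZMod.intCast_zmod_eq_zero_iff_dvd]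
  have hrn : r = 2 * n + 1 := by
    have h1 := (Int.dvd_iff_dvd_of_dvd_sub (hu.trans (dvd_oddPowCoeff_sub u v n).1)).1 hdvd
    have hrp' := Nat.prime_iff_prime_int.1 hrp
    rcases hrp'.dvd_or_dvd h1 with h2 | h2
    · exact (Nat.prime_dvd_prime_iff_eq hrp hq).1 (by exact_mod_cast h2)
    · exact absurd (dvd_neg.1 (hrp'.dvd_of_dvd_pow h2)) hv
  suffices hk2 : k < 2 by
    obtain rfl : k = 1 := by omega
    rw [h, hrn, pow_one]
  by_contra! hk2
  have hdvd2 : (r : ℤ) ^ 2 ∣ (oddPowCoeff u v n).1 := by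
    rw [← Int.dvd_natAbs, h]
    exact_mod_cast pow_dvd_pow r hk2
  obtain ⟨t, ht⟩ := hdvd2
  obtain ⟨w, rfl⟩ := hu
  apply hv
  have hn : n = 1 ∨ n = 2 ∨ n = 3 := by
    simp only [List.mem_cons, List.not_mem_nil, or_false] at hr
    omega
  rcases hn with rfl | rfl | rfl
  · omega
  · norm_num at hrn
    subst hrn
    norm_num [oddPowCoeff] at ht
    exact (Nat.prime_iff_prime_int.1 hrp).dvd_of_dvd_pow (n := 2)
      ⟨t - w ^ 2 + 2 * w * v, by push_cast; linarith⟩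
  · norm_num at hrn
    subst hrn
    norm_num [oddPowCoeff] at ht
    exact (Nat.prime_iff_prime_int.1 hrp).dvd_of_dvd_pow (n := 3)
      ⟨-t + 7 * w ^ 3 - 21 * w ^ 2 * v + 5 * w * v ^ 2, by push_cast; linarith⟩

/-- The coprime pairs of bases between `2` and `10` without perfect powers, the even base first. -/
def evenOddPairs : List (ℕ × ℕ) := [(2, 3), (2, 5), (2, 7), (10, 3), (6, 5), (6, 7), (10, 7)]

theorem coprime_of_pow_add_pow_eq {a b c x y z : ℕ} (hab : a.Coprime b) (hx : 0 < x) (hy : 0 < y)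
    (hz : 0 < z) (h : a ^ x + b ^ y = c ^ z) : c.Coprime a ∧ c.Coprime b := by
  constructor
  · rw [← Nat.coprime_pow_left_iff hz, ← h, ← Nat.succ_pred_eq_of_pos hx, pow_succ',
      Nat.coprime_mul_left_add_left]
    exact hab.symm.pow_left y
  · rw [← Nat.coprime_pow_left_iff hz, ← h, ← Nat.succ_pred_eq_of_pos hy, pow_succ',
      Nat.coprime_add_mul_left_left]
    exact hab.pow_left x

theorem exists_pow_eq_mul_sq (a : ℤ) (x : ℕ) : ∃ d A : ℤ, (d = 1 ∨ d = a) ∧ a ^ x = d * A ^ 2 := by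
  rcases Nat.even_or_odd' x with ⟨k, rfl | rfl⟩
  · exact ⟨1, a ^ k, Or.inl rfl, by ring⟩
  · exact ⟨a, a ^ k, Or.inr rfl, by ring⟩

theorem evenOddPairs_spec {a b : ℕ} (hab : (a, b) ∈ evenOddPairs) :
    a.Coprime b ∧ 2 ∣ a ∧ Odd b ∧ 2 ≤ a ∧ a ≤ 10 ∧ 3 ≤ b ∧ b ≤ 7 := by
  simp only [evenOddPairs, List.mem_cons, Prod.mk.injEq, List.not_mem_nil, or_false] at hab
  rcases hab with ⟨rfl, rfl⟩ | ⟨rfl, rfl⟩ | ⟨rfl, rfl⟩ | ⟨rfl, rfl⟩ | ⟨rfl, rfl⟩ | ⟨rfl, rfl⟩ |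
    ⟨rfl, rfl⟩ <;> decide

theorem mem_formCoeffs {a b : ℕ} (hab : (a, b) ∈ evenOddPairs) {d e : ℤ} (hd : d = 1 ∨ d = a)
    (he : e = 1 ∨ e = b) : (d, e) ∈ formCoeffs := by
  simp only [evenOddPairs, List.mem_cons, Prod.mk.injEq, List.not_mem_nil, or_false] at hab
  rcases hab with ⟨rfl, rfl⟩ | ⟨rfl, rfl⟩ | ⟨rfl, rfl⟩ | ⟨rfl, rfl⟩ | ⟨rfl, rfl⟩ | ⟨rfl, rfl⟩ |
    ⟨rfl, rfl⟩ <;> rcases hd with rfl | rfl <;> rcases he with rfl | rfl <;> decide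

theorem exists_mul_oddPowCoeff_sq {a b c x y n : ℕ} (hab : (a, b) ∈ evenOddPairs) (hx : 0 < x)
    (hy : 0 < y) (h : a ^ x + b ^ y = c ^ (2 * n + 1)) : ∃ u v : ℤ, 0 < u ∧ 0 < v ∧ u + v = c ∧
      u * (oddPowCoeff u v n).1 ^ 2 = a ^ x ∧ v * (oddPowCoeff u v n).2 ^ 2 = b ^ y := by
  obtain ⟨hcop, h2a, -, ha2, -, hb3, -⟩ := evenOddPairs_spec hab
  obtain ⟨hca, hcb⟩ := coprime_of_pow_add_pow_eq hcop hx hy (by omega) h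
  have hc2 : IsCoprime (c : ℤ) 2 := Nat.isCoprime_iff_coprime.2 (hca.coprime_dvd_right h2a)
  have hca : IsCoprime (c : ℤ) a := Nat.isCoprime_iff_coprime.2 hca
  have hcb : IsCoprime (c : ℤ) b := Nat.isCoprime_iff_coprime.2 hcb
  have hc : (0 : ℤ) < c := by
    rcases Nat.eq_zero_or_pos c with rfl | hc
    · have := pow_pos (by omega : 0 < a) x
      rw [zero_pow (by omega)] at h
      omega
    · exact_mod_cast hc
  have ha0 : (0 : ℤ) < a := by omega
  have hb0 : (0 : ℤ) < b := by omega
  obtain ⟨d, A, hd, hA⟩ := exists_pow_eq_mul_sq (a : ℤ) x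
  obtain ⟨e, B, he, hB⟩ := exists_pow_eq_mul_sq (b : ℤ) y
  have hd0 : 0 < d := by omega
  have he0 : 0 < e := by omega
  have hcA : IsCoprime (c : ℤ) (d * A ^ 2) := hA ▸ hca.pow_right
  have hcB : IsCoprime (c : ℤ) (e * B ^ 2) := hB ▸ hcb.pow_right
  have hcd := hcA.of_mul_right_left
  have hce := hcB.of_mul_right_left
  have hcA := (IsCoprime.pow_right_iff two_pos).1 hcA.of_mul_right_right
  have hcB := (IsCoprime.pow_right_iff two_pos).1 hcB.of_mul_right_right
  have heq : d * A ^ 2 + e * B ^ 2 = (c : ℤ) ^ (2 * n + 1) := by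
    rw [← hA, ← hB]; exact_mod_cast h
  obtain ⟨r, s, hrs, hdvd⟩ := exists_eq_mul_sq_add_mul_sq (mem_formCoeffs hab hd he) hc
    ((hc2.mul_right hcd).mul_right hce) hcB heq
  have hpos : ∀ {t P N : ℤ} {k : ℕ}, 0 ≤ t → 0 < N → t * P ^ 2 = N ^ k → 0 < t :=
    fun {t P N k} ht hN hk => ht.lt_of_ne fun h0 => by
      have := pow_pos hN k
      rw [← hk, ← h0, zero_mul] at this
      exact lt_irrefl _ this
  obtain ⟨ε, hε, ⟨h1, h2⟩ | ⟨rfl, rfl, h1, h2⟩⟩ :=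
    eq_oddPowCoeff_of_dvd hc hd0 he0 hcd hce hrs n A B heq hcA hcB hdvd
  · have k1 : d * r ^ 2 * (oddPowCoeff (d * r ^ 2) (e * s ^ 2) n).1 ^ 2 = (a : ℤ) ^ x := by
      rw [hA, h1]; linear_combination -d * r ^ 2 * (oddPowCoeff (d * r ^ 2) (e * s ^ 2) n).1 ^ 2 * hε
    have k2 : e * s ^ 2 * (oddPowCoeff (d * r ^ 2) (e * s ^ 2) n).2 ^ 2 = (b : ℤ) ^ y := by
      rw [hB, h2]; linear_combination -e * s ^ 2 * (oddPowCoeff (d * r ^ 2) (e * s ^ 2) n).2 ^ 2 * hε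
    exact ⟨_, _, hpos (by positivity) ha0 k1, hpos (by positivity) hb0 k2, hrs.symm, k1, k2⟩
  · simp only [one_mul] at h1 h2 hA hB hrs
    have h1m : ((-1 : ℤ) ^ n) ^ 2 = 1 := by rw [← pow_mul, mul_comm, pow_mul]; norm_num
    obtain ⟨w1, w2⟩ := oddPowCoeff_swap (r ^ 2) (s ^ 2) n
    have k1 : s ^ 2 * (oddPowCoeff (s ^ 2) (r ^ 2) n).1 ^ 2 = (a : ℤ) ^ x := by
      rw [hA, h1, w1]
      linear_combination s ^ 2 * (oddPowCoeff (r ^ 2) (s ^ 2) n).2 ^ 2 * (h1m - hε)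
    have k2 : r ^ 2 * (oddPowCoeff (s ^ 2) (r ^ 2) n).2 ^ 2 = (b : ℤ) ^ y := by
      rw [hB, h2, w2]
      linear_combination r ^ 2 * (oddPowCoeff (r ^ 2) (s ^ 2) n).1 ^ 2 * (h1m - hε)
    exact ⟨_, _, hpos (by positivity) ha0 k1, hpos (by positivity) hb0 k2,
      by rw [hrs]; ring, k1, k2⟩

theorem evenOddPairs_primes {a b : ℕ} (hab : (a, b) ∈ evenOddPairs) : b ∈ [3, 5, 7] ∧
    (a = 2 ∨ ∃ r ∈ [3, 5, 7], a = 2 * r) := by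
  simp only [evenOddPairs, List.mem_cons, Prod.mk.injEq, List.not_mem_nil, or_false] at hab
  rcases hab with ⟨rfl, rfl⟩ | ⟨rfl, rfl⟩ | ⟨rfl, rfl⟩ | ⟨rfl, rfl⟩ | ⟨rfl, rfl⟩ | ⟨rfl, rfl⟩ |
    ⟨rfl, rfl⟩ <;> decide

theorem pow_add_pow_ne_pow_prime {a b c x y q : ℕ} (hab : (a, b) ∈ evenOddPairs) (hx : 0 < x)
    (hy : 0 < y) (hq : q.Prime) (hq5 : 5 ≤ q) : a ^ x + b ^ y ≠ c ^ q := by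
  intro h
  obtain ⟨hcop, h2a, hb, ha2, -, hb3, -⟩ := evenOddPairs_spec hab
  obtain ⟨n, rfl⟩ := hq.odd_of_ne_two (by omega)
  obtain ⟨hca, hcb⟩ := coprime_of_pow_add_pow_eq hcop hx hy (by omega) h
  have hc2 := hca.coprime_dvd_right h2a
  have hcodd : Odd c := Nat.coprime_two_right.1 hc2
  obtain ⟨u, v, hu, hv, huv, hP, hQ⟩ := exists_mul_oddPowCoeff_sq hab hx hy h
  have hodd : Odd (u + v) := by rw [huv]; exact_mod_cast hcodd
  obtain ⟨hPodd, -⟩ := odd_oddPowCoeff hodd n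
  have hPdvd : (oddPowCoeff u v n).1.natAbs ∣ a ^ x := by
    rw [← Int.natCast_dvd_natCast, Int.natAbs_dvd]
    push_cast
    rw [← hP, sq]
    exact (Dvd.intro _ rfl).mul_left u
  have hQdvd : (oddPowCoeff u v n).2.natAbs ∣ b ^ y := by
    rw [← Int.natCast_dvd_natCast, Int.natAbs_dvd]
    push_cast
    rw [← hQ, sq]
    exact (Dvd.intro _ rfl).mul_left v
  have hua : ∀ r : ℕ, r.Prime → (r : ℤ) ∣ u → r ∣ a := fun r hr hru => by
    refine hr.dvd_of_dvd_pow (n := x) ?_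
    rw [← Int.natCast_dvd_natCast]
    push_cast
    rw [← hP]
    exact hru.mul_right _
  have hvb : ∀ r : ℕ, r.Prime → (r : ℤ) ∣ v → r ∣ b := fun r hr hrv => by
    refine hr.dvd_of_dvd_pow (n := y) ?_
    rw [← Int.natCast_dvd_natCast]
    push_cast
    rw [← hQ]
    exact hrv.mul_right _
  obtain ⟨hb', ha'⟩ := evenOddPairs_primes hab
  have hprime : ∀ r ∈ [3, 5, 7], r.Prime := by decide
  have hP1 : (oddPowCoeff u v n).1.natAbs ≤ 2 * n + 1 := by
    have hP2 : (oddPowCoeff u v n).1.natAbs.Coprime (2 ^ x) :=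
      (Nat.coprime_two_right.2 (Int.natAbs_odd.2 hPodd)).pow_right x
    rcases ha' with rfl | ⟨r, hr, rfl⟩
    · rw [Nat.eq_one_of_dvd_coprimes hP2 (dvd_refl _) hPdvd]
      omega
    · rw [mul_pow] at hPdvd
      obtain ⟨k, -, hk⟩ := (Nat.dvd_prime_pow (hprime r hr)).1 (hP2.dvd_of_dvd_mul_left hPdvd)
      refine natAbs_oddPowCoeff_le hr hq hq5 (fun hrv => ?_) (fun hrc => ?_) hk
      · exact (hprime r hr).one_lt.ne' (Nat.eq_one_of_dvd_coprimes hcop (Dvd.intro_left 2 rfl)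
          (hvb r (hprime r hr) hrv))
      · rw [huv, Int.natCast_dvd_natCast] at hrc
        exact (hprime r hr).one_lt.ne' (Nat.eq_one_of_dvd_coprimes hca hrc (Dvd.intro_left 2 rfl))
  have hQ1 : (oddPowCoeff u v n).2.natAbs ≤ 2 * n + 1 := by
    have hsw : (oddPowCoeff u v n).2.natAbs = (oddPowCoeff v u n).1.natAbs := by
      rw [(oddPowCoeff_swap u v n).1, Int.natAbs_mul, Int.natAbs_pow]
      simp
    obtain ⟨k, -, hk⟩ := (Nat.dvd_prime_pow (hprime b hb')).1 hQdvd
    rw [hsw] at hk ⊢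
    refine natAbs_oddPowCoeff_le hb' hq hq5 (fun hbu => ?_) (fun hbc => ?_) hk
    · exact (hprime b hb').one_lt.ne'
        (Nat.eq_one_of_dvd_coprimes hcop (hua b (hprime b hb') hbu) (dvd_refl b))
    · rw [add_comm, huv, Int.natCast_dvd_natCast] at hbc
      exact (hprime b hb').one_lt.ne' (Nat.eq_one_of_dvd_coprimes hcb hbc (dvd_refl b))
  have hP' : (oddPowCoeff u v n).1 ^ 2 ≤ (2 * n + 1) ^ 2 := by
    rw [← Int.natAbs_sq]
    exact_mod_cast Nat.pow_le_pow_left hP1 2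
  have hQ' : (oddPowCoeff u v n).2 ^ 2 ≤ (2 * n + 1) ^ 2 := by
    rw [← Int.natAbs_sq]
    exact_mod_cast Nat.pow_le_pow_left hQ1 2
  have hle : (c : ℤ) * c ^ (2 * n) ≤ c * (2 * n + 1) ^ 2 := by
    have h' : (a : ℤ) ^ x + (b : ℤ) ^ y = c ^ (2 * n + 1) := by exact_mod_cast h
    rw [← pow_succ', ← h', ← hP, ← hQ, ← huv]
    nlinarith
  have hc3 : 3 ≤ c := by
    obtain ⟨t, rfl⟩ := hcodd
    omega
  have hle2 : c ^ (2 * n) ≤ (2 * n + 1) ^ 2 := by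
    have := le_of_mul_le_mul_left hle (by omega)
    exact_mod_cast this
  have h9 : (2 * n + 1) ^ 2 < 9 ^ n := by
    clear * - hq5
    induction n, (by omega : 2 ≤ n) using Nat.le_induction with
    | base => norm_num
    | succ n hn ih => rw [pow_succ 9]; nlinarith [ih (by omega)]
  have : 9 ^ n ≤ c ^ (2 * n) := by
    rw [pow_mul]
    exact Nat.pow_le_pow_left (by nlinarith) n
  omega

theorem exists_of_pow_add_pow_eq_cube {r b c x y : ℕ} (hab : (2 * r, b) ∈ evenOddPairs) (hx : 0 < x)
    (hy : 0 < y) (h : (2 * r) ^ x + b ^ y = c ^ 3) : ∃ (k j l : ℕ) (u ε δ : ℤ),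
      (ε = 1 ∨ ε = -1) ∧ (δ = 1 ∨ δ = -1) ∧ 0 < u ∧ u * r ^ (2 * k) = 2 ^ x * r ^ x ∧
      u - 3 * b ^ j = ε * r ^ k ∧ 3 * u - b ^ j = δ * b ^ l ∧ u + b ^ j = c ∧ y = j + 2 * l := by
  obtain ⟨hcop, h2a, hb, ha2, -, hb3, -⟩ := evenOddPairs_spec hab
  obtain ⟨hca, -⟩ := coprime_of_pow_add_pow_eq hcop hx hy (by omega) h
  have hcodd : Odd c := Nat.coprime_two_right.1 (hca.coprime_dvd_right h2a)
  obtain ⟨u, v, hu, hv, huv, hP, hQ⟩ := exists_mul_oddPowCoeff_sq (n := 1) hab hx hy h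
  simp only [oddPowCoeff, mul_one] at hP hQ
  obtain ⟨hb', ha'⟩ := evenOddPairs_primes hab
  have hprime : ∀ r ∈ [3, 5, 7], r.Prime := by decide
  have hbp := hprime b hb'
  have hr : r = 1 ∨ r.Prime := by
    rcases ha' with h2 | ⟨s, hs, hs'⟩
    · exact Or.inl (by omega)
    · exact Or.inr (by rw [Nat.eq_of_mul_eq_mul_left two_pos hs']; exact hprime s hs)
  have hpow : ∀ {p : ℕ} {t : ℤ} {n : ℕ}, (p = 1 ∨ p.Prime) → t.natAbs ∣ p ^ n →
      ∃ (ε : ℤ) (k : ℕ), (ε = 1 ∨ ε = -1) ∧ t = ε * p ^ k := by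
    intro p t n hp hdvd
    have : ∃ k, t.natAbs = p ^ k := by
      rcases hp with rfl | hp
      · exact ⟨0, by simpa using hdvd⟩
      · obtain ⟨k, -, hk⟩ := (Nat.dvd_prime_pow hp).1 hdvd
        exact ⟨k, hk⟩
    obtain ⟨k, hk⟩ := this
    rcases Int.natAbs_eq t with ht | ht <;> rw [hk] at ht
    · exact ⟨1, k, Or.inl rfl, by rw [ht]; simp⟩
    · exact ⟨-1, k, Or.inr rfl, by rw [ht]; simp⟩
  have hQdvd : (u - v + 2 * u).natAbs ∣ b ^ y := by
    rw [← Int.natCast_dvd_natCast, Int.natAbs_dvd]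
    push_cast
    rw [← hQ, sq]
    exact (Dvd.intro _ rfl).mul_left v
  have hvdvd : v.natAbs ∣ b ^ y := by
    rw [← Int.natCast_dvd_natCast, Int.natAbs_dvd]
    push_cast
    rw [← hQ]
    exact Dvd.intro _ rfl
  have hPdvd : (u - v - 2 * v).natAbs ∣ r ^ x := by
    have h1 : (u - v - 2 * v).natAbs ∣ 2 ^ x * r ^ x := by
      rw [← mul_pow, ← Int.natCast_dvd_natCast, Int.natAbs_dvd]
      push_cast at hP ⊢
      rw [← hP, sq]
      exact (Dvd.intro _ rfl).mul_left u
    refine Nat.Coprime.dvd_of_dvd_mul_left (Nat.Coprime.pow_right x ?_) h1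
    rw [Nat.coprime_two_right, Int.natAbs_odd]
    have : Odd (u + v) := by rw [huv]; exact_mod_cast hcodd
    grind
  obtain ⟨ε, k, hε, hk⟩ := hpow hr hPdvd
  obtain ⟨δ, l, hδ, hl⟩ := hpow (Or.inr hbp) hQdvd
  obtain ⟨j, -, hj⟩ := (Nat.dvd_prime_pow hbp).1 hvdvd
  have hj' : v = (b : ℤ) ^ j := by
    rw [← Int.natAbs_of_nonneg hv.le, hj]; push_cast; rfl
  subst hj'
  have hε2 : ε ^ 2 = 1 := by rcases hε with rfl | rfl <;> norm_num
  have hδ2 : δ ^ 2 = 1 := by rcases hδ with rfl | rfl <;> norm_num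
  refine ⟨k, j, l, u, ε, δ, hε, hδ, hu, ?_, by linear_combination hk, by linear_combination hl, huv,
    ?_⟩
  · rw [hk] at hP
    push_cast at hP
    rw [mul_pow] at hP
    linear_combination hP - u * r ^ (2 * k) * hε2
  · rw [hl] at hQ
    have : (b : ℤ) ^ (j + 2 * l) = b ^ y := by linear_combination hQ - b ^ (j + 2 * l) * hδ2
    exact (Nat.pow_right_injective hbp.two_le (by exact_mod_cast this)).symm

theorem three_pow_dichotomy (j : ℕ) : (3 : ℤ) ^ j = 1 ∨ (3 : ℤ) ^ j = 3 ∨ (9 : ℤ) ∣ 3 ^ j := by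
  rcases j with _ | _ | j
  · simp
  · simp
  · exact Or.inr (Or.inr ⟨3 ^ j, by ring⟩)

theorem pow_eq_one_or_dvd (p : ℤ) (j : ℕ) : p ^ j = 1 ∨ p ∣ p ^ j := by
  rcases j with _ | j
  · simp
  · exact Or.inr (dvd_pow_self p j.succ_ne_zero)

theorem two_pow_add_pow_eq_cube {b c x y : ℕ} (hb : b ∈ [3, 5, 7]) (hx : 0 < x)
    (hy : 0 < y) (h : 2 ^ x + b ^ y = c ^ 3) : b = 5 ∧ c = 3 ∧ x = 1 ∧ y = 2 := by
  have hab : (2 * 1, b) ∈ evenOddPairs := by fin_cases hb <;> decide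
  obtain ⟨k, j, l, u, ε, δ, hε, hδ, hu, h1, h2, h3, h4, h5⟩ :=
    exists_of_pow_add_pow_eq_cube hab hx hy h
  simp only [Nat.cast_one, one_pow, mul_one] at h1 h2
  have hv : (0 : ℤ) < b ^ j := by fin_cases hb <;> positivity
  have hw : (0 : ℤ) < b ^ l := by fin_cases hb <;> positivity
  obtain rfl : δ = 1 := by
    rcases hδ with rfl | rfl
    · rfl
    · exfalso; rcases hε with rfl | rfl <;> linarith
  rw [one_mul] at h3
  have hQ : (b : ℤ) ^ l = 8 * b ^ j + 3 * ε := by linarith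
  have h2u : (2 : ℤ) ∣ u := h1 ▸ dvd_pow_self 2 hx.ne'
  fin_cases hb
  · exfalso
    simp only [Nat.cast_ofNat] at *
    have h16 : (2 : ℤ) ^ x = 2 ∨ (2 : ℤ) ^ x = 4 ∨ (2 : ℤ) ^ x = 8 ∨ (16 : ℤ) ∣ 2 ^ x := by
      rcases x with _ | _ | _ | _ | x
      · exact absurd hx (lt_irrefl 0)
      · simp
      · simp
      · simp
      · exact Or.inr (Or.inr (Or.inr ⟨2 ^ x, by ring⟩))
    rcases three_pow_dichotomy j with hj | hj | hj <;> rcases three_pow_dichotomy l with hl | hl | hl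
      <;> omega
  · simp only [Nat.cast_ofNat] at *
    have key : (5 : ℤ) ^ j = 1 ∧ (5 : ℤ) ^ l = 5 ∧ (2 : ℤ) ^ x = 2 ^ 1 ∧ (c : ℤ) = 3 := by
      rcases pow_eq_one_or_dvd 5 j with hj | hj <;> rcases pow_eq_one_or_dvd 5 l with hl | hl <;>
        omega
    obtain ⟨k1, k2, k3, k4⟩ := key
    have hj0 : j = 0 := Nat.pow_right_injective (by norm_num : 2 ≤ 5)
      (by simpa using (by exact_mod_cast k1 : 5 ^ j = 1))
    have hl1 : l = 1 := Nat.pow_right_injective (by norm_num : 2 ≤ 5)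
      (by simpa using (by exact_mod_cast k2 : 5 ^ l = 5))
    have hx1 : x = 1 := Nat.pow_right_injective (le_refl 2) (by exact_mod_cast k3)
    exact ⟨trivial, by exact_mod_cast k4, hx1, by omega⟩
  · exfalso
    simp only [Nat.cast_ofNat] at *
    rcases pow_eq_one_or_dvd 7 j with hj | hj <;> rcases pow_eq_one_or_dvd 7 l with hl | hl <;>
      omega

theorem eq_two_pow_of_not_dvd {r m x : ℕ} {u : ℤ} (hr : r.Prime) (hr2 : r ≠ 2)
    (hu : ¬ (r : ℤ) ∣ u) (h : u * r ^ m = 2 ^ x * r ^ x) : x = m ∧ u = 2 ^ x := by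
  have hr0 : (r : ℤ) ≠ 0 := by exact_mod_cast hr.ne_zero
  have hrp := Nat.prime_iff_prime_int.1 hr
  rcases lt_trichotomy x m with hxm | rfl | hxm
  · exfalso
    obtain ⟨t, rfl⟩ := Nat.exists_eq_add_of_lt hxm
    have : u * r ^ t * r = 2 ^ x := by
      apply mul_right_cancel₀ (pow_ne_zero x hr0)
      linear_combination h
    have h2 := hrp.dvd_of_dvd_pow (this ▸ Dvd.intro_left _ rfl : (r : ℤ) ∣ 2 ^ x)
    exact hr2 ((Nat.prime_dvd_prime_iff_eq hr Nat.prime_two).1 (by exact_mod_cast h2))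
  · exact ⟨rfl, mul_right_cancel₀ (pow_ne_zero x hr0) h⟩
  · exfalso
    obtain ⟨t, rfl⟩ := Nat.exists_eq_add_of_lt hxm
    refine hu (Dvd.intro_left (2 ^ (m + t + 1) * r ^ t) ?_)
    apply mul_right_cancel₀ (pow_ne_zero m hr0)
    linear_combination -h

theorem six_pow_add_pow_ne_cube {b c x y : ℕ} (hb : b ∈ [5, 7]) (hx : 0 < x) (hy : 0 < y) :
    6 ^ x + b ^ y ≠ c ^ 3 := by
  intro h
  have hab : (2 * 3, b) ∈ evenOddPairs := by fin_cases hb <;> decide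
  obtain ⟨k, j, l, u, ε, δ, hε, hδ, hu, h1, h2, h3, -, -⟩ :=
    exists_of_pow_add_pow_eq_cube hab hx hy h
  push_cast at h1 h2
  have hV : (0 : ℤ) < b ^ j := by fin_cases hb <;> positivity
  have hW : (0 : ℤ) < b ^ l := by fin_cases hb <;> positivity
  have h3x : (3 : ℤ) ∣ 3 ^ x := dvd_pow_self 3 hx.ne'
  rcases Nat.eq_zero_or_pos k with rfl | hk
  · rw [mul_zero, pow_zero, mul_one] at h1
    have : (3 : ℤ) ∣ u := h1 ▸ h3x.mul_left _
    omega
  obtain ⟨k, rfl⟩ : ∃ t, k = t + 1 := ⟨k - 1, by omega⟩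
  obtain ⟨u, rfl⟩ : (3 : ℤ) ∣ u := ⟨b ^ j + ε * 3 ^ k, by linear_combination h2⟩
  have h2' : u - b ^ j = ε * 3 ^ k := by
    apply mul_left_cancel₀ (three_ne_zero' ℤ)
    linear_combination h2
  have hbu : ¬ (b : ℤ) ∣ u := by
    intro hbu
    have h4 : (b : ℤ) ∣ 6 ^ x := by
      rw [(by norm_num : (6 : ℤ) = 2 * 3), mul_pow, ← h1]
      exact (hbu.mul_left 3).mul_right _
    have hbp : Prime (b : ℤ) := by
      rw [← Nat.prime_iff_prime_int]
      fin_cases hb <;> norm_num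
    have := hbp.dvd_of_dvd_pow h4
    fin_cases hb <;> omega
  rcases pow_eq_one_or_dvd (b : ℤ) j with hj | hj
  · have hδ1 : δ = 1 := by
      rcases hδ with rfl | rfl
      · rfl
      · omega
    subst hδ1
    rcases Nat.lt_or_ge x 2 with hx2 | hx2
    · obtain rfl : x = 1 := by omega
      have : (9 : ℤ) ∣ 6 := ⟨u * 3 * 9 ^ k, by
        rw [(by norm_num : (9 : ℤ) = 3 ^ 2), ← pow_mul]; linear_combination -h1⟩
      omega
    · have h4u : (4 : ℤ) ∣ 3 * u := by
        have h4 : (4 : ℤ) ∣ 3 * u * 3 ^ (2 * (k + 1)) := by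
          rw [h1]
          exact (pow_dvd_pow (2 : ℤ) hx2).mul_right _
        refine IsCoprime.dvd_of_dvd_mul_right (IsCoprime.pow_right ?_) h4
        rw [Int.isCoprime_iff_gcd_eq_one]; norm_num
      fin_cases hb
      · have : (5 : ℤ) ^ l ≡ 1 ^ l [ZMOD 4] := Int.ModEq.pow l (by decide)
        simp only [Nat.cast_ofNat] at *
        rw [one_pow, Int.ModEq] at this
        omega
      · have : (7 : ℤ) ^ l ≡ 1 ^ l [ZMOD 3] := Int.ModEq.pow l (by decide)
        simp only [Nat.cast_ofNat] at *
        rw [one_pow, Int.ModEq] at this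
        omega
  · rcases pow_eq_one_or_dvd (b : ℤ) l with hl | hl
    · rw [hl] at h3
      have hε1 : ε = -1 := by
        rcases hε with rfl | rfl
        · have := pow_pos (three_pos : (0 : ℤ) < 3) k
          omega
        · rfl
      subst hε1
      have hk' : (3 : ℤ) ^ k = 8 * u - δ := by linarith
      have h3u : ¬ ((3 : ℕ) : ℤ) ∣ u := by
        rcases pow_eq_one_or_dvd (3 : ℤ) k with hk0 | hk0
        · omega
        · push_cast
          omega
      obtain ⟨rfl, rfl⟩ := eq_two_pow_of_not_dvd (m := 2 * k + 3) Nat.prime_three (by norm_num) h3u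
        (x := x) (by push_cast; linear_combination h1)
      have : (3 : ℤ) ^ k ≤ 4 ^ k := pow_le_pow_left₀ (by norm_num) (by norm_num) k
      rw [pow_add, pow_mul] at hk'
      norm_num at hk'
      have := pow_pos (four_pos : (0 : ℤ) < 4) k
      omega
    · have : (b : ℤ) ∣ 9 * u := by
        have : 9 * u = b ^ j + δ * b ^ l := by linarith
        rw [this]
        exact dvd_add hj (hl.mul_left δ)
      refine hbu (IsCoprime.dvd_of_dvd_mul_left ?_ this)
      fin_cases hb <;> rw [Int.isCoprime_iff_gcd_eq_one] <;> rfl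

theorem five_pow_mod_eight (k : ℕ) : (5 : ℤ) ^ k % 8 = 1 ∨ (5 : ℤ) ^ k % 8 = 5 := by
  induction k with
  | zero => simp
  | succ k ih => rw [pow_succ]; omega

theorem ten_pow_add_seven_pow_ne_cube {c x y : ℕ} (hx : 0 < x) (hy : 0 < y) :
    10 ^ x + 7 ^ y ≠ c ^ 3 := by
  intro h
  obtain ⟨k, j, l, u, ε, δ, hε, hδ, hu, h1, h2, h3, -, -⟩ :=
    exists_of_pow_add_pow_eq_cube (r := 5) (by decide) hx hy h
  push_cast at h1 h2 h3
  rw [← mul_pow, pow_mul] at h1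
  norm_num at h1
  have hu3 : u % 3 = 1 := by
    have e1 : (25 : ℤ) ^ k ≡ 1 ^ k [ZMOD 3] := Int.ModEq.pow k (by decide)
    have e2 : (10 : ℤ) ^ x ≡ 1 ^ x [ZMOD 3] := Int.ModEq.pow x (by decide)
    rw [one_pow] at e1 e2
    have e3 := e1.mul_left u
    rw [h1, mul_one] at e3
    exact e3.symm.trans e2
  have hu7 : ¬ (7 : ℤ) ∣ u := by
    intro h7
    have := (by norm_num : Prime (7 : ℤ)).dvd_of_dvd_pow (h1 ▸ h7.mul_right _ : (7 : ℤ) ∣ 10 ^ x)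
    omega
  have m1 : (7 : ℤ) ^ j ≡ 1 ^ j [ZMOD 3] := Int.ModEq.pow j (by decide)
  have m2 : (7 : ℤ) ^ l ≡ 1 ^ l [ZMOD 3] := Int.ModEq.pow l (by decide)
  rw [one_pow, Int.ModEq] at m1 m2
  have p1 := pow_pos (by norm_num : (0 : ℤ) < 7) j
  have p2 := pow_pos (by norm_num : (0 : ℤ) < 7) l
  have p3 := five_pow_mod_eight k
  have p4 := pow_pos (by norm_num : (0 : ℤ) < 5) k
  rcases pow_eq_one_or_dvd 7 j with hj | hj <;> rcases pow_eq_one_or_dvd 7 l with hl | hl <;>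
    rcases hδ with rfl | rfl <;> rcases hε with rfl | rfl <;> omega

theorem ten_pow_add_three_pow_eq_cube {c x y : ℕ} (hx : 0 < x) (hy : 0 < y)
    (h : 10 ^ x + 3 ^ y = c ^ 3) : c = 13 ∨ (c = 7 ∧ x = 2 ∧ y = 5) := by
  obtain ⟨k, j, l, u, ε, δ, hε, hδ, hu, h1, h2, h3, h4, h5⟩ :=
    exists_of_pow_add_pow_eq_cube (r := 5) (by decide) hx hy h
  push_cast at h1 h2 h3 h4
  have p6 := pow_pos (by norm_num : (0 : ℤ) < 3) j
  have p7 := pow_pos (by norm_num : (0 : ℤ) < 3) l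
  rcases Nat.eq_zero_or_pos k with rfl | hk
  · left
    rw [pow_zero, mul_one] at h2
    rcases three_pow_dichotomy j with hj | hj | hj <;> rcases three_pow_dichotomy l with hl | hl | hl
      <;> rcases hδ with rfl | rfl <;> omega
  · right
    have p4 : (5 : ℤ) ∣ 5 ^ k := dvd_pow_self 5 hk.ne'
    have h5u : ¬ ((5 : ℕ) : ℤ) ∣ u := by
      intro h5u
      push_cast at h5u
      have : (5 : ℤ) ∣ 3 ^ (j + 1) := by
        rw [(by linear_combination -h2 : (3 : ℤ) ^ (j + 1) = u - ε * 5 ^ k)]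
        exact dvd_sub h5u (p4.mul_left _)
      have := (by norm_num : Prime (5 : ℤ)).dvd_of_dvd_pow this
      omega
    obtain ⟨rfl, rfl⟩ := eq_two_pow_of_not_dvd Nat.prime_five (by norm_num) h5u h1
    rw [pow_mul, (by norm_num : (2 : ℤ) ^ 2 = 4)] at h2 h3 h4
    have m1 : (4 : ℤ) ^ k ≡ 1 ^ k [ZMOD 3] := Int.ModEq.pow k (by decide)
    rw [one_pow, Int.ModEq] at m1
    have hlt : (4 : ℤ) ^ k < 5 ^ k := pow_lt_pow_left₀ (by norm_num) (by norm_num) hk.ne'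
    have p1 := pow_pos (by norm_num : (0 : ℤ) < 4) k
    have p3 := five_pow_mod_eight k
    have p5 := dvd_pow_self (4 : ℤ) hk.ne'
    have key : (4 : ℤ) ^ k = 4 ∧ (3 : ℤ) ^ j = 3 ∧ (3 : ℤ) ^ l = 9 := by
      rcases three_pow_dichotomy j with hj | hj | hj <;>
        rcases three_pow_dichotomy l with hl | hl | hl <;>
        rcases hδ with rfl | rfl <;> rcases hε with rfl | rfl <;> omega
    obtain ⟨k1, k2, k3⟩ := key
    have e1 : k = 1 := Nat.pow_right_injective (by norm_num : 2 ≤ 4)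
      (by simpa using (by exact_mod_cast k1 : 4 ^ k = 4))
    have e2 : j = 1 := Nat.pow_right_injective (by norm_num : 2 ≤ 3)
      (by simpa using (by exact_mod_cast k2 : 3 ^ j = 3))
    have e3 : l = 2 := Nat.pow_right_injective (by norm_num : 2 ≤ 3)
      (by simpa using (by exact_mod_cast k3 : 3 ^ l = 9))
    refine ⟨?_, by omega, by omega⟩
    have : (c : ℤ) = 7 := by omega
    exact_mod_cast this

theorem even_of_pow_add_pow_eq_sq {p a b w x y : ℕ} (hp : p.Prime) (ha : ¬ IsSquare (a : ZMod p))
    (hb : p ∣ b) (hy : 0 < y) (h : a ^ x + b ^ y = w ^ 2) : Even x := by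
  have := Fact.mk hp
  by_contra hx
  obtain ⟨k, rfl⟩ := Nat.not_even_iff_odd.1 hx
  have h' : (a : ZMod p) ^ (2 * k + 1) + (b : ZMod p) ^ y = (w : ZMod p) ^ 2 := by
    have := congrArg (Nat.cast : ℕ → ZMod p) h
    push_cast at this
    exact this
  rw [(ZMod.natCast_eq_zero_iff b p).2 hb, zero_pow hy.ne', add_zero] at h'
  have ha0 : (a : ZMod p) ≠ 0 := fun h0 => ha (h0 ▸ IsSquare.zero)
  refine ha ⟨w / a ^ k, ?_⟩
  field_simp
  linear_combination h'

theorem eq_of_sq_eq_sq_add_prime_pow {p m w y : ℕ} (hp : p.Prime) (hm : ¬ p ∣ 2 * m)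
    (h : w ^ 2 = m ^ 2 + p ^ y) : w = m + 1 ∧ p ^ y = 2 * m + 1 := by
  have hlt : m < w := lt_of_pow_lt_pow_left₀ 2 (Nat.zero_le w) (by
    have := pow_pos hp.pos y
    omega)
  obtain ⟨t, rfl⟩ := Nat.exists_eq_add_of_lt hlt
  have hfac : (t + 1) * (2 * m + t + 1) = p ^ y := by
    have : (t + 1) * (2 * m + t + 1) + m ^ 2 = m ^ 2 + p ^ y := by rw [← h]; ring
    omega
  obtain ⟨i, -, hi⟩ := (Nat.dvd_prime_pow hp).1 (Dvd.intro _ hfac)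
  obtain ⟨j, -, hj⟩ := (Nat.dvd_prime_pow hp).1 (Dvd.intro_left _ hfac)
  have hi0 : i = 0 := by
    by_contra hi0
    have hj0 : j ≠ 0 := by
      rintro rfl
      rw [pow_zero] at hj
      have := hp.one_lt.trans_le (Nat.le_of_dvd (by omega) (dvd_pow_self p hi0))
      omega
    apply hm
    rw [(by omega : 2 * m = 2 * m + t + 1 - (t + 1)), hi, hj]
    exact Nat.dvd_sub (dvd_pow_self p hj0) (dvd_pow_self p hi0)
  subst hi0
  rw [pow_zero] at hi
  obtain rfl : t = 0 := by omega
  exact ⟨rfl, by linarith⟩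

theorem eq_of_base_pow_add_prime_pow_eq_sq {a b w x y : ℕ} (hb : b.Prime) (hb2 : b ≠ 2)
    (ha : ¬ IsSquare (a : ZMod b)) (hy : 0 < y) (h : a ^ x + b ^ y = w ^ 2) :
    ∃ k, x = 2 * k ∧ w = a ^ k + 1 ∧ b ^ y = 2 * a ^ k + 1 := by
  obtain ⟨k, hk⟩ := even_of_pow_add_pow_eq_sq hb ha (dvd_refl b) hy h
  obtain rfl : x = 2 * k := by omega
  refine ⟨k, rfl, eq_of_sq_eq_sq_add_prime_pow hb ?_ (by rw [← h, ← pow_mul, mul_comm])⟩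
  intro hdvd
  rcases hb.dvd_mul.1 hdvd with h2 | h2
  · exact hb2 ((Nat.prime_dvd_prime_iff_eq hb Nat.prime_two).1 h2)
  · refine ha ?_
    rw [(ZMod.natCast_eq_zero_iff a b).2 (hb.dvd_of_dvd_pow h2)]
    exact IsSquare.zero

theorem two_pow_add_three_pow_eq_sq {w x y : ℕ} (hx : 0 < x) (hy : 0 < y)
    (h : 2 ^ x + 3 ^ y = w ^ 2) : w = 5 := by
  obtain ⟨k, rfl, rfl, hk⟩ := eq_of_base_pow_add_prime_pow_eq_sq Nat.prime_three (by norm_num)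
    (by decide) hy h
  have h3 : 3 ∣ 3 ^ y := dvd_pow_self 3 hy.ne'
  rcases k with _ | _ | _ | k
  · omega
  · omega
  · rfl
  · exfalso
    have h80 : 3 ^ y % 80 = 3 ^ (y % 4) % 80 := by
      conv_lhs => rw [← Nat.div_add_mod y 4, pow_add, pow_mul, Nat.mul_mod, Nat.pow_mod]
      simp
    have h5 : 2 * 2 ^ (k + 1 + 1 + 1) % 5 ≠ 0 := by
      rw [← pow_succ', Ne, ← Nat.dvd_iff_mod_eq_zero]
      intro h5
      exact absurd (Nat.prime_five.dvd_of_dvd_pow h5) (by norm_num)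
    have h16 : 16 ∣ 2 * 2 ^ (k + 1 + 1 + 1) := ⟨2 ^ k, by ring⟩
    have : y % 4 < 4 := Nat.mod_lt _ (by norm_num)
    interval_cases y % 4 <;> omega

theorem two_pow_add_five_pow_eq_sq {w x y : ℕ} (hx : 0 < x) (hy : 0 < y)
    (h : 2 ^ x + 5 ^ y = w ^ 2) : w = 3 := by
  obtain ⟨k, rfl, rfl, hk⟩ := eq_of_base_pow_add_prime_pow_eq_sq Nat.prime_five (by norm_num)
    (by decide) hy h
  rcases k with _ | _ | k
  · omega
  · rfl
  · exfalso
    have h24 : 5 ^ y % 24 = 5 ^ (y % 2) % 24 := by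
      conv_lhs => rw [← Nat.div_add_mod y 2, pow_add, pow_mul, Nat.mul_mod, Nat.pow_mod]
      simp
    have h3 : 2 * 2 ^ (k + 1 + 1) % 3 ≠ 0 := by
      rw [← pow_succ', Ne, ← Nat.dvd_iff_mod_eq_zero]
      intro h3
      exact absurd (Nat.prime_three.dvd_of_dvd_pow h3) (by norm_num)
    have h8 : 8 ∣ 2 * 2 ^ (k + 1 + 1) := ⟨2 ^ k, by ring⟩
    have : y % 2 < 2 := Nat.mod_lt _ (by norm_num)
    interval_cases y % 2 <;> omega

theorem six_pow_add_seven_pow_ne_sq {w x y : ℕ} (hy : 0 < y) : 6 ^ x + 7 ^ y ≠ w ^ 2 := by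
  intro h
  obtain ⟨k, rfl, rfl, hk⟩ := eq_of_base_pow_add_prime_pow_eq_sq (by norm_num : Nat.Prime 7)
    (by norm_num) (by decide) hy h
  have h6 : 6 ^ k % 7 = 6 ^ (k % 2) % 7 := by
    conv_lhs => rw [← Nat.div_add_mod k 2, pow_add, pow_mul, Nat.mul_mod, Nat.pow_mod]
    simp
  have h7 : 7 ∣ 7 ^ y := dvd_pow_self 7 hy.ne'
  have : k % 2 < 2 := Nat.mod_lt _ (by norm_num)
  interval_cases k % 2 <;> omega

theorem ten_pow_add_seven_pow_ne_sq {w x y : ℕ} (hy : 0 < y) : 10 ^ x + 7 ^ y ≠ w ^ 2 := by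
  intro h
  obtain ⟨k, rfl, rfl, hk⟩ := eq_of_base_pow_add_prime_pow_eq_sq (by norm_num : Nat.Prime 7)
    (by norm_num) (by decide) hy h
  have h10 : 10 ^ k % 3 = 1 := by rw [Nat.pow_mod]; simp
  have h7 : 7 ^ y % 3 = 1 := by rw [Nat.pow_mod]; simp
  omega

theorem eq_of_two_mul_pow_add_pow_eq_sq {r b w x l : ℕ} (hrb : (r, b) ∈ [(3, 5), (5, 3)])
    (h : (2 * r) ^ x + b ^ (2 * l) = w ^ 2) (hx : 3 ≤ x) :
    (w = b ^ l + 2 ∧ b ^ l + 1 = 2 ^ (x - 2) * r ^ x) ∨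
      (w = 2 ^ (x - 2) + r ^ x ∧ b ^ l + 2 ^ (x - 2) = r ^ x) := by
  have hb : Odd (b ^ l) := Odd.pow (by fin_cases hrb <;> decide)
  have hrp : r.Prime ∧ b.Prime ∧ r ≠ b ∧ b ≠ 2 ∧ r ≠ 2 ∧ 2 ≤ r := by fin_cases hrb <;> norm_num
  obtain ⟨hrp, hbp, hrb', hb2, hr2, hr2'⟩ := hrp
  obtain ⟨x, rfl⟩ := Nat.exists_eq_add_of_le' hx
  have hlt : b ^ l < w := lt_of_pow_lt_pow_left₀ 2 (Nat.zero_le w) (by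
    rw [← h, ← pow_mul, mul_comm l]
    have := pow_pos (by omega : 0 < 2 * r) (x + 3)
    omega)
  have hw : Odd w := by
    have h1 : Odd (w ^ 2) := by
      rw [← h, mul_comm 2 l, pow_mul, pow_succ]
      exact Even.add_odd ((even_two.mul_right r).mul_left _) hb.pow
    exact Nat.odd_pow_iff two_ne_zero |>.1 h1
  obtain ⟨S, hS⟩ : ∃ S, w = b ^ l + 2 * S := ⟨(w - b ^ l) / 2, by grind⟩
  subst hS
  have hfac : S * (S + b ^ l) = 2 ^ (x + 1) * r ^ (x + 3) := by
    have : 4 * (S * (S + b ^ l)) = 4 * (2 ^ (x + 1) * r ^ (x + 3)) := by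
      rw [mul_comm 2 l, pow_mul, mul_pow] at h
      have e : 2 ^ (x + 3) * r ^ (x + 3) = 4 * (2 ^ (x + 1) * r ^ (x + 3)) := by ring
      nlinarith
    omega
  have hSb : S.Coprime (b ^ l) := by
    refine Nat.Coprime.pow_right l (Nat.Coprime.symm ((Nat.Prime.coprime_iff_not_dvd hbp).2 ?_))
    intro hbS
    have := (hbS.mul_right (S + b ^ l))
    rw [hfac, hbp.dvd_mul] at this
    rcases this with h1 | h1
    · exact hb2 ((Nat.prime_dvd_prime_iff_eq hbp Nat.prime_two).1 (hbp.dvd_of_dvd_pow h1))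
    · exact hrb' ((Nat.prime_dvd_prime_iff_eq hbp hrp).1 (hbp.dvd_of_dvd_pow h1)).symm
  have hST : S.Coprime (S + b ^ l) := by simpa using hSb
  have hb1 : 0 < b ^ l := pow_pos hbp.pos l
  have hP : 0 < 2 ^ (x + 1) * r ^ (x + 3) := by positivity
  have h2r : (2 ^ (x + 1)).Coprime (r ^ (x + 3)) :=
    Nat.Coprime.pow _ _ ((Nat.coprime_primes Nat.prime_two hrp).2 hr2.symm)
  have h2 := (hST.isPrimePow_dvd_mul (Nat.prime_two.isPrimePow.pow (by omega : x + 1 ≠ 0))).1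
    (hfac ▸ Dvd.intro _ rfl)
  have h3 := (hST.isPrimePow_dvd_mul (hrp.isPrimePow.pow (by omega : x + 3 ≠ 0))).1
    (hfac ▸ Dvd.intro_left _ rfl)
  have hS0 : 0 < S := Nat.pos_of_ne_zero (by rintro rfl; omega)
  have hsub : x + 3 - 2 = x + 1 := rfl
  rw [hsub]
  rcases h2 with h2 | h2 <;> rcases h3 with h3 | h3
  · have := Nat.le_of_dvd hS0 (h2r.mul_dvd_of_dvd_of_dvd h2 h3)
    nlinarith
  · right
    obtain ⟨s, hs⟩ := h2
    obtain ⟨t, ht⟩ := h3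
    have hst : s * t = 1 := by
      apply Nat.eq_of_mul_eq_mul_left hP
      rw [ht, hs] at hfac
      linarith
    obtain ⟨rfl, rfl⟩ := mul_eq_one.1 hst
    omega
  · exfalso
    have h4 := Nat.le_of_dvd hS0 h3
    obtain ⟨s, hs⟩ := h3
    obtain ⟨t, ht⟩ := h2
    have hst : s * t = 1 := by
      apply Nat.eq_of_mul_eq_mul_left hP
      rw [ht, hs] at hfac
      linarith
    obtain ⟨rfl, rfl⟩ := mul_eq_one.1 hst
    have : 2 ^ (x + 1) ≤ r ^ (x + 3) :=
      (Nat.pow_le_pow_left hr2' _).trans (Nat.pow_le_pow_right hrp.pos (by omega))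
    omega
  · left
    have := Nat.le_of_dvd (by omega) (h2r.mul_dvd_of_dvd_of_dvd h2 h3)
    have hS1 : S = 1 := by
      by_contra hS1
      have : 2 * (S + b ^ l) ≤ S * (S + b ^ l) := Nat.mul_le_mul_right _ (by omega)
      omega
    subst hS1
    omega

theorem five_pow_add_one_ne {x l : ℕ} (hx : 3 ≤ x) : 5 ^ l + 1 ≠ 2 ^ (x - 2) * 3 ^ x := by
  obtain ⟨x, rfl⟩ := Nat.exists_eq_add_of_le' hx
  intro h
  have h5 : 5 ^ l % 4 = 1 := by rw [Nat.pow_mod]; simp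
  rcases x with _ | x
  · have h63 : 5 ^ l % 63 = 5 ^ (l % 6) % 63 := by
      conv_lhs => rw [← Nat.div_add_mod l 6, pow_add, pow_mul, Nat.mul_mod, Nat.pow_mod]
      simp
    have : l % 6 < 6 := Nat.mod_lt _ (by norm_num)
    norm_num at h
    interval_cases l % 6 <;> omega
  · have : 4 ∣ 2 ^ (x + 1 + 3 - 2) * 3 ^ (x + 1 + 3) :=
      (Dvd.intro (2 ^ x) (by rw [(by omega : x + 1 + 3 - 2 = x + 2)]; ring)).mul_right _
    omega

theorem three_pow_add_one_ne {x l : ℕ} (hx : 3 ≤ x) : 3 ^ l + 1 ≠ 2 ^ (x - 2) * 5 ^ x := by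
  obtain ⟨x, rfl⟩ := Nat.exists_eq_add_of_le' hx
  intro h
  rcases x with _ | x
  · have h26 : 3 ^ l % 26 = 3 ^ (l % 3) % 26 := by
      conv_lhs => rw [← Nat.div_add_mod l 3, pow_add, pow_mul, Nat.mul_mod, Nat.pow_mod]
      simp
    have : l % 3 < 3 := Nat.mod_lt _ (by norm_num)
    norm_num at h
    interval_cases l % 3 <;> omega
  · have h20 : 3 ^ l % 20 = 3 ^ (l % 4) % 20 := by
      conv_lhs => rw [← Nat.div_add_mod l 4, pow_add, pow_mul, Nat.mul_mod, Nat.pow_mod]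
      simp
    have : l % 4 < 4 := Nat.mod_lt _ (by norm_num)
    have : 20 ∣ 2 ^ (x + 1 + 3 - 2) * 5 ^ (x + 1 + 3) :=
      ⟨2 ^ x * 5 ^ (x + 3), by rw [(by omega : x + 1 + 3 - 2 = x + 2)]; ring⟩
    interval_cases l % 4 <;> omega

theorem sq_mod_eight (w : ℕ) : w ^ 2 % 8 = 0 ∨ w ^ 2 % 8 = 1 ∨ w ^ 2 % 8 = 4 := by
  have : w % 8 < 8 := Nat.mod_lt _ (by norm_num)
  rw [Nat.pow_mod]
  interval_cases w % 8 <;> simp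

theorem pow_add_two_pow_ne_pow_of_even {r b l t : ℕ} (hb : b.Prime) (hb2 : b ≠ 2) (hr : 3 ≤ r)
    (ht : 2 ≤ t) : b ^ l + 2 ^ (2 * t - 2) ≠ r ^ (2 * t) := by
  obtain ⟨t, rfl⟩ : ∃ s, t = s + 1 := ⟨t - 1, by omega⟩
  intro h
  have h' : (r ^ (t + 1)) ^ 2 = (2 ^ t) ^ 2 + b ^ l := by
    rw [← pow_mul, mul_comm _ 2, ← h, ← pow_mul, add_comm, mul_comm t]
    rfl
  have h1 := (eq_of_sq_eq_sq_add_prime_pow hb (fun h2 => hb2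
    ((Nat.prime_dvd_prime_iff_eq hb Nat.prime_two).1
      (hb.dvd_of_dvd_pow (n := t + 1) (by rwa [pow_succ'])))) h').1
  have h3 : 2 ^ t ≤ r ^ t := Nat.pow_le_pow_left (by omega) t
  have h4 : 2 ≤ 2 ^ t := Nat.le_self_pow (by omega) 2
  rw [pow_succ] at h1
  nlinarith

theorem six_pow_add_five_pow_eq_sq {w x y : ℕ} (hx : 0 < x) (h : 6 ^ x + 5 ^ y = w ^ 2) :
    w = 29 ∧ x = 3 ∧ y = 4 := by
  obtain ⟨l, hl⟩ := even_of_pow_add_pow_eq_sq Nat.prime_three (a := 5) (b := 6) (by decide)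
    (by norm_num) hx (by rw [add_comm, h])
  obtain rfl : y = 2 * l := by omega
  have hx3 : 3 ≤ x := by
    have h1 : 5 ^ (2 * l) % 8 = 1 := by rw [pow_mul, Nat.pow_mod]; simp
    have h2 := sq_mod_eight w
    by_contra hx3
    obtain rfl | rfl : x = 1 ∨ x = 2 := by omega
    · omega
    · omega
  rcases eq_of_two_mul_pow_add_pow_eq_sq (r := 3) (b := 5) (by simp) h hx3 with ⟨-, h1⟩ | ⟨hw, h1⟩
  · exact absurd h1 (five_pow_add_one_ne hx3)
  · obtain rfl | hx4 : x = 3 ∨ 4 ≤ x := by omega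
    · have : 5 ^ l = 5 ^ 2 := by omega
      obtain rfl := Nat.pow_right_injective (by norm_num : 2 ≤ 5) this
      exact ⟨hw, rfl, rfl⟩
    · exfalso
      have h5 : 5 ^ l % 4 = 1 := by rw [Nat.pow_mod]; simp
      have h4 : 4 ∣ 2 ^ (x - 2) := pow_dvd_pow 2 (by omega : 2 ≤ x - 2)
      have h3 : 3 ^ x % 4 = 3 ^ (x % 2) % 4 := by
        conv_lhs => rw [← Nat.div_add_mod x 2, pow_add, pow_mul, Nat.mul_mod, Nat.pow_mod]
        simp
      obtain ⟨t, rfl⟩ : ∃ t, x = 2 * t := by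
        refine ⟨x / 2, ?_⟩
        have : x % 2 < 2 := Nat.mod_lt _ (by norm_num)
        interval_cases hm : x % 2 <;> omega
      exact pow_add_two_pow_ne_pow_of_even Nat.prime_five (by norm_num) le_rfl (by omega) h1

theorem ten_pow_add_three_pow_ne_sq {w x y : ℕ} (hx : 0 < x) : 10 ^ x + 3 ^ y ≠ w ^ 2 := by
  intro h
  obtain ⟨l, hl⟩ := even_of_pow_add_pow_eq_sq Nat.prime_five (a := 3) (b := 10) (by decide)
    (by norm_num) hx (by rw [add_comm, h])
  obtain rfl : y = 2 * l := by omega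
  have hx3 : 3 ≤ x := by
    have h1 : 3 ^ (2 * l) % 8 = 1 := by rw [pow_mul, Nat.pow_mod]; simp
    have h2 := sq_mod_eight w
    by_contra hx3
    obtain rfl | rfl : x = 1 ∨ x = 2 := by omega
    · omega
    · omega
  rcases eq_of_two_mul_pow_add_pow_eq_sq (r := 5) (b := 3) (by simp) h hx3 with ⟨-, h1⟩ | ⟨-, h1⟩
  · exact three_pow_add_one_ne hx3 h1
  · obtain rfl | hx4 : x = 3 ∨ 4 ≤ x := by omega
    · rcases l with _ | _ | l
      · omega
      · omega
      · rw [pow_add] at h1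
        omega
    · have h5 : 5 ^ x % 4 = 1 := by rw [Nat.pow_mod]; simp
      have h4 : 4 ∣ 2 ^ (x - 2) := pow_dvd_pow 2 (by omega : 2 ≤ x - 2)
      have h20 : 3 ^ l % 20 = 3 ^ (l % 4) % 20 := by
        conv_lhs => rw [← Nat.div_add_mod l 4, pow_add, pow_mul, Nat.mul_mod, Nat.pow_mod]
        simp
      have h2 : 2 ^ (x - 2) % 5 = 2 ^ ((x - 2) % 4) % 5 := by
        conv_lhs => rw [← Nat.div_add_mod (x - 2) 4, pow_add, pow_mul, Nat.mul_mod, Nat.pow_mod]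
        simp
      have h6 : 5 ∣ 5 ^ x := dvd_pow_self 5 hx.ne'
      obtain ⟨t, rfl⟩ : ∃ t, x = 2 * t := by
        refine ⟨x / 2, ?_⟩
        have hm1 : l % 4 < 4 := Nat.mod_lt _ (by norm_num)
        have hm2 : (x - 2) % 4 < 4 := Nat.mod_lt _ (by norm_num)
        interval_cases hm1 : l % 4 <;> interval_cases hm2 : (x - 2) % 4 <;> omega
      exact pow_add_two_pow_ne_pow_of_even Nat.prime_three (by norm_num) (by norm_num) (by omega) h1

theorem sq_eq_seven_mul_sq_add_two {n : ℕ} : ∀ v w : ℕ, v ≤ n → w ^ 2 = 7 * v ^ 2 + 2 →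
    ∃ k, ∀ (R : Type) [CommRing R],
      ((fun z : R × R => (8 * z.1 + 21 * z.2, 3 * z.1 + 8 * z.2))^[k] (3, 1)) = ((w : R), (v : R)) := by
  induction n with
  | zero =>
    intro v w hv h
    obtain rfl : v = 0 := by omega
    have := sq_mod_eight w
    omega
  | succ n ih =>
    intro v w hv h
    obtain hv1 | hv1 : v < 4 ∨ 4 < v ∨ v = 4 := by omega
    · have hw : w < 9 := by nlinarith
      interval_cases v <;> interval_cases w <;> first | omega | skip
      exact ⟨0, fun R _ => by simp⟩
    · rcases hv1 with hv1 | rfl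
      · have h1 : 21 * v ≤ 8 * w := by nlinarith
        have h2 : 3 * w ≤ 8 * v := by nlinarith
        obtain ⟨s, hs⟩ := Nat.exists_eq_add_of_le h1
        obtain ⟨t, ht⟩ := Nat.exists_eq_add_of_le h2
        have hv' : v = 3 * s + 8 * t := by omega
        have hw' : w = 8 * s + 21 * t := by omega
        obtain ⟨k, hk⟩ := ih t s (by omega) (by subst hv' hw'; nlinarith)
        refine ⟨k + 1, fun R _ => ?_⟩
        rw [Function.iterate_succ_apply', hk R]
        ext <;> subst hv' hw' <;> push_cast <;> ring
      · have hw : w < 12 := by nlinarith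
        interval_cases w <;> omega

theorem dvd_of_sq_eq_seven_mul_sq_add_two {v w : ℕ} (h : w ^ 2 = 7 * v ^ 2 + 2) (h7 : 7 ∣ v) :
    617 ∣ v := by
  obtain ⟨k, hk⟩ := sq_eq_seven_mul_sq_add_two v w le_rfl h
  have hk := congrArg Prod.snd (hk (ZMod 4319))
  have hper : ∀ k, (fun z : ZMod 4319 × ZMod 4319 => (8 * z.1 + 21 * z.2, 3 * z.1 + 8 * z.2))^[k]
      (3, 1) = (fun z : ZMod 4319 × ZMod 4319 => (8 * z.1 + 21 * z.2, 3 * z.1 + 8 * z.2))^[k % 7]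
      (3, 1) := by
    intro k
    refine (Function.IsPeriodicPt.iterate_mod_apply ?_ k).symm
    decide +kernel
  rw [hper] at hk
  have hval : v % 4319 ∈ (Finset.range 7).image fun i => ((fun z : ZMod 4319 × ZMod 4319 =>
      (8 * z.1 + 21 * z.2, 3 * z.1 + 8 * z.2))^[i] (3, 1)).2.val := by
    rw [Finset.mem_image]
    exact ⟨k % 7, Finset.mem_range.2 (Nat.mod_lt _ (by norm_num)), by rw [hk, ZMod.val_natCast]⟩
  have hdvd : ∀ i ∈ (Finset.range 7).image fun i => ((fun z : ZMod 4319 × ZMod 4319 =>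
      (8 * z.1 + 21 * z.2, 3 * z.1 + 8 * z.2))^[i] (3, 1)).2.val, i % 7 = 0 → i % 617 = 0 := by
    decide +kernel
  have := hdvd _ hval (by omega)
  omega

theorem two_pow_add_seven_pow_eq_sq {w x y : ℕ} (hx : 0 < x) (hy : 0 < y)
    (h : 2 ^ x + 7 ^ y = w ^ 2) : w = 3 ∨ w = 9 := by
  have hsq := sq_mod_eight w
  have h8 : 7 ^ y % 16 = 7 ^ (y % 2) % 16 := by
    conv_lhs => rw [← Nat.div_add_mod y 2, pow_add, pow_mul, Nat.mul_mod, Nat.pow_mod]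
    simp
  obtain rfl | rfl | hx3 : x = 1 ∨ x = 2 ∨ 3 ≤ x := by omega
  · left
    obtain ⟨j, rfl⟩ : ∃ j, y = 2 * j + 1 := by
      refine ⟨y / 2, ?_⟩
      obtain hm | hm : y % 2 = 0 ∨ y % 2 = 1 := by omega
      · rw [hm] at h8
        omega
      · omega
    have hpell : w ^ 2 = 7 * (7 ^ j) ^ 2 + 2 := by rw [← h]; ring
    rcases j with _ | j
    · norm_num at h
      nlinarith
    · exfalso
      have := dvd_of_sq_eq_seven_mul_sq_add_two hpell (dvd_pow_self 7 (by omega))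
      exact absurd ((by norm_num : Nat.Prime 617).dvd_of_dvd_pow this) (by norm_num)
  · exfalso
    obtain hm | hm : y % 2 = 0 ∨ y % 2 = 1 := by omega
    · rw [hm] at h8
      omega
    · rw [hm] at h8
      omega
  · right
    have h2 : 8 ∣ 2 ^ x := pow_dvd_pow 2 hx3
    obtain ⟨l, rfl⟩ : ∃ l, y = 2 * l := by
      refine ⟨y / 2, ?_⟩
      obtain hm | hm : y % 2 = 0 ∨ y % 2 = 1 := by omega
      · omega
      · rw [hm] at h8
        omega
    have h7 : 7 ^ l % 16 = 7 ^ (l % 2) % 16 := by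
      conv_lhs => rw [← Nat.div_add_mod l 2, pow_add, pow_mul, Nat.mul_mod, Nat.pow_mod]
      simp
    have hl2 : l % 2 < 2 := Nat.mod_lt _ (by norm_num)
    have h70 : 7 ∣ 7 ^ l := dvd_pow_self 7 (by omega)
    have h71 : 0 < 7 ^ l := pow_pos (by norm_num) l
    have hlt : 7 ^ l < w := lt_of_pow_lt_pow_left₀ 2 (Nat.zero_le w) (by
      rw [← h, ← pow_mul, mul_comm l]
      have := pow_pos (two_pos : 0 < 2) x
      omega)
    obtain ⟨s, rfl⟩ := Nat.exists_eq_add_of_lt hlt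
    have hfac : (s + 1) * (2 * 7 ^ l + (s + 1)) = 2 ^ x := by
      have : (s + 1) * (2 * 7 ^ l + (s + 1)) + 7 ^ (2 * l) = 2 ^ x + 7 ^ (2 * l) := by
        rw [h]; ring
      omega
    obtain ⟨i, -, hi⟩ := (Nat.dvd_prime_pow Nat.prime_two).1 (Dvd.intro _ hfac)
    obtain ⟨j, -, hj⟩ := (Nat.dvd_prime_pow Nat.prime_two).1 (Dvd.intro_left _ hfac)
    obtain ⟨j, rfl⟩ : ∃ t, j = t + 1 := by
      refine ⟨j - 1, ?_⟩
      rcases j with _ | j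
      · omega
      · rfl
    rcases i with _ | _ | i
    · rw [pow_succ] at hj
      omega
    · obtain hj4 | hj4 : j < 4 ∨ 4 ≤ j := by omega
      · interval_cases j <;> omega
      · have : 16 ∣ 2 ^ j := pow_dvd_pow 2 hj4
        rw [pow_succ] at hj
        interval_cases l % 2 <;> omega
    · rw [pow_add] at hi
      rcases j with _ | j
      · omega
      · rw [pow_succ, pow_succ] at hj
        interval_cases l % 2 <;> omega

theorem pow_add_pow_eq_sq {a b c x y : ℕ} (hab : (a, b) ∈ evenOddPairs) (hx : 0 < x) (hy : 0 < y)
    (h : a ^ x + b ^ y = c ^ 2) :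
    (a, b, c) ∈ [(2, 3, 5), (2, 5, 3), (2, 7, 3), (2, 7, 9), (6, 5, 29)] := by
  simp only [evenOddPairs, List.mem_cons, Prod.mk.injEq, List.not_mem_nil, or_false] at hab
  rcases hab with ⟨rfl, rfl⟩ | ⟨rfl, rfl⟩ | ⟨rfl, rfl⟩ | ⟨rfl, rfl⟩ | ⟨rfl, rfl⟩ | ⟨rfl, rfl⟩ |
    ⟨rfl, rfl⟩
  · simp [two_pow_add_three_pow_eq_sq hx hy h]
  · simp [two_pow_add_five_pow_eq_sq hx hy h]
  · rcases two_pow_add_seven_pow_eq_sq hx hy h with rfl | rfl <;> simp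
  · exact absurd h (ten_pow_add_three_pow_ne_sq hx)
  · simp [(six_pow_add_five_pow_eq_sq hx h).1]
  · exact absurd h (six_pow_add_seven_pow_ne_sq hy)
  · exact absurd h (ten_pow_add_seven_pow_ne_sq hy)

theorem pow_add_pow_eq_cube {a b c x y : ℕ} (hab : (a, b) ∈ evenOddPairs) (hx : 0 < x)
    (hy : 0 < y) (h : a ^ x + b ^ y = c ^ 3) :
    (a, b, c) ∈ [(2, 5, 3), (10, 3, 13), (10, 3, 7)] := by
  simp only [evenOddPairs, List.mem_cons, Prod.mk.injEq, List.not_mem_nil, or_false] at hab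
  rcases hab with ⟨rfl, rfl⟩ | ⟨rfl, rfl⟩ | ⟨rfl, rfl⟩ | ⟨rfl, rfl⟩ | ⟨rfl, rfl⟩ | ⟨rfl, rfl⟩ |
    ⟨rfl, rfl⟩
  · exact absurd (two_pow_add_pow_eq_cube (by simp) hx hy h).1 (by norm_num)
  · simp [(two_pow_add_pow_eq_cube (by simp) hx hy h).2.1]
  · exact absurd (two_pow_add_pow_eq_cube (by simp) hx hy h).1 (by norm_num)
  · rcases ten_pow_add_three_pow_eq_cube hx hy h with rfl | ⟨rfl, -⟩ <;> simp
  · exact absurd h (six_pow_add_pow_ne_cube (by simp) hx hy)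
  · exact absurd h (six_pow_add_pow_ne_cube (by simp) hx hy)
  · exact absurd h (ten_pow_add_seven_pow_ne_cube hx hy)

theorem eq_and_eq_one_of_pow_eq_prime {c d p : ℕ} (hp : p.Prime) (h : c ^ d = p) :
    c = p ∧ d = 1 := by
  obtain rfl : d = 1 := Nat.Prime.eq_one_of_pow (h ▸ hp)
  exact ⟨by simpa using h, rfl⟩

theorem exponent_eq_one_of_pow_add_pow_eq {a b c x y z : ℕ} (hab : (a, b) ∈ evenOddPairs)
    (hc : ¬ ∃ m k : ℕ, 1 ≤ m ∧ 2 ≤ k ∧ c = m ^ k) (hx : 0 < x) (hy : 0 < y) (hz : 0 < z)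
    (hE : (a, b, c) ∉ [(2, 3, 5), (2, 5, 3), (2, 7, 3), (10, 3, 13)])
    (h : a ^ x + b ^ y = c ^ z) :
    z = 1 ∨ ((a, b, c) = (6, 5, 29) ∧ z = 2) ∨ ((a, b, c) = (10, 3, 7) ∧ z = 3) := by
  refine or_iff_not_imp_left.2 fun hz1 => ?_
  obtain ⟨d, hd⟩ := Nat.minFac_dvd z
  have hq := Nat.minFac_prime hz1
  generalize z.minFac = q at hd hq
  subst hd
  rw [mul_comm, pow_mul] at h
  obtain rfl | rfl | hq5 : q = 2 ∨ q = 3 ∨ 5 ≤ q := by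
    by_contra! hcon
    have := hq.two_le
    obtain rfl : q = 4 := by omega
    exact absurd hq (by norm_num)
  · have h9 : c ^ d = 9 → c = 3 := by
      intro h9
      obtain ⟨i, -, rfl⟩ := (Nat.dvd_prime_pow Nat.prime_three).1
        (show c ∣ 3 ^ 2 from (dvd_pow_self c (by rintro rfl; omega)).trans (dvd_of_eq h9))
      rcases i with _ | _ | i
      · simp at h9
      · rfl
      · exact absurd ⟨3, i + 1 + 1, by norm_num, by omega, rfl⟩ hc
    have := pow_add_pow_eq_sq hab hx hy h
    simp only [List.mem_cons, Prod.mk.injEq, List.not_mem_nil, or_false] at this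
    rcases this with ⟨rfl, rfl, h1⟩ | ⟨rfl, rfl, h1⟩ | ⟨rfl, rfl, h1⟩ | ⟨rfl, rfl, h1⟩ |
      ⟨rfl, rfl, h1⟩
    · simp [(eq_and_eq_one_of_pow_eq_prime (by norm_num) h1).1] at hE
    · simp [(eq_and_eq_one_of_pow_eq_prime (by norm_num) h1).1] at hE
    · simp [(eq_and_eq_one_of_pow_eq_prime (by norm_num) h1).1] at hE
    · simp [h9 h1] at hE
    · obtain ⟨rfl, rfl⟩ := eq_and_eq_one_of_pow_eq_prime (by norm_num) h1
      simp
  · have := pow_add_pow_eq_cube hab hx hy h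
    simp only [List.mem_cons, Prod.mk.injEq, List.not_mem_nil, or_false] at this
    rcases this with ⟨rfl, rfl, h1⟩ | ⟨rfl, rfl, h1⟩ | ⟨rfl, rfl, h1⟩
    · simp [(eq_and_eq_one_of_pow_eq_prime (by norm_num) h1).1] at hE
    · simp [(eq_and_eq_one_of_pow_eq_prime (by norm_num) h1).1] at hE
    · obtain ⟨rfl, rfl⟩ := eq_and_eq_one_of_pow_eq_prime (by norm_num) h1
      simp
  · exact absurd h (pow_add_pow_ne_pow_prime hab hx hy hq hq5)

theorem exponent_unique_of_evenOddPairs {a b c x₁ y₁ z₁ x₂ y₂ z₂ : ℕ}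
    (hab : (a, b) ∈ evenOddPairs) (hc : ¬ ∃ m k : ℕ, 1 ≤ m ∧ 2 ≤ k ∧ c = m ^ k)
    (hx₁ : 0 < x₁) (hy₁ : 0 < y₁) (hz₁ : 0 < z₁) (hx₂ : 0 < x₂) (hy₂ : 0 < y₂) (hz₂ : 0 < z₂)
    (hE : (a, b, c) ∉ [(2, 3, 5), (2, 5, 3), (2, 7, 3), (10, 3, 13)])
    (h₁ : a ^ x₁ + b ^ y₁ = c ^ z₁) (h₂ : a ^ x₂ + b ^ y₂ = c ^ z₂) : z₁ = z₂ := by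
  have key : ∀ {x y : ℕ}, 0 < x → 0 < y → a ^ x + b ^ y = c ^ 1 →
      (a, b, c) ≠ (6, 5, 29) ∧ (a, b, c) ≠ (10, 3, 7) := by
    intro x y hx hy h
    constructor
    · rintro ⟨⟩
      have h5 : 5 ∣ 5 ^ y := dvd_pow_self 5 hy.ne'
      have := pow_pos (by norm_num : 0 < 5) y
      obtain hx2 | hx2 : x < 2 ∨ 2 ≤ x := by omega
      · interval_cases x
        omega
      · have := Nat.pow_le_pow_right (by norm_num : 0 < 6) hx2
        omega
    · rintro ⟨⟩
      have := pow_pos (by norm_num : 0 < 3) y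
      have := Nat.pow_le_pow_right (by norm_num : 0 < 10) hx
      omega
  rcases exponent_eq_one_of_pow_add_pow_eq hab hc hx₁ hy₁ hz₁ hE h₁ with
    rfl | ⟨e₁, rfl⟩ | ⟨e₁, rfl⟩ <;>
  rcases exponent_eq_one_of_pow_add_pow_eq hab hc hx₂ hy₂ hz₂ hE h₂ with
    rfl | ⟨e₂, rfl⟩ | ⟨e₂, rfl⟩
  · rfl
  · exact absurd e₂ (key hx₁ hy₁ h₁).1
  · exact absurd e₂ (key hx₁ hy₁ h₁).2
  · exact absurd e₁ (key hx₂ hy₂ h₂).1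
  · rfl
  · simp [e₁] at e₂
  · exact absurd e₁ (key hx₂ hy₂ h₂).2
  · simp [e₁] at e₂
  · rfl

theorem unique_of_pow_add_pow_eq_pow {a b c x₁ y₁ x₂ y₂ z : ℕ} (hab : (a, b) ∈ smallPairs)
    (hx₁ : 0 < x₁) (hy₁ : 0 < y₁) (hx₂ : 0 < x₂) (hy₂ : 0 < y₂)
    (hE : (a, b, c) ∉ [(2, 3, 11), (2, 3, 35), (2, 3, 259), (2, 5, 133)])
    (h₁ : a ^ x₁ + b ^ y₁ = c ^ z) (h₂ : a ^ x₂ + b ^ y₂ = c ^ z) : x₁ = x₂ ∧ y₁ = y₂ := by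
  have ha2 : 2 ≤ a := (by decide : ∀ p ∈ smallPairs, 2 ≤ p.1) _ hab
  have hb2 : 2 ≤ b := (by decide : ∀ p ∈ smallPairs, 2 ≤ p.2) _ hab
  have key : ∀ {x₁ y₁ x₂ y₂ : ℕ}, 0 < y₁ → 0 < x₂ → x₂ < x₁ →
      a ^ x₁ + b ^ y₁ = c ^ z → a ^ x₂ + b ^ y₂ = c ^ z → False := by
    intro x₁ y₁ x₂ y₂ hy₁ hx₂ hlt h₁ h₂
    have hax := Nat.pow_lt_pow_right (by omega : 1 < a) hlt
    have hy : y₁ < y₂ := (Nat.pow_lt_pow_iff_right (by omega : 1 < b)).1 (by omega)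
    have hmem := pillai_small hab hx₂ hy₁ hlt hy (h₁.trans h₂.symm)
    rw [h₁] at hmem
    have hsf : Squarefree (c ^ z) := by
      have : c ^ z ∈ [11, 35, 259, 133] := by
        simp only [List.mem_cons, Prod.mk.injEq, List.not_mem_nil, or_false] at hmem ⊢
        tauto
      exact (by decide +kernel : ∀ n ∈ [11, 35, 259, 133], Squarefree n) _ this
    have hz : z ≠ 0 := by
      rintro rfl
      simp at hmem
    have hc1 : c ≠ 1 := by
      rintro rfl
      simp at hmem
    obtain rfl := ((Nat.squarefree_pow_iff hc1 hz).1 hsf).2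
    exact hE (by simpa using hmem)
  rcases lt_trichotomy x₁ x₂ with hlt | rfl | hlt
  · exact (key hy₂ hx₁ hlt h₂ h₁).elim
  · exact ⟨rfl, Nat.pow_right_injective hb2 (by dsimp only; omega)⟩
  · exact (key hy₁ hx₂ hlt h₁ h₂).elim

theorem unique_of_smallPairs {a b c x₁ y₁ z₁ x₂ y₂ z₂ : ℕ}
    (hab : (a, b) ∈ smallPairs) (hc : ¬ ∃ m k : ℕ, 1 ≤ m ∧ 2 ≤ k ∧ c = m ^ k) (hc1 : 1 < c)
    (hx₁ : 0 < x₁) (hy₁ : 0 < y₁) (hz₁ : 0 < z₁) (hx₂ : 0 < x₂) (hy₂ : 0 < y₂) (hz₂ : 0 < z₂)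
    (hE : (a, b, c) ∉ [(2, 3, 5), (2, 3, 11), (2, 3, 35), (2, 3, 259), (2, 5, 3),
      (2, 5, 133), (2, 7, 3), (3, 5, 2), (3, 10, 13)])
    (h₁ : a ^ x₁ + b ^ y₁ = c ^ z₁) (h₂ : a ^ x₂ + b ^ y₂ = c ^ z₂) :
    x₁ = x₂ ∧ y₁ = y₂ ∧ z₁ = z₂ := by
  have hz : z₁ = z₂ := by
    have hcases := (by decide : ∀ p ∈ smallPairs, p ∈ evenOddPairs ∨ p.swap ∈ evenOddPairs ∨
      p ∈ [(3, 5), (3, 7), (5, 7)]) _ hab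
    rcases hcases with hp | hp | hp
    · refine exponent_unique_of_evenOddPairs hp hc hx₁ hy₁ hz₁ hx₂ hy₂ hz₂ ?_ h₁ h₂
      simp only [List.mem_cons, Prod.mk.injEq, List.not_mem_nil, or_false]
      rintro (⟨rfl, rfl, rfl⟩ | ⟨rfl, rfl, rfl⟩ | ⟨rfl, rfl, rfl⟩ | ⟨rfl, rfl, rfl⟩)
      · simp at hE
      · simp at hE
      · simp at hE
      · exact absurd hab (by decide)
    · refine exponent_unique_of_evenOddPairs hp hc hy₁ hx₁ hz₁ hy₂ hx₂ hz₂ ?_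
        (by rw [add_comm, h₁]) (by rw [add_comm, h₂])
      simp only [List.mem_cons, Prod.mk.injEq, List.not_mem_nil, or_false]
      rintro (⟨rfl, rfl, rfl⟩ | ⟨rfl, rfl, rfl⟩ | ⟨rfl, rfl, rfl⟩ | ⟨rfl, rfl, rfl⟩)
      · exact absurd hab (by decide)
      · exact absurd hab (by decide)
      · exact absurd hab (by decide)
      · simp at hE
    · rcases lt_trichotomy z₁ z₂ with hlt | h | hlt
      · have := eq_three_five_two hp hx₁ hy₁ hz₁ hx₂ hy₂ hlt hc1 h₁ h₂
        simp [this] at hE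
      · exact h
      · have := eq_three_five_two hp hx₂ hy₂ hz₂ hx₁ hy₁ hlt hc1 h₂ h₁
        simp [this] at hE
  subst hz
  have := unique_of_pow_add_pow_eq_pow hab hx₁ hy₁ hx₂ hy₂ (fun h => hE (by
    simp only [List.mem_cons, List.not_mem_nil, or_false] at h
    rcases h with h | h | h | h <;> simp [h])) h₁ h₂
  exact ⟨this.1, this.2, rfl⟩

theorem at_most_one_solution_small_a_b
    (a b c : ℕ) (ha : 2 ≤ a) (ha' : a ≤ 10) (hb : 2 ≤ b) (hb' : b ≤ 10) (hc : 1 < c)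
    (hab : Nat.Coprime a b)
    (hpa : ¬ ∃ m k : ℕ, 1 ≤ m ∧ 2 ≤ k ∧ a = m ^ k)
    (hpb : ¬ ∃ m k : ℕ, 1 ≤ m ∧ 2 ≤ k ∧ b = m ^ k)
    (hpc : ¬ ∃ m k : ℕ, 1 ≤ m ∧ 2 ≤ k ∧ c = m ^ k)
    (hE1 : (a, b, c) ∉ ({(2, 3, 5), (2, 3, 11), (2, 3, 35), (2, 3, 259), (2, 5, 3),
      (2, 5, 133), (2, 7, 3), (3, 5, 2), (3, 10, 13)} : Set (ℕ × ℕ × ℕ)))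
    (hE2 : (b, a, c) ∉ ({(2, 3, 5), (2, 3, 11), (2, 3, 35), (2, 3, 259), (2, 5, 3),
      (2, 5, 133), (2, 7, 3), (3, 5, 2), (3, 10, 13)} : Set (ℕ × ℕ × ℕ))) :
    ∀ x₁ y₁ z₁ x₂ y₂ z₂ : ℕ,
      0 < x₁ → 0 < y₁ → 0 < z₁ → 0 < x₂ → 0 < y₂ → 0 < z₂ →
      a ^ x₁ + b ^ y₁ = c ^ z₁ → a ^ x₂ + b ^ y₂ = c ^ z₂ →
      (x₁, y₁, z₁) = (x₂, y₂, z₂) := by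
  intro x₁ y₁ z₁ x₂ y₂ z₂ hx₁ hy₁ hz₁ hx₂ hy₂ hz₂ h₁ h₂
  have hnp : ∀ n, (¬ ∃ m k : ℕ, 1 ≤ m ∧ 2 ≤ k ∧ n = m ^ k) → n ∉ [4, 8, 9] := by
    intro n hn hmem
    fin_cases hmem
    · exact hn ⟨2, 2, by norm_num⟩
    · exact hn ⟨2, 3, by norm_num⟩
    · exact hn ⟨3, 2, by norm_num⟩
  have hmem : (a, b) ∈ smallPairs ∨ (b, a) ∈ smallPairs :=
    (by decide : ∀ a ∈ Finset.Icc 2 10, ∀ b ∈ Finset.Icc 2 10, Nat.Coprime a b → a ∉ [4, 8, 9] →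
      b ∉ [4, 8, 9] → (a, b) ∈ smallPairs ∨ (b, a) ∈ smallPairs) a (Finset.mem_Icc.2 ⟨ha, ha'⟩) b
      (Finset.mem_Icc.2 ⟨hb, hb'⟩) hab (hnp a hpa) (hnp b hpb)
  rcases hmem with hmem | hmem
  · obtain ⟨rfl, rfl, rfl⟩ := unique_of_smallPairs hmem hpc hc hx₁ hy₁ hz₁ hx₂ hy₂ hz₂
      (by simpa using hE1) h₁ h₂
    rfl
  · obtain ⟨rfl, rfl, rfl⟩ := unique_of_smallPairs hmem hpc hc hy₁ hx₁ hz₁ hy₂ hx₂ hz₂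
      (by simpa using hE2) (by rw [add_comm, h₁]) (by rw [add_comm, h₂])
    rfl
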